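/- For every ε > 0 there exists δ > 0 such that for all a ∈ [-2+ε, a_F − ε]: if μ is an acip for f_a with log|f_a'| μ-integrable, then h(a) > (1+δ) · ∫ log|f_a'| dμ. -/

import Mathlib

open Filter Set MeasureTheory

/-- The quadratic family `f_a(x) = x² + a`. -/
noncomputable def fa (a : ℝ) : ℝ → ℝ := fun x => x ^ 2 + a

/-- The invariant interval `I_a`. -/
noncomputable def Ia (a : ℝ) : Set ℝ :=
  Set.Icc ((-1 - Real.sqrt (1 - 4 * a)) / 2) ((1 + Real.sqrt (1 - 4 * a)) / 2)

/-- Topological entropy of `f_a` restricted to `I_a`. -/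
noncomputable def h (a : ℝ) : ℝ := (Dynamics.coverEntropy (fa a) (Ia a)).toReal

/-- The Feigenbaum parameter `a_F`. -/
noncomputable def aF : ℝ := sInf {a ∈ Set.Icc (-2 : ℝ) (1 / 4) | h a = 0}

/-- `μ` is an acip for `f_a`. -/
def IsAcip (a : ℝ) (μ : Measure ℝ) : Prop :=
  IsProbabilityMeasure μ ∧ μ (Ia a)ᶜ = 0 ∧ μ.map (fa a) = μ ∧ μ ≪ volume

namespace QuadraticFamily

open Topology

section

variable {a : ℝ}

lemma fa_apply (a x : ℝ) : fa a x = x ^ 2 + a := rfl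

lemma continuous_fa (a : ℝ) : Continuous (fa a) := by
  unfold fa; fun_prop

lemma continuous_iterate (a : ℝ) (n : ℕ) : Continuous (fa a)^[n] :=
  (continuous_fa a).iterate n

lemma fa_neg (a x : ℝ) : fa a (-x) = fa a x := by simp [fa]

lemma iterate_neg (a x : ℝ) {n : ℕ} (hn : n ≠ 0) : (fa a)^[n] (-x) = (fa a)^[n] x := by
  obtain ⟨m, rfl⟩ := Nat.exists_eq_succ_of_ne_zero hn
  rw [Function.iterate_succ_apply, Function.iterate_succ_apply, fa_neg]

lemma hasDerivAt_fa (a x : ℝ) : HasDerivAt (fa a) (2 * x) x := by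
  exact ((hasDerivAt_pow 2 x).add_const a).congr_deriv (by simp)

lemma hasDerivAt_iterate (a x : ℝ) (n : ℕ) :
    HasDerivAt (fa a)^[n] (∏ i ∈ Finset.range n, 2 * (fa a)^[i] x) x := by
  induction n with
  | zero => simpa using hasDerivAt_id x
  | succ n ih =>
    rw [Finset.prod_range_succ, mul_comm, Function.iterate_succ']
    exact (hasDerivAt_fa a _).comp x ih

lemma mul_pos_of_preconnected {g : ℝ → ℝ} (hg : Continuous g) {J : Set ℝ} (hJ : J.OrdConnected)
    (h0 : ∀ x ∈ J, g x ≠ 0) {x y : ℝ} (hx : x ∈ J) (hy : y ∈ J) : 0 < g x * g y := by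
  by_contra hneg
  have hsub : uIcc x y ⊆ J := hJ.uIcc_subset hx hy
  have hne : g x * g y ≠ 0 := mul_ne_zero (h0 x hx) (h0 y hy)
  have hlt : g x * g y < 0 := lt_of_le_of_ne (not_lt.1 hneg) hne
  have h0mem : (0 : ℝ) ∈ uIcc (g x) (g y) := by
    rcases mul_neg_iff.1 hlt with ⟨h1, h2⟩ | ⟨h1, h2⟩
    · exact Set.mem_uIcc.2 (Or.inr ⟨h2.le, h1.le⟩)
    · exact Set.mem_uIcc.2 (Or.inl ⟨h1.le, h2.le⟩)
  obtain ⟨t, ht, ht0⟩ := intermediate_value_uIcc (hg.continuousOn (s := uIcc x y)) h0mem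
  exact h0 t (hsub ht) ht0

lemma mul_nonneg_of_closure {g : ℝ → ℝ} (hg : Continuous g) {J : Set ℝ}
    (hJ : ∀ x ∈ J, ∀ y ∈ J, 0 ≤ g x * g y) {x y : ℝ}
    (hx : x ∈ closure J) (hy : y ∈ closure J) : 0 ≤ g x * g y := by
  have hc : IsClosed {p : ℝ × ℝ | 0 ≤ g p.1 * g p.2} :=
    isClosed_le continuous_const ((hg.comp continuous_fst).mul (hg.comp continuous_snd))
  have hsub : closure (J ×ˢ J) ⊆ {p : ℝ × ℝ | 0 ≤ g p.1 * g p.2} :=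
    closure_minimal (fun p hp => hJ _ hp.1 _ hp.2) hc
  have : (x, y) ∈ closure (J ×ˢ J) := by
    rw [closure_prod_eq]; exact ⟨hx, hy⟩
  exact hsub this

lemma isIntegral_iterate {x : ℝ} (ha : IsIntegral ℤ a) (hx : IsIntegral ℤ x) (n : ℕ) :
    IsIntegral ℤ ((fa a)^[n] x) := by
  induction n with
  | zero => simpa using hx
  | succ n ih =>
    rw [Function.iterate_succ_apply', fa_apply]
    exact (ih.pow 2).add ha

end

section

variable {a : ℝ}

/-- `ψ` is monotone, odd, and semiconjugates `fa a` to the folded map `t ↦ s (|t| - 1)`. -/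
structure FoldSemiconj (a s : ℝ) (ψ : ℝ → ℝ) : Prop where
  mono : Monotone ψ
  odd : ∀ x, ψ (-x) = -ψ x
  map_fa : ∀ x, ψ (fa a x) = s * (|ψ x| - 1)

/-- `ψ` is bi-Lipschitz near `x`. -/
def BiLipAt (ψ : ℝ → ℝ) (x : ℝ) : Prop :=
  ∃ c > 0, ∃ C > 0, ∀ᶠ p in 𝓝 (x, x),
    c * |p.1 - p.2| ≤ |ψ p.1 - ψ p.2| ∧ |ψ p.1 - ψ p.2| ≤ C * |p.1 - p.2|

lemma BiLipAt.neg {ψ : ℝ → ℝ} (hodd : ∀ x, ψ (-x) = -ψ x) {x : ℝ} (hx : BiLipAt ψ x) :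
    BiLipAt ψ (-x) := by
  obtain ⟨c, hc, C, hC, hev⟩ := hx
  refine ⟨c, hc, C, hC, ?_⟩
  have ht : Tendsto (fun p : ℝ × ℝ => (-p.1, -p.2)) (𝓝 (-x, -x)) (𝓝 (x, x)) := by
    have : Continuous (fun p : ℝ × ℝ => (-p.1, -p.2)) := by fun_prop
    simpa using this.tendsto (-x, -x)
  filter_upwards [ht.eventually hev] with p hp
  simp only [hodd] at hp
  rw [show -p.1 - -p.2 = -(p.1 - p.2) by ring, abs_neg,
    show -ψ p.1 - -ψ p.2 = -(ψ p.1 - ψ p.2) by ring, abs_neg] at hp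
  exact hp

lemma isOpen_biLipAt (ψ : ℝ → ℝ) : IsOpen {x | BiLipAt ψ x} := by
  rw [isOpen_iff_mem_nhds]
  rintro x ⟨c, hc, C, hC, hev⟩
  have hd : Tendsto (fun y : ℝ => (y, y)) (𝓝 x) (𝓝 (x, x)) := by
    have : Continuous (fun y : ℝ => (y, y)) := by fun_prop
    exact this.tendsto x
  filter_upwards [hd.eventually (eventually_eventually_nhds.2 hev)] with y hy
  exact ⟨c, hc, C, hC, hy⟩

namespace FoldSemiconj

variable {s : ℝ} {ψ : ℝ → ℝ}

lemma map_zero (hψ : FoldSemiconj a s ψ) : ψ 0 = 0 := by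
  have := hψ.odd 0
  simp at this; linarith

lemma nonneg (hψ : FoldSemiconj a s ψ) {x : ℝ} (hx : 0 ≤ x) : 0 ≤ ψ x := by
  rw [← hψ.map_zero]; exact hψ.mono hx

lemma abs_map_fa_sub (hψ : FoldSemiconj a s ψ) (hs : 0 < s) {x y : ℝ} (hxy : 0 ≤ x * y) :
    |ψ (fa a x) - ψ (fa a y)| = s * |ψ x - ψ y| := by
  have key : ∀ x y : ℝ, 0 ≤ x → 0 ≤ y → |ψ (fa a x) - ψ (fa a y)| = s * |ψ x - ψ y| := by
    intro x y hx hy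
    rw [hψ.map_fa, hψ.map_fa, abs_of_nonneg (hψ.nonneg hx), abs_of_nonneg (hψ.nonneg hy),
      ← mul_sub, abs_mul, abs_of_pos hs]
    congr 2; ring
  rcases le_total 0 x with hx | hx
  · rcases hx.eq_or_lt with rfl | hx'
    · rcases le_total 0 y with hy | hy
      · exact key _ _ le_rfl hy
      · have := key 0 (-y) le_rfl (by linarith)
        rw [fa_neg, hψ.odd, hψ.map_zero] at this
        rw [this, hψ.map_zero, zero_sub, zero_sub, abs_neg]
    · exact key _ _ hx (nonneg_of_mul_nonneg_right hxy hx')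
  · rcases hx.eq_or_lt with rfl | hx'
    · rcases le_total 0 y with hy | hy
      · exact key _ _ le_rfl hy
      · have := key 0 (-y) le_rfl (by linarith)
        rw [fa_neg, hψ.odd, hψ.map_zero] at this
        rw [this, hψ.map_zero, zero_sub, zero_sub, abs_neg]
    · have hy : y ≤ 0 := by
        by_contra hy
        push Not at hy
        nlinarith
      have := key (-x) (-y) (by linarith) (by linarith)
      rw [fa_neg, fa_neg, hψ.odd, hψ.odd] at this
      rw [this, show -ψ x - -ψ y = -(ψ x - ψ y) by ring, abs_neg]

lemma abs_map_iterate_sub (hψ : FoldSemiconj a s ψ) (hs : 0 < s) {x y : ℝ} (n : ℕ)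
    (hxy : ∀ i < n, 0 ≤ (fa a)^[i] x * (fa a)^[i] y) :
    |ψ ((fa a)^[n] x) - ψ ((fa a)^[n] y)| = s ^ n * |ψ x - ψ y| := by
  induction n with
  | zero => simp
  | succ n ih =>
    rw [Function.iterate_succ_apply', Function.iterate_succ_apply',
      hψ.abs_map_fa_sub hs (hxy n (Nat.lt_succ_self n)),
      ih (fun i hi => hxy i (hi.trans (Nat.lt_succ_self n)))]
    ring

lemma biLipAt_fa_of (hψ : FoldSemiconj a s ψ) (hs : 0 < s) {x : ℝ} (hx0 : x ≠ 0)
    (hx : BiLipAt ψ x) : BiLipAt ψ (fa a x) := by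
  wlog hpos : 0 < x generalizing x
  · have := this (x := -x) (by simpa using hx0) (hx.neg hψ.odd)
      (by rcases lt_or_gt_of_ne hx0 with h1 | h1 <;> [linarith; exact absurd h1 hpos])
    rwa [fa_neg] at this
  obtain ⟨c, hc, C, hC, hev⟩ := hx
  have hsq : Tendsto (fun y : ℝ => √(y - a)) (𝓝 (fa a x)) (𝓝 x) := by
    have h1 : Continuous (fun y : ℝ => √(y - a)) := by fun_prop
    have h2 := h1.tendsto (fa a x)
    simpa [fa, Real.sqrt_sq hpos.le] using h2
  have hmap : Tendsto (fun p : ℝ × ℝ => (√(p.1 - a), √(p.2 - a))) (𝓝 (fa a x, fa a x))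
      (𝓝 (x, x)) := by
    rw [nhds_prod_eq, nhds_prod_eq]
    exact hsq.prodMap hsq
  have hbd : ∀ᶠ p : ℝ × ℝ in 𝓝 (x, x), x / 2 < p.1 ∧ x / 2 < p.2 ∧ p.1 < 2 * x ∧ p.2 < 2 * x := by
    rw [nhds_prod_eq]
    have h1 : ∀ᶠ y in 𝓝 x, x / 2 < y := lt_mem_nhds (by linarith)
    have h2 : ∀ᶠ y in 𝓝 x, y < 2 * x := gt_mem_nhds (by linarith)
    filter_upwards [(h1.and h2).prod_mk (h1.and h2)] with p hp
    exact ⟨hp.1.1, hp.2.1, hp.1.2, hp.2.2⟩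
  have hgt : ∀ᶠ p : ℝ × ℝ in 𝓝 (fa a x, fa a x), a < p.1 ∧ a < p.2 := by
    rw [nhds_prod_eq]
    have h1 : ∀ᶠ y in 𝓝 (fa a x), a < y := lt_mem_nhds (by rw [fa_apply]; nlinarith)
    exact h1.prod_mk h1
  refine ⟨s * c / (4 * x), by positivity, s * C / x, by positivity, ?_⟩
  filter_upwards [hmap.eventually hev, hmap.eventually hbd, hgt] with p h1 h2 h3
  obtain ⟨u, hu⟩ : ∃ u, u = √(p.1 - a) := ⟨_, rfl⟩
  obtain ⟨v, hv⟩ : ∃ v, v = √(p.2 - a) := ⟨_, rfl⟩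
  have hp1 : p.1 = fa a u := by
    rw [fa_apply, hu, Real.sq_sqrt (by linarith)]; ring
  have hp2 : p.2 = fa a v := by
    rw [fa_apply, hv, Real.sq_sqrt (by linarith)]; ring
  simp only [← hu, ← hv] at h1 h2
  obtain ⟨ha1, ha2, hb1, hb2⟩ := h2
  rw [hp1, hp2, hψ.abs_map_fa_sub hs (by nlinarith), fa_apply, fa_apply,
    show u ^ 2 + a - (v ^ 2 + a) = (u + v) * (u - v) by ring, abs_mul,
    abs_of_pos (show 0 < u + v by linarith)]
  constructor
  · calc s * c / (4 * x) * ((u + v) * |u - v|) = s * ((u + v) / (4 * x) * (c * |u - v|)) := by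
          field_simp
      _ ≤ s * (1 * (c * |u - v|)) := by
          gcongr
          rw [div_le_one (by positivity)]; linarith
      _ ≤ s * |ψ u - ψ v| := by rw [one_mul]; exact mul_le_mul_of_nonneg_left h1.1 hs.le
  · calc s * |ψ u - ψ v| ≤ s * (1 * (C * |u - v|)) := by
          rw [one_mul]; exact mul_le_mul_of_nonneg_left h1.2 hs.le
      _ ≤ s * ((u + v) / x * (C * |u - v|)) := by
          gcongr
          rw [one_le_div (by positivity)]; linarith
      _ = s * C / x * ((u + v) * |u - v|) := by field_simp

lemma biLipAt_of_fa (hψ : FoldSemiconj a s ψ) (hs : 0 < s) {x : ℝ} (hx0 : x ≠ 0)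
    (hx : BiLipAt ψ (fa a x)) : BiLipAt ψ x := by
  wlog hpos : 0 < x generalizing x
  · have := this (x := -x) (by simpa using hx0) (by rwa [fa_neg])
      (by rcases lt_or_gt_of_ne hx0 with h1 | h1 <;> [linarith; exact absurd h1 hpos])
    simpa using this.neg hψ.odd
  obtain ⟨c, hc, C, hC, hev⟩ := hx
  have hmap : Tendsto (fun p : ℝ × ℝ => (fa a p.1, fa a p.2)) (𝓝 (x, x))
      (𝓝 (fa a x, fa a x)) := by
    rw [nhds_prod_eq, nhds_prod_eq]
    exact ((continuous_fa a).tendsto x).prodMap ((continuous_fa a).tendsto x)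
  have hbd : ∀ᶠ p : ℝ × ℝ in 𝓝 (x, x), x / 2 < p.1 ∧ x / 2 < p.2 ∧ p.1 < 2 * x ∧ p.2 < 2 * x := by
    rw [nhds_prod_eq]
    have h1 : ∀ᶠ y in 𝓝 x, x / 2 < y := lt_mem_nhds (by linarith)
    have h2 : ∀ᶠ y in 𝓝 x, y < 2 * x := gt_mem_nhds (by linarith)
    filter_upwards [(h1.and h2).prod_mk (h1.and h2)] with p hp
    exact ⟨hp.1.1, hp.2.1, hp.1.2, hp.2.2⟩
  refine ⟨c * x / s, by positivity, C * (4 * x) / s, by positivity, ?_⟩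
  filter_upwards [hmap.eventually hev, hbd] with p h1 h2
  obtain ⟨ha1, ha2, hb1, hb2⟩ := h2
  have e1 : |fa a p.1 - fa a p.2| = (p.1 + p.2) * |p.1 - p.2| := by
    rw [fa_apply, fa_apply, show p.1 ^ 2 + a - (p.2 ^ 2 + a) = (p.1 + p.2) * (p.1 - p.2) by ring,
      abs_mul, abs_of_pos (show 0 < p.1 + p.2 by linarith)]
  rw [e1, hψ.abs_map_fa_sub hs (by nlinarith)] at h1
  have hnn := abs_nonneg (p.1 - p.2)
  constructor
  · rw [div_mul_eq_mul_div, div_le_iff₀ hs]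
    have : c * (x * |p.1 - p.2|) ≤ c * ((p.1 + p.2) * |p.1 - p.2|) := by
      gcongr; linarith
    nlinarith [h1.1]
  · rw [div_mul_eq_mul_div, le_div_iff₀ hs]
    have : C * ((p.1 + p.2) * |p.1 - p.2|) ≤ C * (4 * x * |p.1 - p.2|) := by
      gcongr; linarith
    nlinarith [h1.2]

lemma biLipAt_iterate_iff (hψ : FoldSemiconj a s ψ) (hs : 0 < s) {x : ℝ} (n : ℕ)
    (hx : ∀ i < n, (fa a)^[i] x ≠ 0) : BiLipAt ψ ((fa a)^[n] x) ↔ BiLipAt ψ x := by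
  induction n with
  | zero => simp
  | succ n ih =>
    rw [Function.iterate_succ_apply', ← ih (fun i hi => hx i (hi.trans (Nat.lt_succ_self n)))]
    exact ⟨hψ.biLipAt_of_fa hs (hx n (Nat.lt_succ_self n)),
      hψ.biLipAt_fa_of hs (hx n (Nat.lt_succ_self n))⟩

lemma not_biLipAt_param (hψ : FoldSemiconj a s ψ) (hs : 0 < s) (h0 : BiLipAt ψ 0) :
    ¬ BiLipAt ψ a := by
  rintro ⟨c', -, C, hC, hev⟩
  obtain ⟨c, hc, C₀, -, hev0⟩ := h0
  have h1 : Tendsto (fun y : ℝ => (y ^ 2 + a, a)) (𝓝[>] 0) (𝓝 (a, a)) := by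
    have : Continuous (fun y : ℝ => (y ^ 2 + a, a)) := by fun_prop
    have h2 := this.tendsto 0
    simp only [ne_eq, OfNat.ofNat_ne_zero, not_false_eq_true, zero_pow, zero_add] at h2
    exact h2.mono_left nhdsWithin_le_nhds
  have h2 : Tendsto (fun y : ℝ => (y, (0 : ℝ))) (𝓝[>] 0) (𝓝 (0, 0)) := by
    have : Continuous (fun y : ℝ => (y, (0 : ℝ))) := by fun_prop
    exact (this.tendsto 0).mono_left nhdsWithin_le_nhds
  have h3 : ∀ᶠ y : ℝ in 𝓝[>] 0, y < s * c / C :=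
    nhdsWithin_le_nhds (gt_mem_nhds (by positivity))
  obtain ⟨y, hy1, hy2, hy3, hy4⟩ := ((h1.eventually hev).and ((h2.eventually hev0).and
    (h3.and self_mem_nhdsWithin))).exists
  have hy4' : 0 < y := hy4
  have e := hψ.abs_map_fa_sub hs (x := y) (y := 0) (by simp)
  rw [fa_apply, fa_apply] at e
  simp only [ne_eq, OfNat.ofNat_ne_zero, not_false_eq_true, zero_pow, zero_add] at e
  have i1 := hy1.2
  simp only [add_sub_cancel_right, sub_zero] at i1 hy2
  rw [e, abs_of_nonneg (sq_nonneg y)] at i1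
  have i2 := hy2.1
  rw [abs_of_pos hy4'] at i2
  rw [lt_div_iff₀ hC] at hy3
  nlinarith

/-- An open interval on which `ψ` is nonconstant eventually covers the critical point. -/
lemma exists_iterate_eq_zero (hψ : FoldSemiconj a s ψ) (hs : 1 < s) {B : ℝ} (hB : ∀ x, |ψ x| ≤ B)
    {J : Set ℝ} (hJ : J.OrdConnected) {x y : ℝ} (hx : x ∈ J) (hy : y ∈ J) (hne : ψ x ≠ ψ y) :
    ∃ n, ∃ z ∈ J, (fa a)^[n] z = 0 := by
  by_contra! hcon
  have hpos : 0 < |ψ x - ψ y| := abs_pos.2 (sub_ne_zero.2 hne)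
  obtain ⟨n, hn⟩ := pow_unbounded_of_one_lt (2 * B / |ψ x - ψ y|) hs
  have e := hψ.abs_map_iterate_sub (zero_lt_one.trans hs) (x := x) (y := y) n (fun i _ =>
    (mul_pos_of_preconnected (continuous_iterate a i) hJ (fun z hz => hcon i z hz) hx hy).le)
  have : |ψ ((fa a)^[n] x) - ψ ((fa a)^[n] y)| ≤ 2 * B :=
    (abs_sub _ _).trans (by linarith [hB ((fa a)^[n] x), hB ((fa a)^[n] y)])
  rw [div_lt_iff₀ hpos] at hn
  linarith

end FoldSemiconj

end

section

variable {a : ℝ}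

lemma eventually_abs_sub_of_hasDerivAt {g : ℝ → ℝ} {D t : ℝ} (hg : HasDerivAt g D t) (hD : D ≠ 0) :
    ∀ᶠ y in 𝓝 t, |D| / 2 * |y - t| ≤ |g y - g t| ∧ |g y - g t| ≤ 2 * |D| * |y - t| := by
  have hD' : 0 < |D| := abs_pos.2 hD
  have := (hasDerivAt_iff_isLittleO.1 hg).def (show 0 < |D| / 2 by positivity)
  filter_upwards [this] with y hy
  simp only [smul_eq_mul, Real.norm_eq_abs] at hy
  have h1 : |(y - t) * D| = |D| * |y - t| := by rw [abs_mul, mul_comm]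
  constructor
  · have := abs_sub_abs_le_abs_sub ((y - t) * D) (g y - g t)
    rw [abs_sub_comm] at hy
    rw [abs_sub_comm ((y - t) * D)] at this
    rw [abs_sub_comm] at hy
    nlinarith
  · have h2 := abs_add_le (g y - g t - (y - t) * D) ((y - t) * D)
    rw [sub_add_cancel] at h2
    nlinarith [abs_nonneg (y - t)]

/-- The critical orbit as a polynomial in the parameter. -/
noncomputable def critPoly : ℕ → Polynomial ℤ
  | 0 => 0
  | n + 1 => critPoly n ^ 2 + Polynomial.X

lemma aeval_critPoly (a : ℝ) (n : ℕ) : Polynomial.aeval a (critPoly n) = (fa a)^[n] 0 := by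
  induction n with
  | zero => simp [critPoly]
  | succ n ih => rw [critPoly, Function.iterate_succ_apply', fa_apply, ← ih]; simp

lemma natDegree_critPoly (n : ℕ) :
    (critPoly (n + 1)).Monic ∧ (critPoly (n + 1)).natDegree = 2 ^ n := by
  induction n with
  | zero => simp [critPoly, Polynomial.monic_X]
  | succ n ih =>
    have h1 : (critPoly (n + 1) ^ 2).Monic := ih.1.pow 2
    have h2 : (critPoly (n + 1) ^ 2).natDegree = 2 ^ (n + 1) := by
      rw [ih.1.natDegree_pow, ih.2]; ring
    have h3 : (Polynomial.X : Polynomial ℤ).degree < (critPoly (n + 1) ^ 2).degree := by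
      rw [Polynomial.degree_X, Polynomial.degree_eq_natDegree h1.ne_zero, h2]
      have : 1 < 2 ^ (n + 1) := Nat.one_lt_two_pow (by omega)
      exact_mod_cast this
    rw [critPoly]
    exact ⟨h1.add_of_left h3, by rw [Polynomial.natDegree_add_eq_left_of_degree_lt h3, h2]⟩

lemma isIntegral_param {q : ℕ} (hq : q ≠ 0)
    (hc : (fa a)^[2 * q] 0 + (fa a)^[q] 0 = 0) : IsIntegral ℤ a := by
  obtain ⟨m, rfl⟩ := Nat.exists_eq_succ_of_ne_zero hq
  refine ⟨critPoly (2 * (m + 1)) + critPoly (m + 1), ?_, ?_⟩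
  · have h1 := natDegree_critPoly (2 * m + 1)
    have h2 := natDegree_critPoly m
    rw [show 2 * (m + 1) = 2 * m + 1 + 1 by ring]
    refine h1.1.add_of_left ?_
    rw [Polynomial.degree_eq_natDegree h1.1.ne_zero, Polynomial.degree_eq_natDegree h2.1.ne_zero,
      h1.2, h2.2]
    exact_mod_cast Nat.pow_lt_pow_right (by norm_num) (by omega)
  · rw [← Polynomial.aeval_def, map_add, aeval_critPoly, aeval_critPoly]
    exact hc

/-- If the critical point lands after `q` steps on the mirror image of a `q`-periodic point `b`
whose multiplier is `±4`, then the map is the Chebyshev map. -/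
lemma param_le_neg_two {q : ℕ} (hq : q ≠ 0) {b : ℝ} (hb : (fa a)^[q] b = b)
    (hc : (fa a)^[q] 0 = -b) (hb0 : b ≠ 0) (ha0 : q ≠ 1 → a ≠ 0)
    (hmul : |∏ i ∈ Finset.range q, 2 * (fa a)^[i] b| = 4) : a ≤ -2 := by
  have ha : IsIntegral ℤ a := by
    refine isIntegral_param hq ?_
    rw [two_mul, Function.iterate_add_apply, hc, iterate_neg a b hq, hb]; ring
  have hbint : IsIntegral ℤ b := by
    have := (isIntegral_iterate ha (isIntegral_zero (R := ℤ) (B := ℝ)) q).neg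
    rwa [hc, neg_neg] at this
  rw [Finset.prod_mul_distrib, Finset.prod_const, Finset.card_range, abs_mul, abs_pow,
    abs_two] at hmul
  have hq2 : q ≤ 2 := by
    by_contra hq2
    push Not at hq2
    obtain ⟨r, rfl⟩ : ∃ r, q = r + 3 := ⟨q - 3, by omega⟩
    have hprod : IsIntegral ℤ (∏ i ∈ Finset.range (r + 3), (fa a)^[i] b) :=
      IsIntegral.prod _ (fun i _ => isIntegral_iterate ha hbint i)
    have h2 : IsIntegral ℤ ((2 : ℝ) ^ r * |∏ i ∈ Finset.range (r + 3), (fa a)^[i] b|) := by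
      refine ((isIntegral_algebraMap (R := ℤ) (x := (2 : ℤ)) : IsIntegral ℤ (algebraMap ℤ ℝ 2)).pow r).mul ?_
      rcases abs_choice (∏ i ∈ Finset.range (r + 3), (fa a)^[i] b) with h3 | h3 <;> rw [h3]
      exacts [hprod, hprod.neg]
    have h3 : (2 : ℝ) ^ r * |∏ i ∈ Finset.range (r + 3), (fa a)^[i] b| = algebraMap ℚ ℝ (1 / 2) := by
      rw [pow_add] at hmul
      simp only [one_div, map_inv₀, map_ofNat]
      linarith
    rw [h3, isIntegral_algebraMap_iff (algebraMap ℚ ℝ).injective] at h2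
    obtain ⟨m, hm⟩ := IsIntegrallyClosed.isIntegral_iff.1 h2
    have h4 : (m : ℚ) = 1 / 2 := by simpa using hm
    have h5 : ((2 * m : ℤ) : ℚ) = 1 := by push_cast; rw [h4]; norm_num
    have h6 : 2 * m = 1 := by exact_mod_cast h5
    omega
  interval_cases q
  · exact absurd rfl hq
  · simp only [Function.iterate_one, fa_apply] at hb hc
    have : b * (b - 2) = 0 := by nlinarith
    rcases mul_eq_zero.1 this with h1 | h1
    · exact absurd h1 hb0
    · have : b = 2 := by linarith
      subst this; linarith
  · have ha0' := ha0 (by norm_num)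
    obtain ⟨d, hd⟩ : ∃ d, d = b ^ 2 + a := ⟨_, rfl⟩
    simp only [Function.iterate_succ, Function.iterate_zero, Function.comp_apply, id_eq,
      fa_apply] at hb
    rw [← hd] at hb
    simp only [Finset.prod_range_succ, Finset.prod_range_zero, one_mul, Function.iterate_zero, id_eq,
      Function.iterate_one, fa_apply, ← hd] at hmul
    have hbd : |b * d| = 1 := by linarith
    have hfac : (d - b) * (d + b + 1) = 0 := by nlinarith
    rcases mul_eq_zero.1 hfac with h1 | h1
    · have hdb : d = b := by linarith
      subst hdb
      rw [abs_mul_self] at hbd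
      have : (d - 1) * (d + 1) = 0 := by nlinarith
      rcases mul_eq_zero.1 this with h2 | h2
      · exact absurd (by nlinarith) ha0'
      · nlinarith
    · have hdb : d = -1 - b := by linarith
      subst hdb
      rcases abs_eq (by norm_num : (0 : ℝ) ≤ 1) |>.1 hbd with h2 | h2
      · nlinarith [sq_nonneg (b + 1 / 2)]
      · nlinarith

end

section

variable {a : ℝ}

lemma BiLipAt.eventually_ne {ψ : ℝ → ℝ} {x : ℝ} (hx : BiLipAt ψ x) :
    ∀ᶠ y in 𝓝[≠] x, ψ y ≠ ψ x := by
  obtain ⟨c, hc, C, -, hev⟩ := hx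
  have h2 : Tendsto (fun y : ℝ => (y, x)) (𝓝[≠] x) (𝓝 (x, x)) := by
    have : Continuous (fun y : ℝ => (y, x)) := by fun_prop
    exact (this.tendsto x).mono_left nhdsWithin_le_nhds
  filter_upwards [h2.eventually hev, self_mem_nhdsWithin] with y hy hne heq
  have h3 := hy.1
  simp only [heq, sub_self, abs_zero] at h3
  have : 0 < |y - x| := abs_pos.2 (sub_ne_zero.2 hne)
  nlinarith

namespace FoldSemiconj

variable {s : ℝ} {ψ : ℝ → ℝ}

lemma biLipAt_zero (hψ : FoldSemiconj a s ψ) (hs : 1 < s) {B : ℝ} (hB : ∀ x, |ψ x| ≤ B)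
    {x₀ : ℝ} (hx₀ : BiLipAt ψ x₀) : BiLipAt ψ 0 := by
  obtain ⟨r, hr, hball⟩ := Metric.isOpen_iff.1 (isOpen_biLipAt ψ) x₀ hx₀
  have hmem : ∀ᶠ y in 𝓝[≠] x₀, y ∈ Metric.ball x₀ r :=
    nhdsWithin_le_nhds (Metric.ball_mem_nhds x₀ hr)
  obtain ⟨y, hy1, hy2⟩ := (hx₀.eventually_ne.and hmem).exists
  have hJ : (Metric.ball x₀ r).OrdConnected := by
    rw [Real.ball_eq_Ioo]; exact ordConnected_Ioo
  obtain ⟨n, z, hz, hn⟩ := hψ.exists_iterate_eq_zero hs hB hJ hy2 (Metric.mem_ball_self hr) hy1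
  classical
  have hex : ∃ n, (fa a)^[n] z = 0 := ⟨n, hn⟩
  have := (hψ.biLipAt_iterate_iff (zero_lt_one.trans hs) (Nat.find hex)
    (fun i hi => Nat.find_min hex hi)).2 (hball hz)
  rwa [Nat.find_spec hex] at this

lemma not_biLipAt_crit (hψ : FoldSemiconj a s ψ) (hs : 0 < s) (h0 : BiLipAt ψ 0) (n : ℕ) :
    ¬ BiLipAt ψ ((fa a)^[n + 1] 0) := by
  induction n with
  | zero => simpa [fa] using hψ.not_biLipAt_param hs h0
  | succ n ih =>
    intro hcon
    rw [Function.iterate_succ_apply'] at hcon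
    exact ih (hψ.biLipAt_of_fa hs (fun h1 => ih (by rw [h1]; exact h0)) hcon)

/-- Near the critical point, `f^[q]` is quadratic as long as the critical orbit does not return. -/
lemma _root_.QuadraticFamily.eventually_abs_iterate_sub_crit {q : ℕ} (hq : q ≠ 0)
    (hc : ∀ i, i ≠ 0 → i < q → (fa a)^[i] 0 ≠ 0) :
    ∃ D > 0, ∀ᶠ y in 𝓝 (0 : ℝ), D / 2 * y ^ 2 ≤ |(fa a)^[q] y - (fa a)^[q] 0| ∧
      |(fa a)^[q] y - (fa a)^[q] 0| ≤ 2 * D * y ^ 2 := by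
  obtain ⟨m, rfl⟩ := Nat.exists_eq_succ_of_ne_zero hq
  have hD : ∏ i ∈ Finset.range m, 2 * (fa a)^[i] (fa a 0) ≠ 0 := by
    refine Finset.prod_ne_zero_iff.2 fun i hi => mul_ne_zero two_ne_zero ?_
    rw [← Function.iterate_succ_apply]
    exact hc _ (by simp) (by have := Finset.mem_range.1 hi; omega)
  refine ⟨_, abs_pos.2 hD, ?_⟩
  have h1 := ((continuous_fa a).tendsto 0).eventually
    (eventually_abs_sub_of_hasDerivAt (hasDerivAt_iterate a (fa a 0) m) hD)
  filter_upwards [h1] with y hy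
  have e : |fa a y - fa a 0| = y ^ 2 := by
    rw [fa_apply, fa_apply, show y ^ 2 + a - (0 ^ 2 + a) = y ^ 2 by ring, abs_sq]
  rw [e] at hy
  simpa [Function.iterate_succ_apply] using hy

/-- A fold semiconjugacy that is bi-Lipschitz somewhere exists only for the Chebyshev map. -/
theorem false_of_biLipAt (hψ : FoldSemiconj a s ψ) (ha : -2 < a) (hs : 1 < s) {B : ℝ}
    (hB : ∀ x, |ψ x| ≤ B) {x₀ : ℝ} (hx₀ : BiLipAt ψ x₀) : False := by
  have hs0 : 0 < s := zero_lt_one.trans hs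
  have h0 := hψ.biLipAt_zero hs hB hx₀
  have hcrit := hψ.not_biLipAt_crit hs0 h0
  have hcrit0 : ∀ n, n ≠ 0 → (fa a)^[n] 0 ≠ 0 := by
    intro n hn hcon
    obtain ⟨m, rfl⟩ := Nat.exists_eq_succ_of_ne_zero hn
    exact hcrit m (by rw [hcon]; exact h0)
  obtain ⟨S, hS⟩ : ∃ S : Set ℝ, S = {t | 0 ≤ t ∧ ¬ BiLipAt ψ t} := ⟨_, rfl⟩
  have hSc : IsClosed S := by
    rw [hS]
    exact isClosed_Ici.inter (isOpen_biLipAt ψ).isClosed_compl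
  have hSb : BddBelow S := ⟨0, fun t ht => by rw [hS] at ht; exact ht.1⟩
  have hSn : S.Nonempty := by
    refine ⟨|a|, ?_⟩
    rw [hS]
    refine ⟨abs_nonneg a, fun hcon => ?_⟩
    have h1 : ¬ BiLipAt ψ a := by simpa [fa] using hcrit 0
    rcases abs_choice a with h2 | h2 <;> rw [h2] at hcon
    · exact h1 hcon
    · exact h1 (by simpa using hcon.neg hψ.odd)
  obtain ⟨e, he⟩ : ∃ e, e = sInf S := ⟨_, rfl⟩
  have heS : e ∈ S := he ▸ hSc.csInf_mem hSn hSb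
  have hin : ∀ t, |t| < e → BiLipAt ψ t := by
    intro t ht
    have h1 : BiLipAt ψ |t| := by
      by_contra hcon
      have : |t| ∈ S := by rw [hS]; exact ⟨abs_nonneg t, hcon⟩
      have := csInf_le hSb this
      linarith
    rcases abs_choice t with h2 | h2 <;> rw [h2] at h1
    · exact h1
    · simpa using h1.neg hψ.odd
  rw [hS] at heS
  obtain ⟨he0, heN⟩ := heS
  have hepos : 0 < e := by
    rcases he0.eq_or_lt with h1 | h1
    · exact absurd (h1 ▸ h0) heN
    · exact h1
  have hout : ∀ t, |t| ≤ e → ¬ BiLipAt ψ t → t = e ∨ t = -e := by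
    intro t ht hN
    have : |t| = e := le_antisymm ht (not_lt.1 fun h1 => hN (hin t h1))
    rcases abs_choice t with h2 | h2 <;> rw [h2] at this
    · exact Or.inl this
    · exact Or.inr (by linarith)
  have heN' : ∀ n, ¬ BiLipAt ψ ((fa a)^[n] e) := by
    intro n
    induction n with
    | zero => simpa using heN
    | succ n ih =>
      rw [Function.iterate_succ_apply']
      exact fun hcon => ih (hψ.biLipAt_of_fa hs0 (fun h1 => ih (h1 ▸ h0)) hcon)
  -- the first return of the maximal regular interval to the critical point
  have hne2 : ∃ y ∈ Ioo 0 e, ∃ z ∈ Ioo 0 e, ψ y ≠ ψ z := by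
    have hx : BiLipAt ψ (e / 2) := hin _ (by rw [abs_of_pos (by linarith)]; linarith)
    have hmem : ∀ᶠ y in 𝓝[≠] (e / 2), y ∈ Ioo 0 e :=
      nhdsWithin_le_nhds (Ioo_mem_nhds (by linarith) (by linarith))
    obtain ⟨y, hy1, hy2⟩ := (hx.eventually_ne.and hmem).exists
    exact ⟨y, hy2, e / 2, ⟨by linarith, by linarith⟩, hy1⟩
  obtain ⟨y₁, hy₁, y₂, hy₂, hy₁₂⟩ := hne2
  have hex := hψ.exists_iterate_eq_zero hs hB (ordConnected_Ioo (a := (0 : ℝ)) (b := e)) hy₁ hy₂ hy₁₂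
  classical
  obtain ⟨q, hq⟩ : ∃ q, q = Nat.find hex := ⟨_, rfl⟩
  obtain ⟨z, hz, hz0⟩ : ∃ z ∈ Ioo 0 e, (fa a)^[q] z = 0 := hq ▸ Nat.find_spec hex
  have hmin : ∀ i < q, ∀ z ∈ Ioo 0 e, (fa a)^[i] z ≠ 0 := by
    intro i hi z hz hcon
    exact Nat.find_min hex (hq ▸ hi) ⟨z, hz, hcon⟩
  have hq0 : q ≠ 0 := by
    rintro rfl
    simp only [Function.iterate_zero, id_eq] at hz0
    exact hz.1.ne' hz0
  have hsign : ∀ i < q, ∀ x ∈ Icc 0 e, ∀ y ∈ Icc 0 e, 0 ≤ (fa a)^[i] x * (fa a)^[i] y := by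
    intro i hi x hx y hy
    rw [← closure_Ioo hepos.ne] at hx hy
    exact mul_nonneg_of_closure (continuous_iterate a i) (fun u hu v hv =>
      (mul_pos_of_preconnected (continuous_iterate a i) ordConnected_Ioo (hmin i hi) hu hv).le) hx hy
  have hexp : ∀ x ∈ Icc 0 e, ∀ y ∈ Icc 0 e,
      |ψ ((fa a)^[q] x) - ψ ((fa a)^[q] y)| = s ^ q * |ψ x - ψ y| :=
    fun x hx y hy => hψ.abs_map_iterate_sub hs0 q (fun i hi => hsign i hi x hx y hy)
  have himg : ∀ x ∈ Ioo 0 e, |(fa a)^[q] x| < e := by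
    intro x hx
    by_contra hcon
    push Not at hcon
    have hmem : ∃ t ∈ uIcc z x, |(fa a)^[q] t| = e := by
      have hcont : ContinuousOn (fun t => |(fa a)^[q] t|) (uIcc z x) :=
        ((continuous_iterate a q).abs).continuousOn
      have h1 := intermediate_value_uIcc hcont
      obtain ⟨t, ht, ht'⟩ := h1 (show e ∈ uIcc |(fa a)^[q] z| |(fa a)^[q] x| by
        rw [hz0, abs_zero]; exact Set.mem_uIcc.2 (Or.inl ⟨he0, hcon⟩))
      exact ⟨t, ht, ht'⟩
    obtain ⟨t, ht, hte⟩ := hmem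
    have ht' : t ∈ Ioo 0 e := ordConnected_Ioo.uIcc_subset hz hx ht
    have hreg : BiLipAt ψ ((fa a)^[q] t) :=
      (hψ.biLipAt_iterate_iff hs0 q (fun i hi => hmin i hi t ht')).2
        (hin t (by rw [abs_of_pos ht'.1]; exact ht'.2))
    rcases abs_choice ((fa a)^[q] t) with h2 | h2 <;> rw [h2] at hte
    · exact heN (hte ▸ hreg)
    · exact heN (hte ▸ hreg.neg hψ.odd)
  have himg' : ∀ x ∈ Icc 0 e, |(fa a)^[q] x| ≤ e := by
    intro x hx
    rw [← closure_Ioo hepos.ne] at hx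
    have hcl : IsClosed {x | |(fa a)^[q] x| ≤ e} :=
      isClosed_le (continuous_iterate a q).abs continuous_const
    exact closure_minimal (fun y hy => (himg y hy).le) hcl hx
  obtain ⟨b, hb⟩ : ∃ b, b = (fa a)^[q] e := ⟨_, rfl⟩
  have hbe : b = e ∨ b = -e :=
    hout b (hb ▸ himg' e ⟨he0, le_rfl⟩) (hb ▸ heN' q)
  have hce : (fa a)^[q] 0 = e ∨ (fa a)^[q] 0 = -e := by
    obtain ⟨m, rfl⟩ := Nat.exists_eq_succ_of_ne_zero hq0
    exact hout _ (himg' 0 ⟨le_rfl, he0⟩) (hcrit m)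
  have hψe : 0 < ψ e := by
    refine lt_of_le_of_ne (hψ.nonneg he0) fun hcon => hy₁₂ ?_
    have h1 : ∀ y ∈ Ioo 0 e, ψ y = 0 := fun y hy =>
      le_antisymm (hcon ▸ hψ.mono hy.2.le) (hψ.nonneg hy.1.le)
    rw [h1 _ hy₁, h1 _ hy₂]
  have hE := hexp e ⟨he0, le_rfl⟩ 0 ⟨le_rfl, he0⟩
  rw [hψ.map_zero, sub_zero, abs_of_pos hψe, ← hb] at hE
  have hsq0 : 0 < s ^ q * ψ e := by positivity
  have hcb : (fa a)^[q] 0 = -b := by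
    rcases hbe with h1 | h1 <;> rcases hce with h2 | h2 <;> rw [h1, h2] at hE ⊢
    · simp at hE; rcases hE with h3 | h3 <;> linarith
    · simp
    · simp at hE; rcases hE with h3 | h3 <;> linarith
  have hψb : |ψ b| = ψ e := by
    rcases hbe with h1 | h1 <;> rw [h1]
    · exact abs_of_pos hψe
    · rw [hψ.odd, abs_neg, abs_of_pos hψe]
  have hs2 : s ^ q = 2 := by
    rw [hcb, hψ.odd, show ψ b - -ψ b = 2 * ψ b by ring, abs_mul, abs_two, hψb] at hE
    exact (mul_right_cancel₀ hψe.ne' hE).symm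
  have hfb : (fa a)^[q] b = b := by
    rcases hbe with h1 | h1
    · rw [h1, ← hb, h1]
    · rw [h1, iterate_neg a e hq0, ← hb, h1]
  have habsb : |b| = e := by
    rcases hbe with h1 | h1 <;> rw [h1] <;> simp [abs_of_pos hepos]
  have hb0 : b ≠ 0 := by rw [← abs_pos, habsb]; exact hepos
  obtain ⟨P, hP⟩ : ∃ P, P = (fa a)^[q] := ⟨_, rfl⟩
  have hPc : Continuous P := hP ▸ continuous_iterate a q
  rw [← hP] at hfb hcb hexp himg
  have hPneg : ∀ x, P (-x) = P x := fun x => by rw [hP]; exact iterate_neg a x hq0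
  have hneN : ∀ i, (fa a)^[i] b ≠ 0 := by
    intro i hi
    rcases eq_or_ne i 0 with rfl | hi0
    · exact hb0 hi
    · have h1 : (fa a)^[i] e = 0 := by
        rcases hbe with h1 | h1 <;> rw [h1] at hi
        · exact hi
        · rwa [iterate_neg a e hi0] at hi
      exact heN' i (by rw [h1]; exact h0)
  have hΛ0 : ∏ i ∈ Finset.range q, 2 * (fa a)^[i] b ≠ 0 :=
    Finset.prod_ne_zero_iff.2 fun i _ => mul_ne_zero two_ne_zero (hneN i)
  obtain ⟨Λ, hΛ⟩ : ∃ Λ, Λ = ∏ i ∈ Finset.range q, 2 * (fa a)^[i] b := ⟨_, rfl⟩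
  have hderiv : HasDerivAt P Λ b := by rw [hP, hΛ]; exact hasDerivAt_iterate a b q
  rw [← hΛ] at hΛ0
  have hstep : ∀ x, |x| < e → 0 < x * b → |P x| < e ∧ |ψ (P x) - ψ b| = 2 * |ψ x - ψ b| := by
    intro x hx hxb
    rw [← hs2]
    rcases hbe with h1 | h1
    · have hx0 : 0 < x := by rw [h1] at hxb; exact pos_of_mul_pos_left hxb he0
      have hxe : x < e := by rwa [abs_of_pos hx0] at hx
      refine ⟨himg x ⟨hx0, hxe⟩, ?_⟩
      have := hexp x ⟨hx0.le, hxe.le⟩ e ⟨he0, le_rfl⟩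
      rwa [← h1, hfb] at this
    · have hx0 : 0 < -x := by
        rw [h1] at hxb
        nlinarith
      have hxe : -x < e := by rw [abs_of_neg (by linarith)] at hx; exact hx
      refine ⟨by rw [← hPneg]; exact himg _ ⟨hx0, hxe⟩, ?_⟩
      have := hexp (-x) ⟨hx0.le, hxe.le⟩ e ⟨he0, le_rfl⟩
      rw [show e = -b by linarith, hPneg, hPneg, hfb, hψ.odd, hψ.odd,
        show -ψ x - -ψ b = -(ψ x - ψ b) by ring, abs_neg] at this
      exact this
  have hiter : ∀ n, ∀ᶠ x in 𝓝 b, |x| < e →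
      |P^[n] x| < e ∧ |ψ (P^[n] x) - ψ b| = 2 ^ n * |ψ x - ψ b| := by
    intro n
    induction n with
    | zero => exact Eventually.of_forall fun x hx => by simpa using hx
    | succ n ih =>
      have h1 : ∀ᶠ x in 𝓝 b, 0 < P^[n] x * b := by
        have hc : Continuous fun x => P^[n] x * b := (hPc.iterate n).mul continuous_const
        refine hc.continuousAt.eventually (lt_mem_nhds ?_)
        simp only [Function.iterate_fixed hfb]; exact mul_self_pos.2 hb0
      filter_upwards [ih, h1] with x hx hxb hxe
      obtain ⟨h2, h3⟩ := hx hxe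
      obtain ⟨h4, h5⟩ := hstep _ h2 hxb
      rw [Function.iterate_succ_apply']
      exact ⟨h4, by rw [h5, h3]; ring⟩
  have hsqrt : ∃ c > 0, ∃ C > 0, ∀ᶠ x in 𝓝 b, |x| < e →
      c * |x - b| ≤ |ψ x - ψ b| ^ 2 ∧ |ψ x - ψ b| ^ 2 ≤ C * |x - b| := by
    obtain ⟨D, hD, hDev⟩ := eventually_abs_iterate_sub_crit hq0 (fun i hi _ => hcrit0 i hi)
    rw [← hP, hcb] at hDev
    obtain ⟨c, hc, C, hC, hev⟩ := h0
    have h2 : Tendsto (fun y : ℝ => (y, (0 : ℝ))) (𝓝 0) (𝓝 (0, 0)) := by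
      have : Continuous (fun y : ℝ => (y, (0 : ℝ))) := by fun_prop
      exact this.tendsto 0
    obtain ⟨r₀, hr₀, hball⟩ := Metric.eventually_nhds_iff_ball.1 ((h2.eventually hev).and hDev)
    obtain ⟨r, hr, hrr, hre⟩ : ∃ r, 0 < r ∧ r < r₀ ∧ r < e :=
      ⟨min r₀ e / 2, by positivity, by linarith [min_le_left r₀ e, lt_min hr₀ hepos],
        by linarith [min_le_right r₀ e, lt_min hr₀ hepos]⟩
    have hPr := abs_lt.1 (himg r ⟨hr, hre⟩)
    have hivt : ∀ᶠ x in 𝓝 b, |x| < e → -x ∈ uIcc (P 0) (P r) := by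
      rw [hcb]
      rcases hbe with h1 | h1
      · have : ∀ᶠ x in 𝓝 b, -P r < x := lt_mem_nhds (by rw [h1]; linarith)
        filter_upwards [this] with x hx hxe
        have := abs_lt.1 hxe
        exact Set.mem_uIcc.2 (Or.inl ⟨by linarith, by linarith⟩)
      · have : ∀ᶠ x in 𝓝 b, x < -P r := gt_mem_nhds (by rw [h1]; linarith)
        filter_upwards [this] with x hx hxe
        have := abs_lt.1 hxe
        exact Set.mem_uIcc.2 (Or.inr ⟨by linarith, by linarith⟩)
    refine ⟨2 * c ^ 2 / D, by positivity, 8 * C ^ 2 / D, by positivity, ?_⟩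
    filter_upwards [hivt] with x hx hxe
    obtain ⟨y, hy, hyx⟩ := intermediate_value_uIcc hPc.continuousOn (hx hxe)
    rw [uIcc_of_le hr.le] at hy
    have hyb := hball y (by
      rw [Metric.mem_ball, Real.dist_eq, sub_zero, abs_of_nonneg hy.1]; linarith [hy.2])
    simp only [sub_zero, hψ.map_zero] at hyb
    have hE2 := hexp y ⟨hy.1, by linarith [hy.2]⟩ 0 ⟨le_rfl, he0⟩
    rw [hcb, hyx, hψ.odd, hψ.odd, hψ.map_zero, sub_zero, hs2,
      show -ψ x - -ψ b = -(ψ x - ψ b) by ring, abs_neg] at hE2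
    rw [hyx, show -x - -b = -(x - b) by ring, abs_neg, abs_of_nonneg hy.1] at hyb
    obtain ⟨⟨i1, i2⟩, i3, i4⟩ := hyb
    rw [hE2]
    have hcy : 0 ≤ c * y := mul_nonneg hc.le hy.1
    constructor
    · calc 2 * c ^ 2 / D * |x - b| ≤ 2 * c ^ 2 / D * (2 * D * y ^ 2) := by gcongr
        _ = (2 * (c * y)) ^ 2 := by field_simp
        _ ≤ _ := by gcongr
    · calc (2 * |ψ y|) ^ 2 ≤ (2 * (C * y)) ^ 2 := by gcongr
        _ = 8 * C ^ 2 / D * (D / 2 * y ^ 2) := by field_simp; ring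
        _ ≤ _ := by gcongr
  obtain ⟨c, hc, C, hC, hsq⟩ := hsqrt
  have hbclos : ∃ᶠ x in 𝓝 b, |x| < e := by
    have h1 : b ∈ closure (Ioo (-e) e) := by
      rw [closure_Ioo (by linarith)]
      rcases hbe with h1 | h1 <;> rw [h1] <;> constructor <;> linarith
    exact (mem_closure_iff_frequently.1 h1).mono fun x hx => abs_lt.2 hx
  have hgrow : ∀ n : ℕ, c / 2 * |Λ| ^ n ≤ C * 4 ^ n ∧ c * 4 ^ n ≤ 2 * C * |Λ| ^ n := by
    intro n
    have hdn := eventually_abs_sub_of_hasDerivAt (hderiv.iterate _ hfb n) (pow_ne_zero n hΛ0)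
    have hPn : Tendsto P^[n] (𝓝 b) (𝓝 b) := by
      have := (hPc.iterate n).tendsto b
      rwa [Function.iterate_fixed hfb] at this
    obtain ⟨x, hxe, h1, h2, h3, h4⟩ := (hbclos.and_eventually
      (hsq.and ((hiter n).and (hdn.and (hPn.eventually hsq))))).exists
    obtain ⟨j1, j2⟩ := h1 hxe
    obtain ⟨j3, j4⟩ := h2 hxe
    obtain ⟨j5, j6⟩ := h4 j3
    rw [Function.iterate_fixed hfb, abs_pow] at h3
    rw [j4, mul_pow, ← pow_mul, mul_comm n 2, pow_mul] at j5 j6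
    norm_num at j5 j6
    have hxb : 0 < |x - b| := by
      rw [abs_pos, sub_ne_zero]
      rintro rfl
      linarith
    constructor
    · refine le_of_mul_le_mul_right ?_ hxb
      calc c / 2 * |Λ| ^ n * |x - b| = c * (|Λ| ^ n / 2 * |x - b|) := by ring
        _ ≤ c * |P^[n] x - b| := by gcongr; exact h3.1
        _ ≤ 4 ^ n * |ψ x - ψ b| ^ 2 := by simpa using j5
        _ ≤ 4 ^ n * (C * |x - b|) := by gcongr
        _ = _ := by ring
    · refine le_of_mul_le_mul_right ?_ hxb
      calc c * 4 ^ n * |x - b| = 4 ^ n * (c * |x - b|) := by ring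
        _ ≤ 4 ^ n * |ψ x - ψ b| ^ 2 := by gcongr
        _ ≤ C * |P^[n] x - b| := by simpa using j6
        _ ≤ C * (2 * |Λ| ^ n * |x - b|) := by gcongr; exact h3.2
        _ = _ := by ring
  have hΛ4 : |Λ| = 4 := by
    have hΛpos : 0 < |Λ| := abs_pos.2 hΛ0
    rcases lt_trichotomy |Λ| 4 with h1 | h1 | h1
    · obtain ⟨n, hn⟩ := pow_unbounded_of_one_lt (2 * C / c) ((one_lt_div hΛpos).2 h1)
      rw [div_pow, div_lt_div_iff₀ hc (by positivity)] at hn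
      linarith [(hgrow n).2]
    · exact h1
    · obtain ⟨n, hn⟩ := pow_unbounded_of_one_lt (2 * C / c) ((one_lt_div (by norm_num)).2 h1)
      rw [div_pow, div_lt_div_iff₀ hc (by positivity)] at hn
      linarith [(hgrow n).1]
  rw [hΛ] at hΛ4
  rw [hP] at hfb hcb
  have := param_le_neg_two hq0 hfb hcb hb0
    (fun _ h1 => hcrit0 1 one_ne_zero (by simpa [fa] using h1)) hΛ4
  linarith
end FoldSemiconj

end

section

variable {a z : ℝ}

lemma abs_le_two_of_iterate_eq_zero (ha : -2 ≤ a) {x : ℝ} {m : ℕ} (hx : (fa a)^[m] x = 0) :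
    |x| ≤ 2 := by
  by_contra hcon
  have : ∀ n, 2 < |(fa a)^[n] x| := by
    intro n
    induction n with
    | zero => simpa using hcon
    | succ n ih =>
      rw [Function.iterate_succ_apply', fa_apply]
      have h1 : 4 < ((fa a)^[n] x) ^ 2 := by rw [← sq_abs]; nlinarith
      rw [abs_of_pos (by linarith)]; linarith
  have h1 := this m
  rw [hx, abs_zero] at h1
  linarith

/-- The polynomial with values `(fa a)^[n] x`. -/
noncomputable def iterPoly (a : ℝ) : ℕ → Polynomial ℝ
  | 0 => Polynomial.X
  | n + 1 => iterPoly a n ^ 2 + Polynomial.C a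

lemma eval_iterPoly (a x : ℝ) (n : ℕ) : (iterPoly a n).eval x = (fa a)^[n] x := by
  induction n with
  | zero => simp [iterPoly]
  | succ n ih => rw [iterPoly, Function.iterate_succ_apply', fa_apply, ← ih]; simp

lemma iterPoly_sub_C_ne_zero (a g : ℝ) (n : ℕ) : iterPoly a n - Polynomial.C g ≠ 0 := by
  intro hcon
  have h1 : ∀ x, (fa a)^[n] x = g := fun x => by
    have := congrArg (Polynomial.eval x) hcon
    simp only [Polynomial.eval_sub, Polynomial.eval_C, Polynomial.eval_zero, eval_iterPoly] at this
    linarith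
  have hgrow : ∀ n : ℕ, ∀ x : ℝ, |a| + 2 + |g| ≤ x → |a| + 2 + |g| ≤ (fa a)^[n] x := by
    intro n x hx
    induction n with
    | zero => simpa using hx
    | succ n ih =>
      rw [Function.iterate_succ_apply', fa_apply]
      nlinarith [abs_nonneg a, abs_nonneg g, neg_abs_le a]
  have := hgrow n _ le_rfl
  rw [h1] at this
  linarith [le_abs_self g, abs_nonneg a]

/-- The preimages of the critical point under the `m`-th iterate. -/
noncomputable def zeros (a : ℝ) (m : ℕ) : Finset ℝ := (iterPoly a m).roots.toFinset

lemma mem_zeros {x : ℝ} {m : ℕ} : x ∈ zeros a m ↔ (fa a)^[m] x = 0 := by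
  have h0 : iterPoly a m ≠ 0 := by simpa using iterPoly_sub_C_ne_zero a 0 m
  rw [zeros, Multiset.mem_toFinset, Polynomial.mem_roots h0, Polynomial.IsRoot.def, eval_iterPoly]

lemma zeros_zero : zeros a 0 = {0} := by
  ext x; simp [mem_zeros]

/-- The Milnor-Thurston coordinate. -/
noncomputable def theta (a z x : ℝ) : ℝ :=
  ∑' n : ℕ, z ^ n * ∏ i ∈ Finset.range (n + 1), Real.sign ((fa a)^[i] x)

lemma abs_sign_le (x : ℝ) : |Real.sign x| ≤ 1 := by
  rcases Real.sign_apply_eq x with h1 | h1 | h1 <;> rw [h1] <;> norm_num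

lemma abs_prod_sign_le (a x : ℝ) (n : ℕ) :
    |∏ i ∈ Finset.range n, Real.sign ((fa a)^[i] x)| ≤ 1 := by
  rw [Finset.abs_prod]
  exact Finset.prod_le_one (fun _ _ => abs_nonneg _) (fun _ _ => abs_sign_le _)

lemma abs_theta_term_le (hz : 0 < z) (a x : ℝ) (n : ℕ) :
    |z ^ n * ∏ i ∈ Finset.range (n + 1), Real.sign ((fa a)^[i] x)| ≤ z ^ n := by
  rw [abs_mul, abs_of_pos (pow_pos hz n)]
  exact mul_le_of_le_one_right (pow_pos hz n).le (abs_prod_sign_le _ _ _)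

lemma summable_theta (hz : 0 < z) (hz1 : z < 1) (a x : ℝ) :
    Summable fun n : ℕ => z ^ n * ∏ i ∈ Finset.range (n + 1), Real.sign ((fa a)^[i] x) :=
  Summable.of_norm_bounded (summable_geometric_of_lt_one hz.le hz1)
    (fun n => abs_theta_term_le hz a x n)

lemma abs_theta_le (hz : 0 < z) (hz1 : z < 1) (a x : ℝ) : |theta a z x| ≤ 1 / (1 - z) := by
  have := tsum_of_norm_bounded
    (f := fun n : ℕ => z ^ n * ∏ i ∈ Finset.range (n + 1), Real.sign ((fa a)^[i] x))
    (hasSum_geometric_of_lt_one hz.le hz1) (fun n => abs_theta_term_le hz a x n)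
  rwa [Real.norm_eq_abs, ← one_div] at this

lemma theta_eq (hz : 0 < z) (hz1 : z < 1) (a x : ℝ) :
    theta a z x = Real.sign x * (1 + z * theta a z (fa a x)) := by
  rw [theta, (summable_theta hz hz1 a x).tsum_eq_zero_add, theta, mul_add, ← tsum_mul_left,
    ← tsum_mul_left]
  congr 1
  · simp
  · congr 1; ext n
    rw [Finset.prod_range_succ']
    simp only [Function.iterate_succ_apply, Function.iterate_zero, id_eq]
    ring

lemma theta_of_pos (hz : 0 < z) (hz1 : z < 1) {x : ℝ} (hx : 0 < x) :
    theta a z x = 1 + z * theta a z (fa a x) := by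
  rw [theta_eq hz hz1, Real.sign_of_pos hx, one_mul]

lemma theta_zero (a z : ℝ) : theta a z 0 = 0 := by
  rw [theta]
  convert tsum_zero with n
  rw [Finset.prod_range_succ']; simp

lemma theta_neg (hz : 0 < z) (hz1 : z < 1) (a x : ℝ) : theta a z (-x) = -theta a z x := by
  rw [theta_eq hz hz1, theta_eq hz hz1 a x, fa_neg, Real.sign_neg]; ring

/-- Weighted number of preimages of the critical point in a set. -/
noncomputable def count (a z : ℝ) (J : Set ℝ) : ℝ :=
  ∑' m : ℕ, z ^ m * ∑ y ∈ zeros a m, J.indicator 1 y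

/-- Weighted signed count of preimages of the critical point to the left and right. -/
noncomputable def signedCount (a z x : ℝ) : ℝ :=
  ∑' m : ℕ, z ^ m * ∑ y ∈ zeros a m, Real.sign (x - y)

lemma sum_sign_zeros_succ {x : ℝ} (hx : 0 < x) (m : ℕ) :
    ∑ w ∈ zeros a (m + 1), Real.sign (x - w) =
      ∑ y ∈ zeros a m, (Real.sign (fa a x - y) - Real.sign (a - y)) := by
  classical
  have hmaps : ∀ w ∈ zeros a (m + 1), fa a w ∈ zeros a m := fun w hw => by
    rw [mem_zeros, Function.iterate_succ_apply] at hw; exact mem_zeros.2 hw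
  rw [← Finset.sum_fiberwise_of_maps_to hmaps]
  refine Finset.sum_congr rfl fun y hy => ?_
  have hmem : ∀ w, w ∈ (zeros a (m + 1)).filter (fun w => fa a w = y) ↔ w ^ 2 = y - a := by
    intro w
    rw [Finset.mem_filter, mem_zeros, Function.iterate_succ_apply, fa_apply]
    constructor
    · rintro ⟨-, h1⟩; linarith
    · intro h1
      have : w ^ 2 + a = y := by linarith
      exact ⟨by rw [this]; exact mem_zeros.1 hy, this⟩
  rcases lt_trichotomy y a with h1 | h1 | h1
  · have : (zeros a (m + 1)).filter (fun w => fa a w = y) = ∅ := by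
      ext w; rw [hmem]; simp; nlinarith [sq_nonneg w]
    rw [this, Finset.sum_empty, Real.sign_of_pos (by linarith : 0 < a - y),
      Real.sign_of_pos (by rw [fa_apply]; nlinarith : 0 < fa a x - y), sub_self]
  · have : (zeros a (m + 1)).filter (fun w => fa a w = y) = {0} := by
      ext w; rw [hmem]; simp [h1]
    rw [this, Finset.sum_singleton, sub_zero, Real.sign_of_pos hx, h1, sub_self, Real.sign_zero,
      Real.sign_of_pos (by rw [fa_apply]; nlinarith : 0 < fa a x - a), sub_zero]
  · obtain ⟨r, hr, hr2⟩ : ∃ r, 0 < r ∧ r ^ 2 = y - a :=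
      ⟨√(y - a), Real.sqrt_pos.2 (by linarith), Real.sq_sqrt (by linarith)⟩
    have : (zeros a (m + 1)).filter (fun w => fa a w = y) = {r, -r} := by
      ext w; rw [hmem, ← hr2, sq_eq_sq_iff_eq_or_eq_neg]; simp
    rw [this, Finset.sum_pair (by linarith), sub_neg_eq_add,
      Real.sign_of_pos (by linarith : 0 < x + r), Real.sign_of_neg (by linarith : a - y < 0),
      sub_neg_eq_add]
    congr 1
    have e : fa a x - y = (x + r) * (x - r) := by rw [fa_apply]; nlinarith
    rw [e]
    rcases lt_trichotomy x r with h2 | h2 | h2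
    · rw [Real.sign_of_neg (by linarith), Real.sign_of_neg (by nlinarith)]
    · rw [h2]; simp
    · rw [Real.sign_of_pos (by linarith), Real.sign_of_pos (by nlinarith)]

lemma sum_indicator_le (a : ℝ) (J : Set ℝ) (m : ℕ) :
    ∑ y ∈ zeros a m, J.indicator (1 : ℝ → ℝ) y ≤ (zeros a m).card := by
  have := Finset.sum_le_card_nsmul (zeros a m) (J.indicator (1 : ℝ → ℝ)) 1 (fun y _ =>
    Set.indicator_le_self' (fun _ _ => zero_le_one) y)
  simpa using this

lemma sum_indicator_nonneg (a : ℝ) (J : Set ℝ) (m : ℕ) :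
    0 ≤ ∑ y ∈ zeros a m, J.indicator (1 : ℝ → ℝ) y :=
  Finset.sum_nonneg fun y _ => Set.indicator_nonneg (fun _ _ => zero_le_one) y

lemma abs_sum_sign_le (a x : ℝ) (m : ℕ) :
    |∑ y ∈ zeros a m, Real.sign (x - y)| ≤ (zeros a m).card := by
  refine (Finset.abs_sum_le_sum_abs _ _).trans ?_
  have := Finset.sum_le_card_nsmul (zeros a m) (fun y => |Real.sign (x - y)|) 1 (fun y _ =>
    abs_sign_le _)
  simpa using this

/-- The hypotheses under which the weighted counts converge. -/
structure Admissible (a z : ℝ) : Prop where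
  neg_two_le : -2 ≤ a
  pos : 0 < z
  lt_one : z < 1
  summable : Summable fun m : ℕ => z ^ m * ((zeros a m).card : ℝ)

namespace Admissible

lemma summable_count (hz : Admissible a z) (J : Set ℝ) :
    Summable fun m : ℕ => z ^ m * ∑ y ∈ zeros a m, J.indicator (1 : ℝ → ℝ) y :=
  Summable.of_nonneg_of_le
    (fun m => mul_nonneg (pow_pos hz.pos m).le (sum_indicator_nonneg a J m))
    (fun m => mul_le_mul_of_nonneg_left (sum_indicator_le a J m) (pow_pos hz.pos m).le) hz.summable

lemma summable_signedCount (hz : Admissible a z) (x : ℝ) :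
    Summable fun m : ℕ => z ^ m * ∑ y ∈ zeros a m, Real.sign (x - y) :=
  Summable.of_norm_bounded hz.summable (fun m => by
    rw [Real.norm_eq_abs, abs_mul, abs_of_pos (pow_pos hz.pos m)]
    exact mul_le_mul_of_nonneg_left (abs_sum_sign_le a x m) (pow_pos hz.pos m).le)

lemma count_nonneg (hz : Admissible a z) (J : Set ℝ) : 0 ≤ count a z J :=
  tsum_nonneg fun m => mul_nonneg (pow_pos hz.pos m).le (sum_indicator_nonneg a J m)

lemma count_mono (hz : Admissible a z) {J K : Set ℝ} (hJK : J ⊆ K) : count a z J ≤ count a z K :=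
  (hz.summable_count J).tsum_le_tsum (fun m => mul_le_mul_of_nonneg_left
    (Finset.sum_le_sum fun y _ => Set.indicator_le_indicator_of_subset hJK
      (fun _ => zero_le_one) y) (pow_pos hz.pos m).le) (hz.summable_count K)

lemma count_union (hz : Admissible a z) {J K : Set ℝ} (hJK : Disjoint J K) :
    count a z (J ∪ K) = count a z J + count a z K := by
  rw [count, count, count, ← (hz.summable_count J).tsum_add (hz.summable_count K)]
  congr 1; ext m
  rw [← mul_add, ← Finset.sum_add_distrib, Set.indicator_union_of_disjoint hJK]

lemma one_le_count_singleton (hz : Admissible a z) : 1 ≤ count a z {0} := by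
  have := (hz.summable_count {0}).le_tsum 0 (fun m _ =>
    mul_nonneg (pow_pos hz.pos m).le (sum_indicator_nonneg a {0} m))
  rw [count]
  refine le_trans ?_ this
  simp [zeros_zero]

lemma one_le_count_univ (hz : Admissible a z) : 1 ≤ count a z univ :=
  hz.one_le_count_singleton.trans (hz.count_mono (subset_univ _))

lemma abs_signedCount_le (hz : Admissible a z) (x : ℝ) : |signedCount a z x| ≤ count a z univ := by
  refine tsum_of_norm_bounded (f := fun m : ℕ => z ^ m * ∑ y ∈ zeros a m, Real.sign (x - y))
    (hz.summable_count univ).hasSum (fun m => ?_)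
  rw [Real.norm_eq_abs, abs_mul, abs_of_pos (pow_pos hz.pos m)]
  refine mul_le_mul_of_nonneg_left ?_ (pow_pos hz.pos m).le
  simpa using abs_sum_sign_le a x m

lemma signedCount_of_pos (hz : Admissible a z) {x : ℝ} (hx : 0 < x) :
    signedCount a z x = (1 - z * signedCount a z a) + z * signedCount a z (fa a x) := by
  have e1 : signedCount a z x = 1 + ∑' m : ℕ, z ^ (m + 1) *
      ∑ y ∈ zeros a (m + 1), Real.sign (x - y) := by
    rw [signedCount, (hz.summable_signedCount x).tsum_eq_zero_add]
    simp [zeros_zero, Real.sign_of_pos hx]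
  have e2 : ∑' m : ℕ, z ^ (m + 1) * ∑ y ∈ zeros a (m + 1), Real.sign (x - y) =
      z * signedCount a z (fa a x) - z * signedCount a z a := by
    rw [← mul_sub, signedCount, signedCount,
      ← (hz.summable_signedCount (fa a x)).tsum_sub (hz.summable_signedCount a), ← tsum_mul_left]
    congr 1; ext m
    rw [sum_sign_zeros_succ hx, Finset.sum_sub_distrib]; ring
  rw [e1, e2]; ring

lemma signedCount_of_two_lt (hz : Admissible a z) {x : ℝ} (hx : 2 < x) :
    signedCount a z x = count a z univ := by
  rw [signedCount, count]
  congr 1; ext m; congr 1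
  refine Finset.sum_congr rfl fun y hy => ?_
  have := abs_le.1 (abs_le_two_of_iterate_eq_zero hz.neg_two_le (mem_zeros.1 hy))
  rw [Real.sign_of_pos (by linarith)]; simp

lemma signedCount_eq (hz : Admissible a z) {x : ℝ} (hx : 0 < x) :
    signedCount a z x = (1 - z) * count a z univ + z * signedCount a z (fa a x) := by
  have h3 := hz.signedCount_of_pos (x := 3) (by norm_num)
  rw [hz.signedCount_of_two_lt (x := 3) (by norm_num), hz.signedCount_of_two_lt (x := fa a 3) (by
    rw [fa_apply]; linarith [hz.neg_two_le])] at h3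
  rw [hz.signedCount_of_pos hx]; linarith

lemma signedCount_neg (a z x : ℝ) :
    signedCount a z (-x) = -signedCount a z x := by
  rw [signedCount, signedCount, ← tsum_neg]
  congr 1; ext m
  rw [← mul_neg, ← Finset.sum_neg_distrib]
  congr 1
  refine Finset.sum_nbij' (fun y => -y) (fun y => -y) ?_ ?_ (by simp) (by simp) ?_
  · intro y hy
    rw [mem_zeros] at hy ⊢
    rcases eq_or_ne m 0 with rfl | hm
    · simpa using hy
    · rwa [iterate_neg a y hm]
  · intro y hy
    rw [mem_zeros] at hy ⊢
    rcases eq_or_ne m 0 with rfl | hm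
    · simpa using hy
    · rwa [iterate_neg a y hm]
  · intro y _
    rw [← Real.sign_neg]; congr 1; ring

lemma kappa_pos (hz : Admissible a z) : 0 < (1 - z) * count a z univ :=
  mul_pos (by linarith [hz.lt_one]) (by linarith [hz.one_le_count_univ])

lemma theta_eq_signedCount (hz : Admissible a z) (x : ℝ) :
    theta a z x = signedCount a z x / ((1 - z) * count a z univ) := by
  obtain ⟨κ, hκ⟩ : ∃ κ, κ = (1 - z) * count a z univ := ⟨_, rfl⟩
  have hκ0 : 0 < κ := hκ ▸ hz.kappa_pos
  obtain ⟨u, hu⟩ : ∃ u : ℝ → ℝ, u = fun x => theta a z x - signedCount a z x / κ := ⟨_, rfl⟩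
  have hpos : ∀ x, 0 < x → u x = z * u (fa a x) := by
    intro x hx
    rw [hu]; simp only
    rw [theta_of_pos hz.pos hz.lt_one hx, hz.signedCount_eq hx, ← hκ]
    field_simp; ring
  have hodd : ∀ x, u (-x) = - u x := by
    intro x
    rw [hu]; simp only
    rw [theta_neg hz.pos hz.lt_one, signedCount_neg]; ring
  have hstep : ∀ x, |u x| ≤ z * |u (fa a x)| := by
    intro x
    rcases lt_trichotomy x 0 with h1 | h1 | h1
    · have := hpos (-x) (by linarith)
      rw [hodd, fa_neg] at this
      rw [← abs_neg, this, abs_mul, abs_of_pos hz.pos]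
    · have h2 : u 0 = 0 := by have := hodd 0; rw [neg_zero] at this; linarith
      rw [h1, h2, abs_zero]; exact mul_nonneg hz.pos.le (abs_nonneg _)
    · rw [hpos x h1, abs_mul, abs_of_pos hz.pos]
  have hiter : ∀ n, ∀ x, |u x| ≤ z ^ n * (1 / (1 - z) + count a z univ / κ) := by
    intro n
    induction n with
    | zero =>
      intro x
      rw [pow_zero, one_mul, hu]
      refine (abs_sub _ _).trans (add_le_add (abs_theta_le hz.pos hz.lt_one a x) ?_)
      rw [abs_div, abs_of_pos hκ0]
      gcongr
      exact hz.abs_signedCount_le x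
    | succ n ih =>
      intro x
      calc |u x| ≤ z * |u (fa a x)| := hstep x
        _ ≤ z * (z ^ n * (1 / (1 - z) + count a z univ / κ)) :=
          mul_le_mul_of_nonneg_left (ih _) hz.pos.le
        _ = _ := by ring
  have hlim : Tendsto (fun n => z ^ n * (1 / (1 - z) + count a z univ / κ)) atTop (𝓝 0) := by
    simpa using (tendsto_pow_atTop_nhds_zero_of_lt_one hz.pos.le hz.lt_one).mul_const
      (1 / (1 - z) + count a z univ / κ)
  have h0 : |u x| ≤ 0 := ge_of_tendsto' hlim fun n => hiter n x
  have h1 : u x = 0 := abs_eq_zero.1 (le_antisymm h0 (abs_nonneg _))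
  rw [hu] at h1
  rw [← hκ]
  exact sub_eq_zero.1 h1

end Admissible

end

section

variable {a z : ℝ}

/-- The normalized counting measure of preimages of the critical point; its distribution function
is `theta a z`. -/
noncomputable def nu (a z : ℝ) (J : Set ℝ) : ℝ := 2 * count a z J / ((1 - z) * count a z univ)

lemma sign_sub_sign {x y w : ℝ} (hxy : x ≤ y) : Real.sign (y - w) - Real.sign (x - w) =
    (Ico x y).indicator 1 w + (Ioc x y).indicator 1 w := by
  simp only [Set.indicator_apply, mem_Ico, mem_Ioc, Pi.one_apply]
  rcases lt_trichotomy x w with h1 | h1 | h1 <;> rcases lt_trichotomy y w with h2 | h2 | h2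
  all_goals first
    | (exfalso; linarith)
    | skip
  · rw [Real.sign_of_neg (by linarith), Real.sign_of_neg (by linarith), if_neg (by grind),
      if_neg (by grind)]; norm_num
  · rw [Real.sign_of_neg (by linarith : x - w < 0), h2, sub_self, Real.sign_zero, if_neg (by grind),
      if_pos (by grind)]; norm_num
  · rw [Real.sign_of_pos (by linarith), Real.sign_of_neg (by linarith), if_pos (by grind),
      if_pos (by grind)]; norm_num
  · rw [← h1, h2, ← h1, sub_self, if_neg (by grind), if_neg (by grind)]; simp
  · rw [Real.sign_of_pos (by linarith : 0 < y - w), ← h1, sub_self, Real.sign_zero,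
      if_pos (by grind), if_neg (by grind)]; norm_num
  · rw [Real.sign_of_pos (by linarith), Real.sign_of_pos (by linarith), if_neg (by grind),
      if_neg (by grind)]; norm_num

namespace Admissible

lemma nu_nonneg (hz : Admissible a z) (J : Set ℝ) : 0 ≤ nu a z J :=
  div_nonneg (mul_nonneg two_pos.le (hz.count_nonneg J)) hz.kappa_pos.le

lemma nu_mono (hz : Admissible a z) {J K : Set ℝ} (hJK : J ⊆ K) : nu a z J ≤ nu a z K :=
  div_le_div_of_nonneg_right (mul_le_mul_of_nonneg_left (hz.count_mono hJK) two_pos.le)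
    hz.kappa_pos.le

lemma nu_union (hz : Admissible a z) {J K : Set ℝ} (hJK : Disjoint J K) :
    nu a z (J ∪ K) = nu a z J + nu a z K := by
  rw [nu, nu, nu, hz.count_union hJK]; ring

lemma nu_univ (hz : Admissible a z) : nu a z univ = 2 / (1 - z) := by
  have := hz.one_le_count_univ
  have h1 : (1 - z) ≠ 0 := by linarith [hz.lt_one]
  rw [nu]; field_simp

lemma nu_le (hz : Admissible a z) (J : Set ℝ) : nu a z J ≤ 2 / (1 - z) :=
  hz.nu_univ ▸ hz.nu_mono (subset_univ J)

lemma nu_zero_pos (hz : Admissible a z) : 0 < nu a z {0} :=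
  div_pos (mul_pos two_pos (by linarith [hz.one_le_count_singleton])) hz.kappa_pos

lemma theta_sub (hz : Admissible a z) {x y : ℝ} (hxy : x ≤ y) :
    theta a z y - theta a z x = (nu a z (Ico x y) + nu a z (Ioc x y)) / 2 := by
  rw [hz.theta_eq_signedCount, hz.theta_eq_signedCount, nu, nu]
  have : signedCount a z y - signedCount a z x = count a z (Ico x y) + count a z (Ioc x y) := by
    rw [signedCount, signedCount, count, count,
      ← (hz.summable_signedCount y).tsum_sub (hz.summable_signedCount x),
      ← (hz.summable_count _).tsum_add (hz.summable_count _)]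
    congr 1; ext m
    rw [← mul_sub, ← mul_add, ← Finset.sum_sub_distrib, ← Finset.sum_add_distrib]
    congr 1
    exact Finset.sum_congr rfl fun w _ => sign_sub_sign hxy
  rw [← sub_div, this]; ring

lemma theta_mono (hz : Admissible a z) : Monotone (theta a z) := by
  intro x y hxy
  have := hz.theta_sub hxy
  linarith [hz.nu_nonneg (Ico x y), hz.nu_nonneg (Ioc x y)]

lemma nu_Ioo_le (hz : Admissible a z) {x y : ℝ} (hxy : x ≤ y) :
    nu a z (Ioo x y) ≤ theta a z y - theta a z x := by
  rw [hz.theta_sub hxy]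
  have h1 : nu a z (Ioo x y) ≤ nu a z (Ico x y) := hz.nu_mono Ioo_subset_Ico_self
  have h2 : nu a z (Ioo x y) ≤ nu a z (Ioc x y) := hz.nu_mono Ioo_subset_Ioc_self
  linarith

lemma theta_sub_le (hz : Admissible a z) {x y : ℝ} (hxy : x ≤ y) :
    theta a z y - theta a z x ≤ nu a z (Icc x y) := by
  rw [hz.theta_sub hxy]
  have h1 : nu a z (Ico x y) ≤ nu a z (Icc x y) := hz.nu_mono Ico_subset_Icc_self
  have h2 : nu a z (Ioc x y) ≤ nu a z (Icc x y) := hz.nu_mono Ioc_subset_Icc_self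
  linarith

lemma nu_zero_le_theta (hz : Admissible a z) {x : ℝ} (hx : 0 < x) :
    nu a z {0} / 2 ≤ theta a z x := by
  have := hz.theta_sub hx.le
  rw [theta_zero, sub_zero] at this
  have h1 : nu a z {0} ≤ nu a z (Ico 0 x) := hz.nu_mono (by simpa using hx)
  linarith [hz.nu_nonneg (Ioc 0 x)]

lemma tendsto_nu_Ioo (hz : Admissible a z) : Tendsto (fun x => nu a z (Ioo 0 x)) (𝓝[>] 0) (𝓝 0) := by
  have h1 : Tendsto (fun x => count a z (Ioo 0 x)) (𝓝[>] 0) (𝓝 0) := by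
    have := tendsto_tsum_of_dominated_convergence (𝓕 := 𝓝[>] (0 : ℝ))
      (f := fun x (m : ℕ) => z ^ m * ∑ y ∈ zeros a m, (Ioo 0 x).indicator (1 : ℝ → ℝ) y)
      (g := fun _ => 0) hz.summable ?_ ?_
    · rw [tsum_zero] at this; exact this
    · intro m
      refine tendsto_const_nhds.congr' ?_
      have h2 : ∀ᶠ x in 𝓝[>] (0 : ℝ), ∀ y ∈ zeros a m, 0 < y → x < y := by
        rw [Filter.eventually_all_finset]
        intro y _
        by_cases hy : 0 < y
        · filter_upwards [nhdsWithin_le_nhds (gt_mem_nhds hy)] with x hx _ using hx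
        · exact Eventually.of_forall fun x h3 => absurd h3 hy
      filter_upwards [h2] with x hx
      rw [Finset.sum_eq_zero, mul_zero]
      intro y hy
      rw [Set.indicator_of_notMem]
      rintro ⟨h3, h4⟩
      linarith [hx y hy h3]
    · refine Eventually.of_forall fun x m => ?_
      rw [Real.norm_eq_abs, abs_mul, abs_of_pos (pow_pos hz.pos m),
        abs_of_nonneg (sum_indicator_nonneg a _ m)]
      exact mul_le_mul_of_nonneg_left (sum_indicator_le a _ m) (pow_pos hz.pos m).le
  simpa [nu] using (h1.const_mul 2).div_const ((1 - z) * count a z univ)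

/-- `theta` is right-continuous at the critical point up to the atom there. -/
lemma exists_theta_le (hz : Admissible a z) {e : ℝ} (he : 0 < e) :
    ∀ᶠ x in 𝓝[>] 0, theta a z x ≤ nu a z {0} / 2 + e := by
  obtain ⟨y, hy, hy0⟩ := ((hz.tendsto_nu_Ioo.eventually (gt_mem_nhds he)).and
    self_mem_nhdsWithin).exists
  have hy0' : 0 < y := hy0
  filter_upwards [self_mem_nhdsWithin, nhdsWithin_le_nhds (gt_mem_nhds hy0')] with x hx hxy
  have hx' : 0 < x := hx
  have h1 := hz.theta_sub hx'.le
  rw [theta_zero, sub_zero] at h1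
  have h2 : nu a z (Ico 0 x) ≤ nu a z ({0} ∪ Ioo 0 y) := hz.nu_mono fun t ht => by
    rcases ht.1.eq_or_lt with h3 | h3
    · exact Or.inl h3.symm
    · exact Or.inr ⟨h3, ht.2.trans hxy⟩
  rw [hz.nu_union (by simp)] at h2
  have h3 : nu a z (Ioc 0 x) ≤ nu a z (Ioo 0 y) := hz.nu_mono fun t ht =>
    ⟨ht.1, ht.2.trans_lt hxy⟩
  linarith

lemma abs_theta_iterate_sub (hz : Admissible a z) {x y : ℝ} (n : ℕ)
    (hxy : ∀ i < n, 0 < (fa a)^[i] x * (fa a)^[i] y) :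
    |theta a z x - theta a z y| =
      z ^ n * |theta a z ((fa a)^[n] x) - theta a z ((fa a)^[n] y)| := by
  induction n with
  | zero => simp
  | succ n ih =>
    rw [ih (fun i hi => hxy i (hi.trans (Nat.lt_succ_self n))),
      theta_eq hz.pos hz.lt_one a ((fa a)^[n] x), theta_eq hz.pos hz.lt_one a ((fa a)^[n] y),
      ← Function.iterate_succ_apply' (fa a) n x, ← Function.iterate_succ_apply' (fa a) n y]
    have h1 := hxy n (Nat.lt_succ_self n)
    have hn : ∀ u v : ℝ, |(1 + z * u) - (1 + z * v)| = z * |u - v| := fun u v => by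
      rw [show (1 + z * u) - (1 + z * v) = z * (u - v) by ring, abs_mul, abs_of_pos hz.pos]
    rcases mul_pos_iff.1 h1 with ⟨h2, h3⟩ | ⟨h2, h3⟩
    · rw [Real.sign_of_pos h2, Real.sign_of_pos h3, one_mul, one_mul, hn]; ring
    · rw [Real.sign_of_neg h2, Real.sign_of_neg h3, ← mul_sub, abs_mul, hn]
      norm_num; ring

lemma count_iterate (hz : Admissible a z) {J : Set ℝ} (n : ℕ)
    (hJ : ∀ i < n, ∀ x ∈ J, (fa a)^[i] x ≠ 0) (hinj : InjOn (fa a)^[n] J) :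
    count a z J = z ^ n * count a z ((fa a)^[n] '' J) := by
  classical
  rw [count, ← (hz.summable_count J).sum_add_tsum_nat_add n, Finset.sum_eq_zero, zero_add, count,
    ← tsum_mul_left]
  · congr 1; ext m
    rw [← mul_assoc, ← pow_add, add_comm n m]
    congr 1
    rw [← Finset.sum_filter_add_sum_filter_not (zeros a (m + n)) (· ∈ J),
      ← Finset.sum_filter_add_sum_filter_not (zeros a m) (· ∈ (fa a)^[n] '' J)]
    rw [Finset.sum_eq_zero (s := (zeros a (m + n)).filter (· ∉ J)),
      Finset.sum_eq_zero (s := (zeros a m).filter (· ∉ (fa a)^[n] '' J)), add_zero, add_zero]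
    · refine Finset.sum_bij (fun x _ => (fa a)^[n] x) ?_ ?_ ?_ ?_
      · intro x hx
        rw [Finset.mem_filter, mem_zeros, Function.iterate_add_apply] at hx
        exact Finset.mem_filter.2 ⟨mem_zeros.2 hx.1, mem_image_of_mem _ hx.2⟩
      · intro x hx y hy hxy
        exact hinj (Finset.mem_filter.1 hx).2 (Finset.mem_filter.1 hy).2 hxy
      · intro y hy
        obtain ⟨hy1, x, hx, rfl⟩ := Finset.mem_filter.1 hy
        refine ⟨x, Finset.mem_filter.2 ⟨?_, hx⟩, rfl⟩
        rw [mem_zeros, Function.iterate_add_apply]; exact mem_zeros.1 hy1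
      · intro x hx
        have hx2 := (Finset.mem_filter.1 hx).2
        rw [Set.indicator_of_mem hx2, Set.indicator_of_mem (mem_image_of_mem _ hx2)]; rfl
    · intro y hy; exact Set.indicator_of_notMem (Finset.mem_filter.1 hy).2 _
    · intro y hy; exact Set.indicator_of_notMem (Finset.mem_filter.1 hy).2 _
  · intro m hm
    rw [Finset.sum_eq_zero, mul_zero]
    intro y hy
    exact Set.indicator_of_notMem (fun hyJ => hJ m (Finset.mem_range.1 hm) y hyJ
      (mem_zeros.1 hy)) _

lemma pow_mul_nu_zero_le (hz : Admissible a z) {y : ℝ} {n : ℕ} (hy : (fa a)^[n] y = 0) :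
    z ^ n * nu a z {0} ≤ nu a z {y} := by
  have h1 : z ^ n * count a z {0} ≤ count a z {y} := by
    rw [count, count, ← tsum_mul_left,
      ← (hz.summable_count {y}).sum_add_tsum_nat_add n]
    have hnn : 0 ≤ ∑ m ∈ Finset.range n, z ^ m * ∑ w ∈ zeros a m, ({y} : Set ℝ).indicator (1 : ℝ → ℝ) w :=
      Finset.sum_nonneg fun m _ => mul_nonneg (pow_pos hz.pos m).le (sum_indicator_nonneg a _ m)
    refine le_trans ?_ (le_add_of_nonneg_left hnn)
    refine ((hz.summable_count {0}).mul_left _).tsum_le_tsum (fun m => ?_)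
      ((summable_nat_add_iff n).2 (hz.summable_count {y}))
    rw [← mul_assoc, ← pow_add, add_comm n m]
    refine mul_le_mul_of_nonneg_left ?_ (pow_pos hz.pos _).le
    have e : ∀ (w : ℝ) (k : ℕ), ∑ v ∈ zeros a k, ({w} : Set ℝ).indicator (1 : ℝ → ℝ) v =
        if (fa a)^[k] w = 0 then 1 else 0 := by
      intro w k
      simp only [Set.indicator_apply, mem_singleton_iff, Pi.one_apply]
      rw [Finset.sum_ite_eq' (zeros a k) w]
      simp only [mem_zeros]
    rw [e, e, Function.iterate_add_apply, hy]
  rw [nu, nu, mul_div_assoc', mul_left_comm]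
  exact div_le_div_of_nonneg_right (mul_le_mul_of_nonneg_left h1 two_pos.le) hz.kappa_pos.le

end Admissible

end

section

variable {a z : ℝ}

/-- The fixed point bounding the invariant interval. -/
noncomputable def beta (a : ℝ) : ℝ := (1 + √(1 - 4 * a)) / 2

lemma Ia_eq (a : ℝ) : Ia a = Icc (-beta a) (beta a) := by
  rw [Ia, beta]; congr 1; ring

lemma beta_pos (a : ℝ) : 0 < beta a := by
  rw [beta]; positivity

lemma beta_sq (ha : a ≤ 1 / 4) : beta a ^ 2 = beta a - a := by
  have := Real.sq_sqrt (show 0 ≤ 1 - 4 * a by linarith)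
  rw [beta]; nlinarith

lemma beta_le_two (ha : -2 ≤ a) : beta a ≤ 2 := by
  have : √(1 - 4 * a) ≤ 3 := Real.sqrt_le_iff.2 ⟨by norm_num, by linarith⟩
  rw [beta]; linarith

lemma neg_beta_le_param (ha : -2 ≤ a) (ha' : a ≤ 1 / 4) : -beta a ≤ a := by
  nlinarith [beta_sq ha', beta_le_two ha, beta_pos a]

lemma mapsTo_Ia (ha : -2 ≤ a) (ha' : a ≤ 1 / 4) : MapsTo (fa a) (Ia a) (Ia a) := by
  intro x hx
  rw [Ia_eq] at hx ⊢
  have h1 : x ^ 2 ≤ beta a ^ 2 := sq_le_sq' hx.1 hx.2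
  rw [beta_sq ha'] at h1
  rw [fa_apply]
  exact ⟨by nlinarith [sq_nonneg x, neg_beta_le_param ha ha'], by linarith⟩

lemma abs_iterate_le_two (ha : -2 ≤ a) (ha' : a ≤ 1 / 4) {x : ℝ} (hx : x ∈ Ia a) (n : ℕ) :
    |(fa a)^[n] x| ≤ 2 := by
  have h1 := (mapsTo_Ia ha ha').iterate n hx
  rw [Ia_eq] at h1
  exact (abs_le.2 h1).trans (beta_le_two ha)

/-- An open interval on which the first `n` iterates do not meet the critical point. -/
structure IsLap (a : ℝ) (n : ℕ) (J : Set ℝ) : Prop where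
  isOpen : IsOpen J
  ordConnected : J.OrdConnected
  subset : J ⊆ Ia a
  ne_zero : ∀ i < n, ∀ x ∈ J, (fa a)^[i] x ≠ 0

lemma injOn_iterate {n : ℕ} {J : Set ℝ}
    (hJ : ∀ i < n, ∀ x ∈ J, ∀ y ∈ J, 0 < (fa a)^[i] x * (fa a)^[i] y) : InjOn (fa a)^[n] J := by
  induction n with
  | zero => simp [injOn_id]
  | succ n ih =>
    intro x hx y hy hxy
    refine ih (fun i hi => hJ i (hi.trans (Nat.lt_succ_self n))) hx hy ?_
    rw [Function.iterate_succ_apply', Function.iterate_succ_apply', fa_apply, fa_apply] at hxy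
    have h1 := hJ n (Nat.lt_succ_self n) x hx y hy
    rcases sq_eq_sq_iff_eq_or_eq_neg.1 (add_right_cancel hxy) with h2 | h2
    · exact h2
    · rw [h2] at h1; nlinarith [sq_nonneg ((fa a)^[n] y)]

namespace IsLap

variable {n : ℕ} {J : Set ℝ}

lemma mul_pos (hJ : IsLap a n J) {i : ℕ} (hi : i < n) {x y : ℝ} (hx : x ∈ J) (hy : y ∈ J) :
    0 < (fa a)^[i] x * (fa a)^[i] y :=
  mul_pos_of_preconnected (continuous_iterate a i) hJ.ordConnected (hJ.ne_zero i hi) hx hy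

lemma injOn (hJ : IsLap a n J) : InjOn (fa a)^[n] J :=
  injOn_iterate fun _ hi _ hx _ hy => hJ.mul_pos hi hx hy

lemma mono_or_anti (hJ : IsLap a n J) {x y : ℝ} (hx : x ∈ J) (hy : y ∈ J) (hxy : x ≤ y) :
    StrictMonoOn (fa a)^[n] (Icc x y) ∨ StrictAntiOn (fa a)^[n] (Icc x y) :=
  ContinuousOn.strictMonoOn_of_injOn_Icc' hxy (continuous_iterate a n).continuousOn
    (hJ.injOn.mono (hJ.ordConnected.out hx hy))

lemma ordConnected_inter_preimage (hJ : IsLap a n J) {K : Set ℝ} (hK : K.OrdConnected) :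
    (J ∩ (fa a)^[n] ⁻¹' K).OrdConnected := by
  refine ⟨fun x hx y hy t ht => ⟨hJ.ordConnected.out hx.1 hy.1 ht, ?_⟩⟩
  have hxy := ht.1.trans ht.2
  rcases hJ.mono_or_anti hx.1 hy.1 hxy with h1 | h1
  · exact hK.out hx.2 hy.2 ⟨h1.monotoneOn ⟨le_rfl, hxy⟩ ht ht.1, h1.monotoneOn ht ⟨hxy, le_rfl⟩ ht.2⟩
  · exact hK.out hy.2 hx.2 ⟨h1.antitoneOn ht ⟨hxy, le_rfl⟩ ht.2, h1.antitoneOn ⟨le_rfl, hxy⟩ ht ht.1⟩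

lemma nu_le (hz : Admissible a z) (hJ : IsLap a n J) : nu a z J ≤ z ^ n * (2 / (1 - z)) := by
  rw [nu, hz.count_iterate n hJ.ne_zero hJ.injOn, mul_left_comm, mul_div_assoc]
  exact mul_le_mul_of_nonneg_left (hz.nu_le _) (pow_pos hz.pos n).le

lemma abs_theta_sub (hz : Admissible a z) (hJ : IsLap a n J) {x y : ℝ} (hx : x ∈ J) (hy : y ∈ J) :
    |theta a z x - theta a z y| =
      z ^ n * |theta a z ((fa a)^[n] x) - theta a z ((fa a)^[n] y)| :=
  hz.abs_theta_iterate_sub n fun _ hi => hJ.mul_pos hi hx hy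

end IsLap

/-- The sign `±1` coded by a Boolean. -/
def signOf (b : Bool) : ℝ := if b then 1 else -1

/-- The part of `J` whose itinerary from time `n` on starts with `w`. -/
def child (a : ℝ) (n : ℕ) (J : Set ℝ) {m : ℕ} (w : Fin m → Bool) : Set ℝ :=
  J ∩ {x | ∀ i : Fin m, 0 < signOf (w i) * (fa a)^[n + i] x}

lemma child_subset (a : ℝ) (n : ℕ) (J : Set ℝ) {m : ℕ} (w : Fin m → Bool) : child a n J w ⊆ J :=
  inter_subset_left

lemma child_cons (a : ℝ) (n : ℕ) (J : Set ℝ) {m : ℕ} (b : Bool) (w : Fin m → Bool) :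
    child a n J (Fin.cons b w : Fin (m + 1) → Bool) =
      child a (n + 1) (child a n J (fun _ : Fin 1 => b)) w := by
  ext x
  simp only [child, mem_inter_iff, mem_ofPred_eq, Fin.forall_fin_succ, Fin.cons_zero, Fin.cons_succ,
    Fin.val_zero, Fin.val_succ, add_zero, IsEmpty.forall_iff, and_true, and_assoc]
  simp only [add_assoc, add_comm 1]

lemma sum_children (m : ℕ) (F : (Fin (m + 1) → Bool) → ℝ) :
    ∑ w, F w = ∑ b : Bool, ∑ w : Fin m → Bool, F (Fin.cons b w) := by
  rw [← (Fin.consEquiv (fun _ : Fin (m + 1) => Bool)).sum_comp, Fintype.sum_prod_type]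
  rfl

lemma IsLap.child_one {n : ℕ} {J : Set ℝ} (hJ : IsLap a n J) (b : Bool) :
    IsLap a (n + 1) (child a n J (fun _ : Fin 1 => b)) := by
  have e : child a n J (fun _ : Fin 1 => b) = J ∩ (fa a)^[n] ⁻¹' {y | 0 < signOf b * y} := by
    ext x; simp [child]
  have ho : {y | 0 < signOf b * y}.OrdConnected := by
    refine ⟨fun x hx y hy t ht => ?_⟩
    cases b <;> simp only [signOf, mem_ofPred_eq, Bool.false_eq_true, if_true, if_false] at * <;>
      linarith [ht.1, ht.2]
  rw [e]
  refine ⟨hJ.isOpen.inter ?_, hJ.ordConnected_inter_preimage ho, inter_subset_left.trans hJ.subset,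
    ?_⟩
  · exact (isOpen_lt continuous_const (continuous_const.mul continuous_id)).preimage
      (continuous_iterate a n)
  · intro i hi x hx
    rcases Nat.lt_succ_iff_lt_or_eq.1 hi with h1 | h1
    · exact hJ.ne_zero i h1 x hx.1
    · subst h1
      have h2 : 0 < signOf b * (fa a)^[i] x := hx.2
      exact fun h3 => by rw [h3, mul_zero] at h2; exact lt_irrefl _ h2

lemma IsLap.child {n : ℕ} {J : Set ℝ} (hJ : IsLap a n J) {m : ℕ} (w : Fin m → Bool) :
    IsLap a (n + m) (child a n J w) := by
  induction m generalizing n J with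
  | zero => simpa [QuadraticFamily.child] using hJ
  | succ m ih =>
    have := ih (hJ.child_one (w 0)) (Fin.tail w)
    rw [← child_cons, Fin.cons_self_tail] at this
    rwa [show n + (m + 1) = n + 1 + m by ring]

lemma IsLap.measurableSet {n : ℕ} {J : Set ℝ} (hJ : IsLap a n J) : MeasurableSet J :=
  hJ.isOpen.measurableSet

lemma disjoint_child (a : ℝ) (n : ℕ) (J : Set ℝ) {m : ℕ} {v w : Fin m → Bool} (hvw : v ≠ w) :
    Disjoint (child a n J v) (child a n J w) := by
  obtain ⟨i, hi⟩ := Function.ne_iff.1 hvw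
  rw [Set.disjoint_left]
  intro x hx hy
  have h1 := hx.2 i
  have h2 := hy.2 i
  cases hv : v i <;> cases hw : w i <;> rw [hv, hw] at hi <;> simp at hi <;>
    simp [hv, hw, signOf] at h1 h2 <;> linarith

/-- The points of `J` outside all children meet the critical point. -/
lemma mem_iUnion_child (a : ℝ) (n : ℕ) (J : Set ℝ) (m : ℕ) {x : ℝ} (hx : x ∈ J)
    (hx0 : ∀ i < m, (fa a)^[n + i] x ≠ 0) : ∃ w : Fin m → Bool, x ∈ child a n J w := by
  refine ⟨fun i => decide (0 < (fa a)^[n + i] x), hx, fun i => ?_⟩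
  rcases lt_or_gt_of_ne (hx0 i i.2) with h1 | h1
  · have h2 : ¬ 0 < (fa a)^[n + i] x := h1.not_gt
    simp [signOf, h2, h1]
  · simp [signOf, h1]

open Classical in
/-- The weight of a lap. -/
noncomputable def omega (a z : ℝ) (n : ℕ) (J : Set ℝ) : ℝ :=
  if J.Nonempty then nu a z J + z ^ n * nu a z {0} else 0

lemma omega_nonneg (hz : Admissible a z) (n : ℕ) (J : Set ℝ) : 0 ≤ omega a z n J := by
  rw [omega]; split_ifs
  · exact add_nonneg (hz.nu_nonneg J) (mul_nonneg (pow_pos hz.pos n).le hz.nu_zero_pos.le)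
  · exact le_rfl

lemma omega_of_nonempty {n : ℕ} {J : Set ℝ} (hJ : J.Nonempty) :
    omega a z n J = nu a z J + z ^ n * nu a z {0} := if_pos hJ

lemma omega_empty (n : ℕ) : omega a z n ∅ = 0 := if_neg (by simp)

lemma sum_omega_child_one (hz : Admissible a z) {n : ℕ} {J : Set ℝ} (hJ : IsLap a n J)
    (hne : J.Nonempty) : ∑ b : Bool, omega a z (n + 1) (child a n J (fun _ : Fin 1 => b)) ≤
      omega a z n J - z ^ n * nu a z {0} * (1 - z) := by
  obtain ⟨P, hP⟩ : ∃ P, P = child a n J (fun _ : Fin 1 => true) := ⟨_, rfl⟩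
  obtain ⟨N, hN⟩ : ∃ N, N = child a n J (fun _ : Fin 1 => false) := ⟨_, rfl⟩
  have hdisj : Disjoint P N := by
    rw [hP, hN]; exact disjoint_child a n J (fun hcon => by simpa using congrFun hcon 0)
  have hPN : nu a z P + nu a z N ≤ nu a z J := by
    rw [← hz.nu_union hdisj]
    exact hz.nu_mono (union_subset (hP ▸ child_subset _ _ _ _) (hN ▸ child_subset _ _ _ _))
  have hzn := pow_pos hz.pos n
  have hD := hz.nu_zero_pos
  have hz1 := hz.lt_one
  have hz0 := hz.pos
  have hzD := _root_.mul_pos hzn hD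
  rw [Fintype.sum_bool, ← hP, ← hN, omega_of_nonempty hne]
  by_cases h1 : P.Nonempty
  · by_cases h2 : N.Nonempty
    · rw [omega_of_nonempty h1, omega_of_nonempty h2, pow_succ]
      obtain ⟨p, hp⟩ := h1
      obtain ⟨q, hq⟩ := h2
      have hpJ : p ∈ J := child_subset _ _ _ _ (hP ▸ hp)
      have hqJ : q ∈ J := child_subset _ _ _ _ (hN ▸ hq)
      have hp0 : 0 < (fa a)^[n] p := by
        rw [hP] at hp; simpa [signOf] using hp.2 0
      have hq0 : (fa a)^[n] q < 0 := by
        rw [hN] at hq; simpa [signOf] using hq.2 0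
      obtain ⟨t, ht, ht0⟩ := intermediate_value_uIcc (continuous_iterate a n).continuousOn
        (show (0 : ℝ) ∈ uIcc ((fa a)^[n] q) ((fa a)^[n] p) from
          Set.mem_uIcc.2 (Or.inl ⟨hq0.le, hp0.le⟩))
      have htJ : t ∈ J := hJ.ordConnected.uIcc_subset hqJ hpJ ht
      have hdt : Disjoint (P ∪ N) {t} := by
        rw [Set.disjoint_singleton_right]
        rintro (h3 | h3)
        · rw [hP] at h3; have := h3.2 0; simp [ht0] at this
        · rw [hN] at h3; have := h3.2 0; simp [ht0] at this
      have h4 : nu a z P + nu a z N + nu a z {t} ≤ nu a z J := by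
        rw [← hz.nu_union hdisj, ← hz.nu_union hdt]
        refine hz.nu_mono (union_subset (union_subset (hP ▸ child_subset _ _ _ _)
          (hN ▸ child_subset _ _ _ _)) (by simpa using htJ))
      have h5 := hz.pow_mul_nu_zero_le ht0
      nlinarith
    · rw [omega_of_nonempty h1, Set.not_nonempty_iff_eq_empty.1 h2, omega_empty, pow_succ]
      have := hz.nu_nonneg N
      nlinarith
  · rw [Set.not_nonempty_iff_eq_empty.1 h1, omega_empty]
    by_cases h2 : N.Nonempty
    · rw [omega_of_nonempty h2, pow_succ]
      have := hz.nu_nonneg P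
      nlinarith
    · rw [Set.not_nonempty_iff_eq_empty.1 h2, omega_empty]
      have := hz.nu_nonneg J
      nlinarith

lemma sum_omega_child_le (hz : Admissible a z) {n : ℕ} {J : Set ℝ} (hJ : IsLap a n J) (m : ℕ) :
    ∑ w : Fin m → Bool, omega a z (n + m) (child a n J w) ≤ omega a z n J := by
  induction m generalizing n J with
  | zero => simp [child]
  | succ m ih =>
    rcases J.eq_empty_or_nonempty with h1 | h1
    · subst h1
      have : ∀ w : Fin (m + 1) → Bool, child a n ∅ w = ∅ := fun w =>
        subset_empty_iff.1 (child_subset a n ∅ w)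
      simp [this, omega_empty]
    · rw [sum_children]
      calc _ ≤ ∑ b : Bool, omega a z (n + 1) (child a n J (fun _ : Fin 1 => b)) := by
            refine Finset.sum_le_sum fun b _ => ?_
            have := ih (hJ.child_one b)
            simp only [child_cons]
            rwa [show n + (m + 1) = n + 1 + m by ring]
        _ ≤ omega a z n J - z ^ n * nu a z {0} * (1 - z) := sum_omega_child_one hz hJ h1
        _ ≤ _ := by
          have := _root_.mul_pos (_root_.mul_pos (pow_pos hz.pos n) hz.nu_zero_pos)
            (sub_pos.2 hz.lt_one)
          linarith

end

section

variable {a z : ℝ}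

/-- The absolute value of the derivative of the `n`-th iterate. -/
noncomputable def slope (a : ℝ) (n : ℕ) (x : ℝ) : ℝ := ∏ i ∈ Finset.range n, 2 * |(fa a)^[i] x|

lemma slope_nonneg (a : ℝ) (n : ℕ) (x : ℝ) : 0 ≤ slope a n x :=
  Finset.prod_nonneg fun _ _ => by positivity

lemma continuous_slope (a : ℝ) (n : ℕ) : Continuous (slope a n) :=
  continuous_finsetProd _ fun i _ => continuous_const.mul (continuous_iterate a i).abs

lemma abs_deriv_iterate (a : ℝ) (n : ℕ) (x : ℝ) :
    |∏ i ∈ Finset.range n, 2 * (fa a)^[i] x| = slope a n x := by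
  simp [slope, Finset.abs_prod, abs_mul]

lemma slope_add_le (ha : -2 ≤ a) (ha' : a ≤ 1 / 4) {x : ℝ} (hx : x ∈ Ia a) (n r : ℕ) :
    slope a (n + r) x ≤ slope a n x * 4 ^ r := by
  induction r with
  | zero => simp
  | succ r ih =>
    rw [← add_assoc, slope, Finset.prod_range_succ, pow_succ (4 : ℝ), ← mul_assoc (slope a n x)]
    have := abs_iterate_le_two ha ha' hx (n + r)
    exact mul_le_mul ih (by linarith) (by positivity)
      (mul_nonneg (slope_nonneg _ _ _) (by positivity))

lemma isCompact_Ia (a : ℝ) : IsCompact (Ia a) := isCompact_Icc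

lemma IsLap.volume_lt_top {n : ℕ} {J : Set ℝ} (hJ : IsLap a n J) : volume J < ⊤ :=
  (measure_mono hJ.subset).trans_lt (isCompact_Ia a).measure_lt_top

lemma IsLap.integrableOn {n : ℕ} {J : Set ℝ} (hJ : IsLap a n J) {g : ℝ → ℝ} (hg : Continuous g) :
    IntegrableOn g J :=
  (hg.continuousOn.integrableOn_compact (isCompact_Ia a)).mono_set hJ.subset

lemma IsLap.volume_pos {n : ℕ} {J : Set ℝ} (hJ : IsLap a n J) (hne : J.Nonempty) :
    0 < volume.real J :=
  ENNReal.toReal_pos (hJ.isOpen.measure_pos volume hne).ne' hJ.volume_lt_top.ne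

lemma IsLap.setIntegral_slope_le (ha : -2 ≤ a) (ha' : a ≤ 1 / 4) {n : ℕ} {J : Set ℝ}
    (hJ : IsLap a n J) : ∫ x in J, slope a n x ≤ 4 := by
  have h1 := integral_image_eq_integral_abs_deriv_smul hJ.measurableSet
    (fun x _ => (hasDerivAt_iterate a x n).hasDerivWithinAt) hJ.injOn (fun _ => (1 : ℝ))
  simp only [smul_eq_mul, mul_one, abs_deriv_iterate] at h1
  rw [← h1, setIntegral_const, smul_eq_mul, mul_one]
  have h2 : (fa a)^[n] '' J ⊆ Icc (-2) 2 := by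
    rintro _ ⟨x, hx, rfl⟩
    exact abs_le.1 (abs_iterate_le_two ha ha' (hJ.subset hx) n)
  refine (measureReal_mono h2 (by simp)).trans ?_
  simp [measureReal_def]; norm_num

lemma IsLap.setIntegral_sqrt_slope_le (ha : -2 ≤ a) (ha' : a ≤ 1 / 4) {n : ℕ} {J : Set ℝ}
    (hJ : IsLap a n J) (hne : J.Nonempty) (r : ℕ) :
    ∫ x in J, √(slope a (n + r) x) ≤ 2 ^ r * (2 * √(volume.real J)) := by
  have hV := hJ.volume_pos hne
  set t := √(volume.real J) with ht
  have ht0 : 0 < t := Real.sqrt_pos.2 hV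
  have htt : t * t = volume.real J := Real.mul_self_sqrt hV.le
  have hfin : IsFiniteMeasure (volume.restrict J) := ⟨by simpa using hJ.volume_lt_top⟩
  have h1 : ∀ x ∈ J, √(slope a (n + r) x) ≤ 2 ^ r * (t / 4 * slope a n x + 1 / t) := by
    intro x hx
    have h2 : √(slope a (n + r) x) ≤ 2 ^ r * √(slope a n x) := by
      rw [Real.sqrt_le_left (by positivity), mul_pow, Real.sq_sqrt (slope_nonneg _ _ _), ← pow_mul,
        mul_comm r, pow_mul]
      have := slope_add_le ha ha' (hJ.subset hx) n r
      norm_num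
      linarith
    refine h2.trans (mul_le_mul_of_nonneg_left ?_ (by positivity))
    have h3 := Real.sq_sqrt (slope_nonneg a n x)
    set u := √(slope a n x)
    have h4 : t / 4 * u ^ 2 + 1 / t - u = (t * u / 2 - 1) ^ 2 / t := by field_simp; ring
    rw [← h3, ← sub_nonneg, h4]; positivity
  calc ∫ x in J, √(slope a (n + r) x)
      ≤ ∫ x in J, 2 ^ r * (t / 4 * slope a n x + 1 / t) := by
        refine setIntegral_mono_on (hJ.integrableOn (continuous_slope a _).sqrt)
          (hJ.integrableOn ?_) hJ.measurableSet h1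
        have := continuous_slope a n
        fun_prop
    _ = 2 ^ r * (t / 4 * (∫ x in J, slope a n x) + t) := by
        rw [integral_const_mul, integral_add, integral_const_mul, setIntegral_const, ← htt,
          smul_eq_mul]
        · field_simp
        · exact (hJ.integrableOn (continuous_slope a n)).const_mul _
        · exact integrable_const _
    _ ≤ _ := by
        have := hJ.setIntegral_slope_le ha ha'
        refine mul_le_mul_of_nonneg_left ?_ (by positivity)
        nlinarith

lemma setIntegral_eq_sum_child {n : ℕ} {J : Set ℝ} (hJ : IsLap a n J) (m : ℕ)
    {g : ℝ → ℝ} (hg : Continuous g) :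
    ∫ x in J, g x = ∑ w : Fin m → Bool, ∫ x in child a n J w, g x := by
  rw [← integral_biUnion_finset]
  · refine setIntegral_congr_set ?_
    have hfin : (⋃ i ∈ Finset.range m, (zeros a (n + i) : Set ℝ)).Finite :=
      (Finset.range m).finite_toSet.biUnion fun i _ => (zeros a (n + i)).finite_toSet
    have h0 := hfin.measure_zero volume
    rw [eventuallyEq_set]
    filter_upwards [measure_eq_zero_iff_ae_notMem.1 h0] with x hx
    simp only [mem_iUnion, Finset.mem_univ, exists_const]
    refine ⟨fun h1 => ?_, fun ⟨w, hw⟩ => child_subset _ _ _ _ hw⟩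
    refine mem_iUnion_child a n J m h1 fun i hi h2 => hx ?_
    simp only [mem_iUnion]
    exact ⟨i, by simpa using hi, by simpa using mem_zeros.2 h2⟩
  · exact fun w _ => (hJ.child w).measurableSet
  · exact fun v _ w _ hvw => disjoint_child a n J hvw
  · exact fun w _ => (hJ.child w).integrableOn hg

/-- The lap `J` contracts at time `m`, with rate `ρ` and exponent `χ`. -/
def Contracts (a z χ ρ : ℝ) (n m : ℕ) (J : Set ℝ) : Prop :=
  ∑ w : Fin m → Bool, √(volume.real (child a n J w)) * omega a z (n + m) (child a n J w) ^ χ ≤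
    ρ ^ m * (√(volume.real J) * omega a z n J ^ χ)

lemma setIntegral_sqrt_slope_le_of_contracts (hz : Admissible a z) (ha : a ≤ 1 / 4) {χ ρ : ℝ}
    (hχ : 0 ≤ χ) (hρ : 1 ≤ ρ) {k : ℕ}
    (H : ∀ n J, IsLap a n J → J.Nonempty → ∃ m, 1 ≤ m ∧ m ≤ k ∧ Contracts a z χ ρ n m J) (r : ℕ) :
    ∀ n J, IsLap a n J → J.Nonempty →
      ∫ x in J, √(slope a (n + r) x) ≤ 2 ^ (k + 1) / nu a z {0} ^ χ * ((z ^ χ)⁻¹ ^ (n + r) * ρ ^ r *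
        (√(volume.real J) * omega a z n J ^ χ)) := by
  have hD := hz.nu_zero_pos
  have hzχ : 0 < z ^ χ := Real.rpow_pos_of_pos hz.pos χ
  have hzχ1 : z ^ χ ≤ 1 := Real.rpow_le_one hz.pos.le hz.lt_one.le hχ
  induction r using Nat.strong_induction_on with
  | _ r ih =>
  intro n J hJ hne
  obtain ⟨m, hm1, hmk, hm⟩ := H n J hJ hne
  rcases le_or_gt m r with hmr | hmr
  · rw [setIntegral_eq_sum_child hJ m (continuous_slope a _).sqrt]
    have hw : ∀ w : Fin m → Bool, ∫ x in child a n J w, √(slope a (n + r) x) ≤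
        2 ^ (k + 1) / nu a z {0} ^ χ * ((z ^ χ)⁻¹ ^ (n + r) * ρ ^ (r - m)) *
        (√(volume.real (child a n J w)) * omega a z (n + m) (child a n J w) ^ χ) := by
      intro w
      rcases (child a n J w).eq_empty_or_nonempty with h1 | h1
      · simp [h1]
      · have := ih (r - m) (by omega) (n + m) _ (hJ.child w) h1
        rw [show n + m + (r - m) = n + r by omega] at this
        exact this.trans_eq (by ring)
    refine (Finset.sum_le_sum fun w _ => hw w).trans ?_
    rw [← Finset.mul_sum]
    refine (mul_le_mul_of_nonneg_left hm (by positivity)).trans_eq ?_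
    have : ρ ^ r = ρ ^ (r - m) * ρ ^ m := by rw [← pow_add]; congr 1; omega
    rw [this]; ring
  · refine (hJ.setIntegral_sqrt_slope_le hz.neg_two_le ha hne r).trans ?_
    have h1 : nu a z {0} ^ χ ≤ (z ^ χ)⁻¹ ^ n * omega a z n J ^ χ := by
      have h2 : z ^ n * nu a z {0} ≤ omega a z n J := by
        rw [omega_of_nonempty hne]; linarith [hz.nu_nonneg J]
      have h3 := Real.rpow_le_rpow (mul_pos (pow_pos hz.pos n) hD).le h2 hχ
      rw [Real.mul_rpow (pow_pos hz.pos n).le hD.le, ← Real.rpow_natCast, ← Real.rpow_mul hz.pos.le,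
        mul_comm (n : ℝ), Real.rpow_mul hz.pos.le, Real.rpow_natCast] at h3
      rw [inv_pow, inv_mul_eq_div, le_div_iff₀ (by positivity)]
      linarith
    have h4 : (1 : ℝ) ≤ (z ^ χ)⁻¹ ^ r := one_le_pow₀ ((one_le_inv₀ hzχ).2 hzχ1)
    have h5 : (1 : ℝ) ≤ ρ ^ r := one_le_pow₀ hρ
    have h6 : (2 : ℝ) ^ r ≤ 2 ^ k := pow_le_pow_right₀ (by norm_num) (by omega)
    have hDχ : 0 < nu a z {0} ^ χ := Real.rpow_pos_of_pos hD χ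
    have h7 : (1 : ℝ) ≤ (nu a z {0} ^ χ)⁻¹ * ((z ^ χ)⁻¹ ^ n * omega a z n J ^ χ) := by
      rw [inv_mul_eq_div, le_div_iff₀ hDχ]; linarith
    calc 2 ^ r * (2 * √(volume.real J)) ≤ 2 ^ k * (2 * √(volume.real J)) := by gcongr
      _ = 2 ^ (k + 1) * √(volume.real J) * 1 * 1 * 1 := by ring
      _ ≤ 2 ^ (k + 1) * √(volume.real J) *
          ((nu a z {0} ^ χ)⁻¹ * ((z ^ χ)⁻¹ ^ n * omega a z n J ^ χ)) * (z ^ χ)⁻¹ ^ r * ρ ^ r := by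
        gcongr
      _ = _ := by rw [pow_add _ n r]; ring

lemma isLap_Ioo (a : ℝ) : IsLap a 0 (Ioo (-beta a) (beta a)) :=
  ⟨isOpen_Ioo, ordConnected_Ioo, by rw [Ia_eq]; exact Ioo_subset_Icc_self, by simp⟩

/-- If every lap contracts within bounded time, the mean square root slope grows slowly. -/
lemma exists_integral_sqrt_slope_le (hz : Admissible a z) (ha : a ≤ 1 / 4) {χ ρ : ℝ}
    (hχ : 0 ≤ χ) (hρ : 1 ≤ ρ) {k : ℕ}
    (H : ∀ n J, IsLap a n J → J.Nonempty → ∃ m, 1 ≤ m ∧ m ≤ k ∧ Contracts a z χ ρ n m J) :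
    ∃ C : ℝ, ∀ n, ∫ x in Ia a, √(slope a n x) ≤ C * ((z ^ χ)⁻¹ * ρ) ^ n := by
  refine ⟨2 ^ (k + 1) / nu a z {0} ^ χ * (√(volume.real (Ioo (-beta a) (beta a))) *
    omega a z 0 (Ioo (-beta a) (beta a)) ^ χ), fun n => ?_⟩
  have := setIntegral_sqrt_slope_le_of_contracts hz ha hχ hρ H n 0 _ (isLap_Ioo a)
    ⟨0, by simp [beta_pos]⟩
  rw [zero_add] at this
  rw [Ia_eq, integral_Icc_eq_integral_Ioo]
  exact this.trans_eq (by rw [mul_pow]; ring)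

end

section

variable {a z : ℝ}

lemma deriv_fa (a x : ℝ) : deriv (fa a) x = 2 * x := (hasDerivAt_fa a x).deriv

/-- The set of points whose orbit meets the critical point is countable. -/
lemma ae_iterate_ne_zero (a : ℝ) : ∀ᵐ x ∂(volume : Measure ℝ), ∀ n, (fa a)^[n] x ≠ 0 := by
  have hc : (⋃ n, (zeros a n : Set ℝ)).Countable :=
    countable_iUnion fun n => (zeros a n).countable_toSet
  filter_upwards [measure_eq_zero_iff_ae_notMem.1 (hc.measure_zero volume)] with x hx n h0
  exact hx (mem_iUnion.2 ⟨n, by simpa using mem_zeros.2 h0⟩)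

lemma log_slope (a : ℝ) {x : ℝ} (hx : ∀ n, (fa a)^[n] x ≠ 0) (n : ℕ) :
    Real.log (slope a n x) = ∑ i ∈ Finset.range n, Real.log |deriv (fa a) ((fa a)^[i] x)| := by
  rw [slope, Real.log_prod]
  · simp [deriv_fa, abs_mul]
  · intro i _
    simpa using hx i

variable {μ : Measure ℝ}

lemma IsAcip.measurePreserving (hμ : IsAcip a μ) (n : ℕ) :
    MeasurePreserving ((fa a)^[n]) μ μ :=
  MeasurePreserving.iterate ⟨(continuous_fa a).measurable, hμ.2.2.1⟩ n

lemma measurable_log_deriv (a : ℝ) : Measurable fun x => Real.log |deriv (fa a) x| := by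
  simp only [deriv_fa]
  fun_prop

lemma integrable_log_iterate (hμ : IsAcip a μ)
    (hi : Integrable (fun x => Real.log |deriv (fa a) x|) μ) (n : ℕ) :
    Integrable (fun x => Real.log |deriv (fa a) ((fa a)^[n] x)|) μ :=
  ((IsAcip.measurePreserving hμ n).integrable_comp
    (measurable_log_deriv a).aestronglyMeasurable).2 hi

lemma integral_log_iterate (hμ : IsAcip a μ) (n : ℕ) :
    ∫ x, Real.log |deriv (fa a) ((fa a)^[n] x)| ∂μ = ∫ x, Real.log |deriv (fa a) x| ∂μ := by
  have h1 := IsAcip.measurePreserving hμ n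
  conv_rhs => rw [← h1.map_eq]
  exact (integral_map h1.measurable.aemeasurable
    (measurable_log_deriv a).aestronglyMeasurable).symm

lemma restrict_le_smul_volume [IsFiniteMeasure μ] (hμ : μ ≪ volume) {I : Set ℝ}
    (hI : MeasurableSet I) (M : ℕ) :
    μ.restrict (I ∩ {x | μ.rnDeriv volume x ≤ M}) ≤ (M : ENNReal) • volume.restrict I := by
  have hS : MeasurableSet {x | μ.rnDeriv volume x ≤ M} :=
    measurableSet_le (Measure.measurable_rnDeriv _ _) measurable_const
  refine Measure.le_iff.2 fun T hT => ?_
  rw [Measure.restrict_apply hT, Measure.smul_apply, Measure.restrict_apply hT,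
    ← Measure.setLIntegral_rnDeriv hμ, smul_eq_mul]
  calc ∫⁻ x in T ∩ (I ∩ {x | μ.rnDeriv volume x ≤ M}), μ.rnDeriv volume x
      ≤ ∫⁻ _ in T ∩ (I ∩ {x | μ.rnDeriv volume x ≤ M}), (M : ENNReal) :=
        setLIntegral_mono' (hT.inter (hI.inter hS)) fun x hx => hx.2.2
    _ = M * volume (T ∩ (I ∩ {x | μ.rnDeriv volume x ≤ M})) := by simp
    _ ≤ _ := by gcongr; exact inter_subset_left

lemma le_of_forall_exp_mul_le {κ m C ρ : ℝ} (hm : 0 < m) (hρ : 0 < ρ)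
    (h : ∀ n : ℕ, Real.exp (n * κ) * m ≤ C * ρ ^ n) : κ ≤ Real.log ρ := by
  by_contra! h1
  have h2 : 1 < Real.exp κ / ρ := by
    rw [one_lt_div hρ, ← Real.exp_log hρ]; exact Real.exp_lt_exp.2 h1
  obtain ⟨n, hn⟩ := ((tendsto_pow_atTop_atTop_of_one_lt h2).eventually_gt_atTop (C / m)).exists
  have h3 := h n
  rw [div_pow, ← Real.exp_nat_mul, div_lt_div_iff₀ hm (by positivity)] at hn
  linarith

lemma lyapunov_le_of_restrict (ha : -2 ≤ a) (ha' : a ≤ 1 / 4) (hμ : IsAcip a μ)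
    (hi : Integrable (fun x => Real.log |deriv (fa a) x|) μ) {C ρ : ℝ} (hρ : 0 < ρ)
    (hC : ∀ n, ∫ x in Ia a, √(slope a n x) ≤ C * ρ ^ n) {S : Set ℝ} (hS : MeasurableSet S)
    (hS0 : 0 < μ.real S) {M : ℕ} (hM : μ.restrict S ≤ (M : ENNReal) • volume.restrict (Ia a)) :
    ∫ x, Real.log |deriv (fa a) x| ∂μ - (1 - μ.real S) * Real.log 4 ≤
      2 * μ.real S * Real.log ρ := by
  have := hμ.1
  set L := ∫ x, Real.log |deriv (fa a) x| ∂μ with hL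
  set m := μ.real S with hm
  have hm' : μ.real Sᶜ = 1 - m := by rw [probReal_compl_eq_one_sub hS]
  suffices (L - (1 - m) * Real.log 4) / (2 * m) ≤ Real.log ρ by
    rw [div_le_iff₀ (by positivity)] at this; linarith
  refine le_of_forall_exp_mul_le (C := M * C) hS0 hρ fun n => ?_
  set c := (n : ℝ) * ((L - (1 - m) * Real.log 4) / (2 * m)) with hc
  let G : ℝ → ℝ := fun x => ∑ i ∈ Finset.range n, Real.log |deriv (fa a) ((fa a)^[i] x)|
  have hGi : Integrable G μ := integrable_finsetSum _ fun i _ => integrable_log_iterate hμ hi i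
  have hG : ∫ x, G x ∂μ = n * L := by
    rw [integral_finsetSum _ fun i _ => integrable_log_iterate hμ hi i]
    rw [Finset.sum_congr rfl fun i _ => integral_log_iterate hμ i, Finset.sum_const,
      Finset.card_range, nsmul_eq_mul]
  have hne := hμ.2.2.2.ae_le (ae_iterate_ne_zero a)
  have hI : ∀ᵐ x ∂μ, x ∈ Ia a := hμ.2.1
  have hG4 : ∀ᵐ x ∂μ, G x ≤ n * Real.log 4 := by
    filter_upwards [hne, hI] with x hx hxI
    have : ∀ i ∈ Finset.range n, Real.log |deriv (fa a) ((fa a)^[i] x)| ≤ Real.log 4 := by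
      intro i _
      have := abs_iterate_le_two ha ha' hxI i
      refine Real.log_le_log (by simpa [deriv_fa] using hx i) ?_
      rw [deriv_fa, abs_mul, abs_two]; linarith
    have h5 := Finset.sum_le_card_nsmul _ _ _ this
    rwa [Finset.card_range, nsmul_eq_mul] at h5
  have hSc : ∫ x in Sᶜ, G x ∂μ ≤ (1 - m) * (n * Real.log 4) := by
    calc _ ≤ ∫ _ in Sᶜ, n * Real.log 4 ∂μ := by
          refine setIntegral_mono_ae hGi.integrableOn (integrable_const _).integrableOn ?_
          filter_upwards [hG4] with x hx using hx
      _ = _ := by rw [setIntegral_const, hm', smul_eq_mul]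
  have hSG : n * L - (1 - m) * (n * Real.log 4) ≤ ∫ x in S, G x ∂μ := by
    have := integral_add_compl hS hGi
    linarith
  have hcm : c * (2 * m) = n * L - (1 - m) * (n * Real.log 4) := by
    rw [hc]; field_simp
  have hvol : Integrable (fun x => √(slope a n x)) (volume.restrict (Ia a)) :=
    (continuous_slope a n).sqrt.continuousOn.integrableOn_compact (isCompact_Ia a)
  have hvol' : Integrable (fun x => √(slope a n x)) ((M : ENNReal) • volume.restrict (Ia a)) :=
    hvol.smul_measure (by simp)
  have h1 : ∫ x in S, √(slope a n x) ∂μ ≤ M * (C * ρ ^ n) := by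
    calc _ ≤ ∫ x, √(slope a n x) ∂((M : ENNReal) • volume.restrict (Ia a)) :=
          integral_mono_measure hM (Eventually.of_forall fun x => Real.sqrt_nonneg _) hvol'
      _ = M * ∫ x in Ia a, √(slope a n x) := by simp [integral_smul_measure]
      _ ≤ _ := by gcongr; exact hC n
  have h2 : ∫ x in S, Real.exp c * (1 - c + G x / 2) ∂μ ≤ ∫ x in S, √(slope a n x) ∂μ := by
    refine setIntegral_mono_ae ?_ (hvol'.mono_measure hM) ?_
    · exact ((((integrable_const _).add (hGi.div_const 2)).const_mul _)).integrableOn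
    · filter_upwards [hne] with x hx
      have hpos : 0 < slope a n x :=
        Finset.prod_pos fun i _ => by have := hx i; positivity
      have h3 : √(slope a n x) = Real.exp (G x / 2) := by
        rw [show G x = _ from (log_slope a hx n).symm, Real.sqrt_eq_rpow,
          Real.rpow_def_of_pos hpos]
        congr 1; ring
      rw [h3, show G x / 2 = c + (G x / 2 - c) by ring, Real.exp_add]
      refine mul_le_mul_of_nonneg_left ?_ (Real.exp_pos _).le
      have := Real.add_one_le_exp (G x / 2 - c)
      linarith
  rw [integral_const_mul, integral_add (integrable_const _).integrableOn
    (hGi.div_const 2).integrableOn, setIntegral_const, integral_div, smul_eq_mul, ← hm] at h2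
  have h4 : Real.exp c * m ≤ Real.exp c * (m * (1 - c) + (∫ x in S, G x ∂μ) / 2) := by
    refine mul_le_mul_of_nonneg_left ?_ (Real.exp_pos _).le
    linarith
  linarith

lemma lyapunov_le (ha : -2 ≤ a) (ha' : a ≤ 1 / 4) (hμ : IsAcip a μ)
    (hi : Integrable (fun x => Real.log |deriv (fa a) x|) μ) {C ρ : ℝ} (hρ : 0 < ρ)
    (hC : ∀ n, ∫ x in Ia a, √(slope a n x) ≤ C * ρ ^ n) :
    ∫ x, Real.log |deriv (fa a) x| ∂μ ≤ 2 * Real.log ρ := by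
  have := hμ.1
  let S : ℕ → Set ℝ := fun M => Ia a ∩ {x | μ.rnDeriv volume x ≤ M}
  have hIm : MeasurableSet (Ia a) := (isCompact_Ia a).measurableSet
  have hS : ∀ M, MeasurableSet (S M) := fun M => hIm.inter
    (measurableSet_le (Measure.measurable_rnDeriv _ _) measurable_const)
  have hmono : Monotone S := fun M N hMN =>
    inter_subset_inter_right _ fun x hx => by
      rw [mem_ofPred_eq] at hx ⊢
      exact hx.trans (by exact_mod_cast hMN)
  have hU : μ (⋃ M, S M) = 1 := by
    rw [← prob_compl_eq_zero_iff (MeasurableSet.iUnion hS), measure_eq_zero_iff_ae_notMem]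
    filter_upwards [hμ.2.2.2.ae_le (Measure.rnDeriv_lt_top μ volume),
      (show ∀ᵐ x ∂μ, x ∈ Ia a from hμ.2.1)] with x hx hxI
    obtain ⟨M, hM⟩ := ENNReal.exists_nat_gt hx.ne
    simp only [mem_compl_iff, not_not, mem_iUnion]
    exact ⟨M, hxI, hM.le⟩
  have hlim : Tendsto (fun M => μ.real (S M)) atTop (𝓝 1) := by
    have h1 := tendsto_measure_iUnion_atTop (μ := μ) hmono
    rw [hU] at h1
    exact (ENNReal.tendsto_toReal ENNReal.one_ne_top).comp h1
  have h2 : ∀ᶠ M in atTop, ∫ x, Real.log |deriv (fa a) x| ∂μ - (1 - μ.real (S M)) * Real.log 4 ≤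
      2 * μ.real (S M) * Real.log ρ := by
    filter_upwards [hlim.eventually (lt_mem_nhds one_pos)] with M hM
    exact lyapunov_le_of_restrict ha ha' hμ hi hρ hC (hS M) hM
      (restrict_le_smul_volume hμ.2.2.2 hIm M)
  have h3 := le_of_tendsto_of_tendsto
    (((hlim.const_sub 1).mul_const (Real.log 4)).const_sub _)
    ((hlim.const_mul 2).mul_const (Real.log ρ)) h2
  simpa using h3

end

section

variable {a z : ℝ}

lemma exists_cover_of_coverEntropy_lt {b : ℝ}
    (hb : Dynamics.coverEntropy (fa a) (Ia a) < (b : EReal)) {e : ℝ} (he : 0 < e) :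
    ∀ᶠ n : ℕ in atTop, ∃ s : Finset ℝ, (s.card : ℝ) ≤ Real.exp (b * n) ∧
      ∀ x ∈ Ia a, ∃ c ∈ s, ∀ i < n, |(fa a)^[i] x - (fa a)^[i] c| < e := by
  have hU : {p : ℝ × ℝ | dist p.1 p.2 < e} ∈ uniformity ℝ := Metric.dist_mem_uniformity he
  have h1 := (Dynamics.coverEntropyEntourage_le_coverEntropy (fa a) (Ia a) hU).trans_lt hb
  filter_upwards [ExpGrowth.eventually_le_exp h1] with n hn
  have e1 : EReal.exp ((b : EReal) * n) = ENNReal.ofReal (Real.exp (b * n)) := by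
    rw [← EReal.exp_coe]; norm_cast
  rw [e1] at hn
  have h2 : Dynamics.coverMincard (fa a) (Ia a) {p : ℝ × ℝ | dist p.1 p.2 < e} n < ⊤ := by
    have := hn.trans_lt ENNReal.ofReal_lt_top
    simpa using this
  obtain ⟨s, hs, hsc⟩ := (Dynamics.coverMincard_finite_iff _ _ _ _).1 h2
  refine ⟨s, ?_, fun x hx => ?_⟩
  · rw [← hsc] at hn
    have h3 : ENNReal.ofReal (s.card : ℝ) ≤ ENNReal.ofReal (Real.exp (b * n)) := by simpa using hn
    exact (ENNReal.ofReal_le_ofReal_iff (Real.exp_pos _).le).1 h3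
  · obtain ⟨c, hc, hxc⟩ := hs hx
    exact ⟨c, hc, fun i hi => Dynamics.mem_dynEntourage.1 hxc i hi⟩

lemma coverEntropy_le_of_covers {b : ℝ}
    (H : ∀ e > 0, ∀ᶠ n : ℕ in atTop, ∃ s : Finset ℝ, (s.card : ℝ) ≤ Real.exp (b * n) ∧
      ∀ x ∈ Ia a, ∃ c ∈ s, ∀ i < n, |(fa a)^[i] x - (fa a)^[i] c| < e) :
    Dynamics.coverEntropy (fa a) (Ia a) ≤ b := by
  rw [Dynamics.coverEntropy_eq_iSup_basis Metric.uniformity_basis_dist]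
  refine iSup₂_le fun e he => ?_
  refine Eventually.expGrowthSup_le ?_
  filter_upwards [H e he] with n ⟨s, hs, hcov⟩
  have e1 : EReal.exp ((b : EReal) * n) = ENNReal.ofReal (Real.exp (b * n)) := by
    rw [← EReal.exp_coe]; norm_cast
  rw [e1]
  have h1 : Dynamics.IsDynCoverOf (fa a) (Ia a) {p : ℝ × ℝ | dist p.1 p.2 < e} n s := by
    intro x hx
    obtain ⟨c, hc, hxc⟩ := hcov x hx
    exact ⟨c, hc, Dynamics.mem_dynEntourage.2 hxc⟩
  calc ((Dynamics.coverMincard (fa a) (Ia a) {p : ℝ × ℝ | dist p.1 p.2 < e} n : ℕ∞) : ENNReal)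
      ≤ ((s.card : ℕ∞) : ENNReal) := ENat.toENNReal_mono h1.coverMincard_le_card
    _ = ENNReal.ofReal (s.card : ℝ) := by simp
    _ ≤ _ := ENNReal.ofReal_le_ofReal hs

lemma mem_Ia_of_iterate_eq_zero (ha' : a ≤ 1 / 4) {x : ℝ} {m : ℕ}
    (hx : (fa a)^[m] x = 0) : x ∈ Ia a := by
  rw [Ia_eq]
  by_contra hcon
  have h0 : beta a < |x| := by
    by_contra! h1; exact hcon (abs_le.1 h1)
  have : ∀ n, beta a < |(fa a)^[n] x| := by
    intro n
    induction n with
    | zero => simpa using h0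
    | succ n ih =>
      rw [Function.iterate_succ_apply', fa_apply]
      refine lt_of_lt_of_le ?_ (le_abs_self _)
      have h1 : beta a ^ 2 < ((fa a)^[n] x) ^ 2 := by
        rw [← sq_abs ((fa a)^[n] x)]; have := beta_pos a; gcongr
      rw [beta_sq ha'] at h1; linarith
  have h1 := this m
  rw [hx, abs_zero] at h1
  linarith [beta_pos a]

lemma eq_of_sign_eq {m : ℕ} {x y : ℝ} (hx : (fa a)^[m] x = (fa a)^[m] y)
    (h : ∀ i < m, SignType.sign ((fa a)^[i] x) = SignType.sign ((fa a)^[i] y)) : x = y := by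
  induction m with
  | zero => simpa using hx
  | succ m ih =>
    refine ih ?_ fun i hi => h i (hi.trans (Nat.lt_succ_self m))
    rw [Function.iterate_succ_apply', Function.iterate_succ_apply', fa_apply, fa_apply] at hx
    have h1 := h m (Nat.lt_succ_self m)
    rcases sq_eq_sq_iff_eq_or_eq_neg.1 (add_right_cancel hx) with h2 | h2
    · exact h2
    · rw [h2, Left.sign_neg] at h1
      have h3 : (fa a)^[m] y = 0 := by
        rcases lt_trichotomy ((fa a)^[m] y) 0 with h4 | h4 | h4
        · rw [sign_neg h4] at h1; exact absurd h1 (by decide)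
        · exact h4
        · rw [sign_pos h4] at h1; exact absurd h1 (by decide)
      rw [h2, h3, neg_zero]

lemma sign_eq_of_abs_sub_lt {x y e : ℝ} (hx : e ≤ |x|) (hxy : |x - y| < e) :
    SignType.sign x = SignType.sign y := by
  rw [abs_lt] at hxy
  rcases le_abs.1 hx with h1 | h1
  · rw [sign_pos (by linarith), sign_pos (by linarith)]
  · rw [sign_neg (by linarith), sign_neg (by linarith)]

lemma card_le_of_spaced {r m : ℕ} {T : Finset ℕ} (hT : ∀ i ∈ T, i < m) (hr : 0 < r)
    (hs : ∀ i ∈ T, ∀ j ∈ T, i < j → i + r ≤ j) : T.card ≤ m / r + 1 := by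
  rw [← Finset.card_range (m / r + 1)]
  refine Finset.card_le_card_of_injOn (· / r) (fun i hi => ?_) fun i hi j hj hij => ?_
  · simpa using Nat.lt_succ_of_le (Nat.div_le_div_right (hT i hi).le)
  · have hij' : i / r = j / r := hij
    have key : ∀ i ∈ T, ∀ j ∈ T, i < j → i / r < j / r := fun i hi j hj h => by
      have h2 := Nat.div_le_div_right (c := r) (hs i hi j hj h)
      rw [Nat.add_div_right _ hr] at h2
      omega
    rcases lt_trichotomy i j with h | h | h
    · have := key i hi j hj h; omega
    · exact h
    · have := key j hj i hi h; omega

/-- The zeros of the `m`-th iterate shadowing the orbit of `x`. -/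
noncomputable def shadowZeros (a : ℝ) (m : ℕ) (e x : ℝ) : Finset ℝ := by
  classical exact (zeros a m).filter fun y => ∀ i < m, |(fa a)^[i] x - (fa a)^[i] y| < e

lemma mem_shadowZeros {m : ℕ} {e x y : ℝ} : y ∈ shadowZeros a m e x ↔
    (fa a)^[m] y = 0 ∧ ∀ i < m, |(fa a)^[i] x - (fa a)^[i] y| < e := by
  classical
  rw [shadowZeros, Finset.mem_filter, mem_zeros]

lemma card_shadowZeros_le_pow {m : ℕ} {e x : ℝ} {T : Finset ℕ}
    (hT : ∀ i < m, i ∉ T → e ≤ |(fa a)^[i] x|) : (shadowZeros a m e x).card ≤ 3 ^ T.card := by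
  have h1 : Fintype.card (T → SignType) = 3 ^ T.card := by simp [Fintype.card_pi]; rfl
  rw [← h1, ← Finset.card_univ]
  refine Finset.card_le_card_of_injOn (fun y i => SignType.sign ((fa a)^[i] y))
    (fun _ _ => Finset.mem_coe.2 (Finset.mem_univ _)) fun y hy y' hy' hyy => ?_
  rw [Finset.mem_coe, mem_shadowZeros] at hy hy'
  refine eq_of_sign_eq (m := m) (by rw [hy.1, hy'.1]) fun i hi => ?_
  by_cases hiT : i ∈ T
  · exact congrFun hyy ⟨i, hiT⟩
  · rw [← sign_eq_of_abs_sub_lt (hT i hi hiT) (hy.2 i hi),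
      ← sign_eq_of_abs_sub_lt (hT i hi hiT) (hy'.2 i hi)]

lemma exists_card_shadowZeros_le_of_not_periodic (h0 : ∀ p, 0 < p → (fa a)^[p] 0 ≠ 0) {r : ℕ}
    (hr : 0 < r) :
    ∃ e > 0, ∀ m x, (shadowZeros a m e x).card ≤ 3 ^ (m / r + 1) := by
  have h1 : ∀ᶠ e : ℝ in 𝓝[>] 0, ∀ j ∈ Finset.Ico 1 r, ∀ u : ℝ, |u| < e → e ≤ |(fa a)^[j] u| := by
    rw [Filter.eventually_all_finset]
    intro j hj
    have hj0 := abs_pos.2 (h0 j (Finset.mem_Ico.1 hj).1)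
    have h2 : ∀ᶠ u in 𝓝 (0 : ℝ), |(fa a)^[j] 0| / 2 < |(fa a)^[j] u| :=
      (continuous_iterate a j).abs.continuousAt.eventually (lt_mem_nhds (by linarith))
    obtain ⟨d, hd, hd'⟩ := Metric.eventually_nhds_iff.1 h2
    have h3 : ∀ᶠ e : ℝ in 𝓝[>] 0, e < min d (|(fa a)^[j] 0| / 2) :=
      nhdsWithin_le_nhds (gt_mem_nhds (lt_min hd (by linarith)))
    filter_upwards [h3] with e he u hu
    have := hd' (y := u) (by simpa using hu.trans (he.trans_le (min_le_left _ _)))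
    exact (he.trans_le (min_le_right _ _)).le.trans this.le
  obtain ⟨e, he, he0⟩ := (h1.and self_mem_nhdsWithin).exists
  classical
  refine ⟨e, he0, fun m x => ?_⟩
  let T := (Finset.range m).filter fun i => |(fa a)^[i] x| < e
  refine (card_shadowZeros_le_pow (T := T) fun i hi hiT => ?_).trans
    (Nat.pow_le_pow_right (by norm_num) (card_le_of_spaced (r := r) ?_ hr ?_))
  · by_contra! hcon
    exact hiT (Finset.mem_filter.2 ⟨Finset.mem_range.2 hi, hcon⟩)
  · exact fun i hi => Finset.mem_range.1 (Finset.mem_filter.1 hi).1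
  · intro i hi j hj hij
    by_contra! hcon
    have h2 := he (j - i) (Finset.mem_Ico.2 ⟨by omega, by omega⟩) _ (Finset.mem_filter.1 hi).2
    rw [← Function.iterate_add_apply, Nat.sub_add_cancel hij.le] at h2
    exact absurd (Finset.mem_filter.1 hj).2 h2.not_gt

lemma exists_trap {p : ℕ} (hp : 0 < p) (h0 : (fa a)^[p] 0 = 0) :
    ∃ e > 0, ∀ u : ℝ, u ≠ 0 → |u| < e → ∀ j, (fa a)^[j] u ≠ 0 := by
  have hd := hasDerivAt_iterate a 0 p
  have hd0 : ∏ i ∈ Finset.range p, 2 * (fa a)^[i] 0 = 0 :=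
    Finset.prod_eq_zero (Finset.mem_range.2 hp) (by simp)
  rw [hd0] at hd
  have h1 : ∀ᶠ u in 𝓝 (0 : ℝ), |(fa a)^[p] u| ≤ |u| := by
    have := hd.isLittleO.bound one_pos
    filter_upwards [this] with u hu
    simpa [h0] using hu
  have h2 : ∀ᶠ u in 𝓝 (0 : ℝ), u ≠ 0 → ∀ j ∈ Finset.range (p + 1), (fa a)^[j] u ≠ 0 := by
    have h3 : ∀ᶠ u in 𝓝 (0 : ℝ), ∀ j ∈ Finset.range (p + 1), u ≠ 0 → (fa a)^[j] u ≠ 0 := by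
      rw [Filter.eventually_all_finset]
      intro j _
      have h4 : ((zeros a j : Set ℝ) \ {0})ᶜ ∈ 𝓝 (0 : ℝ) :=
        ((zeros a j).finite_toSet.subset sdiff_subset).isClosed.isOpen_compl.mem_nhds (by simp)
      filter_upwards [h4] with u hu hu0 hj
      exact hu ⟨by simpa using mem_zeros.2 hj, hu0⟩
    filter_upwards [h3] with u hu hu0 j hj using hu j hj hu0
  obtain ⟨e, he, h⟩ := Metric.eventually_nhds_iff.1 (h1.and h2)
  refine ⟨e, he, fun u hu0 hu j => ?_⟩
  induction j using Nat.strong_induction_on generalizing u with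
  | _ j ih =>
  have h3 := h (y := u) (by simpa using hu)
  rcases le_or_gt j p with hj | hj
  · exact h3.2 hu0 j (Finset.mem_range.2 (by omega))
  · have := ih (j - p) (by omega) ((fa a)^[p] u) (h3.2 hu0 p (Finset.mem_range.2 (by omega)))
      (h3.1.trans_lt hu)
    rwa [← Function.iterate_add_apply, Nat.sub_add_cancel hj.le] at this

lemma exists_card_shadowZeros_le_of_periodic {p : ℕ} (hp : 0 < p) (h0 : (fa a)^[p] 0 = 0) :
    ∃ e > 0, ∀ m x, (shadowZeros a m e x).card ≤ 1 := by
  obtain ⟨e, he, h⟩ := exists_trap hp h0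
  refine ⟨e / 2, by positivity, fun m x => Finset.card_le_one.2 fun y hy y' hy' => ?_⟩
  rw [mem_shadowZeros] at hy hy'
  by_cases hclose : ∃ i < m, |(fa a)^[i] x| < e / 2
  · classical
    obtain ⟨hi, hie⟩ := Nat.find_spec hclose
    have hmin : ∀ j < Nat.find hclose, e / 2 ≤ |(fa a)^[j] x| := fun j hj => by
      by_contra! hcon
      exact Nat.find_min hclose hj ⟨hj.trans hi, hcon⟩
    set i := Nat.find hclose
    have key : ∀ y, (fa a)^[m] y = 0 ∧ (∀ i < m, |(fa a)^[i] x - (fa a)^[i] y| < e / 2) →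
        (fa a)^[i] y = 0 := fun y hy => by
      by_contra hcon
      have h1 : |(fa a)^[i] y| < e := by
        have h2 := hy.2 i hi
        rw [abs_lt] at h2 hie ⊢
        constructor <;> linarith
      have h3 := h _ hcon h1 (m - i)
      rw [← Function.iterate_add_apply, Nat.sub_add_cancel hi.le] at h3
      exact h3 hy.1
    refine eq_of_sign_eq (m := i) (by rw [key y hy, key y' hy']) fun j hj => ?_
    rw [← sign_eq_of_abs_sub_lt (hmin j hj) (hy.2 j (hj.trans hi)),
      ← sign_eq_of_abs_sub_lt (hmin j hj) (hy'.2 j (hj.trans hi))]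
  · push Not at hclose
    refine eq_of_sign_eq (m := m) (by rw [hy.1, hy'.1]) fun j hj => ?_
    rw [← sign_eq_of_abs_sub_lt (hclose j hj) (hy.2 j hj),
      ← sign_eq_of_abs_sub_lt (hclose j hj) (hy'.2 j hj)]

lemma exists_card_shadowZeros_le (a : ℝ) {r : ℕ} (hr : 0 < r) :
    ∃ e > 0, ∀ m x, (shadowZeros a m e x).card ≤ 3 ^ (m / r + 1) := by
  by_cases h0 : ∀ p, 0 < p → (fa a)^[p] 0 ≠ 0
  · exact exists_card_shadowZeros_le_of_not_periodic h0 hr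
  · push Not at h0
    obtain ⟨p, hp, hp0⟩ := h0
    obtain ⟨e, he, h⟩ := exists_card_shadowZeros_le_of_periodic hp hp0
    exact ⟨e, he, fun m x => (h m x).trans (Nat.one_le_pow _ _ (by norm_num))⟩

/-- The number of critical preimages grows at most at the rate of the entropy. -/
lemma eventually_card_zeros_le (ha' : a ≤ 1 / 4) {b : ℝ}
    (hb : Dynamics.coverEntropy (fa a) (Ia a) < (b : EReal)) :
    ∀ᶠ m : ℕ in atTop, ((zeros a m).card : ℝ) ≤ 3 * Real.exp (b * m) := by
  obtain ⟨c, hc1, hc2⟩ := EReal.lt_iff_exists_real_btwn.1 hb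
  have hcb : c < b := by exact_mod_cast hc2
  obtain ⟨r, hr⟩ := exists_nat_gt (Real.log 3 / (b - c))
  have hlog : 0 < Real.log 3 := Real.log_pos (by norm_num)
  have hr0 : 0 < (r : ℝ) := lt_trans (div_pos hlog (by linarith)) hr
  have hr1 : 0 < r := by exact_mod_cast hr0
  obtain ⟨e, he, hcard⟩ := exists_card_shadowZeros_le a hr1
  filter_upwards [exists_cover_of_coverEntropy_lt hc1 (half_pos he)] with m ⟨s, hs, hcov⟩
  classical
  let Z : ℝ → Finset ℝ := fun c => (zeros a m).filter fun x =>
    ∀ i < m, |(fa a)^[i] x - (fa a)^[i] c| < e / 2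
  have hsub : zeros a m ⊆ s.biUnion Z := by
    intro x hx
    obtain ⟨c, hc, hxc⟩ := hcov x (mem_Ia_of_iterate_eq_zero ha' (mem_zeros.1 hx))
    exact Finset.mem_biUnion.2 ⟨c, hc, Finset.mem_filter.2 ⟨hx, hxc⟩⟩
  have hZ : ∀ c ∈ s, (Z c).card ≤ 3 ^ (m / r + 1) := by
    intro c _
    rcases (Z c).eq_empty_or_nonempty with h1 | ⟨x, hx⟩
    · simp [h1]
    · refine (Finset.card_le_card ?_).trans (hcard m x)
      intro y hy
      rw [mem_shadowZeros]
      refine ⟨mem_zeros.1 (Finset.mem_filter.1 hy).1, fun i hi => ?_⟩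
      have h1 := (Finset.mem_filter.1 hx).2 i hi
      have h2 := (Finset.mem_filter.1 hy).2 i hi
      rw [abs_lt] at *
      constructor <;> linarith
  have h1 : (zeros a m).card ≤ s.card * 3 ^ (m / r + 1) :=
    (Finset.card_le_card hsub).trans (Finset.card_biUnion_le_card_mul _ _ _ hZ)
  have h2 : ((3 : ℝ) ^ (m / r + 1)) ≤ 3 * Real.exp ((b - c) * m) := by
    rw [pow_succ, mul_comm]
    refine mul_le_mul_of_nonneg_left ?_ (by norm_num)
    rw [← Real.rpow_natCast, Real.rpow_def_of_pos (by norm_num)]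
    refine Real.exp_le_exp.2 ?_
    have h3 : ((m / r : ℕ) : ℝ) ≤ m / r := Nat.cast_div_le
    have h4 : Real.log 3 < r * (b - c) := by rwa [div_lt_iff₀ (by linarith)] at hr
    calc Real.log 3 * ((m / r : ℕ) : ℝ) ≤ (r * (b - c)) * (m / r) := by gcongr
      _ = (b - c) * m := by field_simp
  calc ((zeros a m).card : ℝ) ≤ s.card * 3 ^ (m / r + 1) := by exact_mod_cast h1
    _ ≤ Real.exp (c * m) * (3 * Real.exp ((b - c) * m)) := by gcongr
    _ = 3 * Real.exp (b * m) := by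
      rw [mul_left_comm, ← Real.exp_add]; ring_nf

lemma admissible_of_coverEntropy_lt (ha : -2 ≤ a) (ha' : a ≤ 1 / 4) {b : ℝ}
    (hb : Dynamics.coverEntropy (fa a) (Ia a) < (b : EReal)) (hz : 0 < z) (hz1 : z < 1)
    (hzb : z * Real.exp b < 1) : Admissible a z := by
  refine ⟨ha, hz, hz1, ?_⟩
  have hg : Summable fun m : ℕ => 3 * (z * Real.exp b) ^ m :=
    (summable_geometric_of_lt_one (by positivity) hzb).mul_left 3
  refine Summable.of_norm_bounded_eventually_nat hg ?_
  filter_upwards [eventually_card_zeros_le ha' hb] with m hm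
  rw [Real.norm_of_nonneg (by positivity), mul_pow, ← Real.exp_nat_mul, mul_left_comm,
    mul_comm (m : ℝ)]
  gcongr

end

section

variable {a z : ℝ}

/-- The points whose orbit meets the critical point for the first time at time `m`. -/
noncomputable def firstZeros (a : ℝ) (m : ℕ) : Finset ℝ := by
  classical exact (zeros a m).filter fun x => ∀ i < m, (fa a)^[i] x ≠ 0

lemma mem_firstZeros {m : ℕ} {x : ℝ} :
    x ∈ firstZeros a m ↔ (fa a)^[m] x = 0 ∧ ∀ i < m, (fa a)^[i] x ≠ 0 := by
  classical
  rw [firstZeros, Finset.mem_filter, mem_zeros]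

/-- The points mapped to `g` by the `n`-th iterate. -/
noncomputable def fibre (a g : ℝ) (n : ℕ) : Finset ℝ :=
  (iterPoly a n - Polynomial.C g).roots.toFinset

lemma mem_fibre {g x : ℝ} {n : ℕ} : x ∈ fibre a g n ↔ (fa a)^[n] x = g := by
  rw [fibre, Multiset.mem_toFinset, Polynomial.mem_roots (iterPoly_sub_C_ne_zero a g n),
    Polynomial.IsRoot.def, Polynomial.eval_sub, Polynomial.eval_C, eval_iterPoly, sub_eq_zero]

lemma card_fibre_le (a g : ℝ) (n : ℕ) :
    (fibre a g n).card ≤ ∑ j ∈ Finset.range n, (firstZeros a j).card + 1 := by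
  classical
  refine (Polynomial.card_roots_toFinset_le_derivative _).trans (Nat.succ_le_succ ?_)
  refine (Finset.card_le_card (t := (Finset.range n).biUnion (firstZeros a)) fun x hx => ?_).trans
    Finset.card_biUnion_le
  have h1 : (Polynomial.derivative (iterPoly a n - Polynomial.C g)).eval x = 0 :=
    Polynomial.isRoot_of_mem_roots (Multiset.mem_toFinset.1 hx)
  rw [Polynomial.derivative_sub, Polynomial.derivative_C, sub_zero] at h1
  have h2 := (iterPoly a n).hasDerivAt x
  rw [h1] at h2
  simp only [eval_iterPoly] at h2
  have h3 := h2.unique (hasDerivAt_iterate a x n)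
  obtain ⟨i, hi, hi0⟩ := Finset.prod_eq_zero_iff.1 h3.symm
  have hex : ∃ j, (fa a)^[j] x = 0 := ⟨i, by simpa using hi0⟩
  rw [Finset.mem_biUnion]
  refine ⟨Nat.find hex, ?_, mem_firstZeros.2 ⟨Nat.find_spec hex, fun j hj => Nat.find_min hex hj⟩⟩
  exact Finset.mem_range.2 ((Nat.find_min' hex (by simpa using hi0)).trans_lt
    (Finset.mem_range.1 hi))

lemma natDegree_iterPoly_le (a : ℝ) (n : ℕ) : (iterPoly a n).natDegree ≤ 2 ^ n := by
  induction n with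
  | zero => simp [iterPoly]
  | succ n ih =>
    rw [iterPoly, Polynomial.natDegree_add_C]
    exact Polynomial.natDegree_pow_le.trans (by rw [pow_succ]; omega)

lemma card_zeros_le (a : ℝ) (n : ℕ) : (zeros a n).card ≤ 2 ^ n :=
  (Multiset.toFinset_card_le _).trans ((Polynomial.card_roots' _).trans (natDegree_iterPoly_le a n))

lemma card_firstZeros_le (a : ℝ) (n : ℕ) : (firstZeros a n).card ≤ (zeros a n).card :=
  Finset.card_le_card fun _ hx => mem_zeros.2 (mem_firstZeros.1 hx).1

lemma exists_representatives (F : Set ℝ) {R : ℝ → ℝ → Prop} (c : ℝ → ℕ) {N : ℕ}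
    (hN : ∀ x, c x ≤ N) (hc : ∀ x ∈ F, ∀ y ∈ F, c x = c y → R x y) :
    ∃ s : Finset ℝ, s.card ≤ N + 1 ∧ ∀ x ∈ F, ∃ y ∈ s, R x y := by
  classical
  let rep : ℕ → ℝ := fun k => if h : ∃ y ∈ F, c y = k then h.choose else 0
  refine ⟨(Finset.range (N + 1)).image rep, by simpa using Finset.card_image_le (s := Finset.range (N + 1)) (f := rep),
    fun x hx => ⟨rep (c x), Finset.mem_image_of_mem _ (Finset.mem_range.2 (Nat.lt_succ_of_le (hN x))),
      ?_⟩⟩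
  have h : ∃ y ∈ F, c y = c x := ⟨x, hx, rfl⟩
  have e : rep (c x) = h.choose := dif_pos h
  rw [e]
  exact hc x hx _ h.choose_spec.1 h.choose_spec.2.symm

/-- A finite set cuts the line into at most twice as many pieces. -/
lemma exists_representatives_of_finset (F : Set ℝ) {R : ℝ → ℝ → Prop} (hR : ∀ x y, R x y → R y x)
    (hRr : ∀ x, R x x) (Q : Finset ℝ)
    (hQ : ∀ x ∈ F, ∀ y ∈ F, x < y → (∀ q ∈ Q, q ∉ Icc x y) → R x y) :
    ∃ s : Finset ℝ, s.card ≤ 2 * Q.card + 1 ∧ ∀ x ∈ F, ∃ y ∈ s, R x y := by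
  classical
  let A : ℝ → Finset ℝ := fun x => Q.filter (· < x)
  let B : ℝ → Finset ℝ := fun x => Q.filter (· ≤ x)
  have key : ∀ x ∈ F, ∀ y ∈ F, (A x).card + (B x).card = (A y).card + (B y).card → x < y →
      R x y := by
    intro x hx y hy hxy hlt
    refine hQ x hx y hy hlt fun q hq hqI => ?_
    have hA : A x ⊆ A y := Finset.monotone_filter_right _ fun q _ h => h.trans hlt
    have hB : B x ⊆ B y := Finset.monotone_filter_right _ fun q _ h => h.trans hlt.le
    have hA' := Finset.card_le_card hA
    have hB' := Finset.card_le_card hB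
    have eA := Finset.eq_of_subset_of_card_le hA (by omega)
    have eB := Finset.eq_of_subset_of_card_le hB (by omega)
    have h1 : q ∈ B y := Finset.mem_filter.2 ⟨hq, hqI.2⟩
    rw [← eB] at h1
    have h2 : q = x := le_antisymm (Finset.mem_filter.1 h1).2 hqI.1
    have h3 : q ∈ A y := Finset.mem_filter.2 ⟨hq, h2 ▸ hlt⟩
    rw [← eA] at h3
    exact (Finset.mem_filter.1 h3).2.ne h2
  refine exists_representatives F (fun x => (A x).card + (B x).card) (fun x => ?_)
    fun x hx y hy hxy => ?_
  · have h1 : (A x).card ≤ Q.card := Finset.card_filter_le _ _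
    have h2 : (B x).card ≤ Q.card := Finset.card_filter_le _ _
    omega
  · rcases lt_trichotomy x y with h | h | h
    · exact key x hx y hy hxy h
    · exact h ▸ hRr x
    · exact hR _ _ (key y hy x hx hxy.symm h)

/-- A finite set meeting every interval of length `e` in `[-2, 2]`. -/
lemma exists_grid {e : ℝ} (he : 0 < e) : ∃ G : Finset ℝ, ∀ u v : ℝ, |u| ≤ 2 → |v| ≤ 2 → u ≤ v →
    e ≤ v - u → ∃ g ∈ G, u ≤ g ∧ g ≤ v := by
  obtain ⟨N, hN⟩ := exists_nat_gt (2 / e)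
  classical
  refine ⟨(Finset.Icc (-(N : ℤ)) N).image fun k : ℤ => (k : ℝ) * e, fun u v hu hv huv hle => ?_⟩
  rw [div_lt_iff₀ he] at hN
  refine ⟨(⌈u / e⌉ : ℝ) * e, Finset.mem_image_of_mem _ ?_, ?_, ?_⟩
  · rw [Finset.mem_Icc]
    rw [abs_le] at hu hv
    have h1 : (-(N : ℝ)) * e ≤ u := by nlinarith
    have h3 := Int.ceil_lt_add_one (u / e)
    have h4 : u / e + 1 ≤ N := by
      rw [← le_sub_iff_add_le, div_le_iff₀ he]; linarith
    constructor
    · have h2 : ((-(N : ℤ) : ℤ) : ℝ) ≤ u / e := by push_cast; rwa [le_div_iff₀ he]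
      exact_mod_cast h2.trans (Int.le_ceil _)
    · exact_mod_cast (h3.trans_le h4).le
  · exact (div_le_iff₀ he).1 (Int.le_ceil _)
  · have h3 := Int.ceil_lt_add_one (u / e)
    have h4 := mul_lt_mul_of_pos_right h3 he
    rw [add_mul, div_mul_cancel₀ _ he.ne'] at h4
    linarith

lemma exists_cover_card_le (ha : -2 ≤ a) (ha' : a ≤ 1 / 4) {u C : ℝ} (hu : 1 ≤ u) (hC : 0 ≤ C)
    (H : ∀ j, ((firstZeros a j).card : ℝ) ≤ C * u ^ j) {e : ℝ} (he : 0 < e) :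
    ∃ K : ℝ, ∀ n : ℕ, 1 ≤ n → ∃ s : Finset ℝ, (s.card : ℝ) ≤ K * ((n : ℝ) ^ 2 * u ^ n) ∧
      ∀ x ∈ Ia a, ∃ c ∈ s, ∀ i < n, |(fa a)^[i] x - (fa a)^[i] c| < e := by
  obtain ⟨G, hG⟩ := exists_grid he
  classical
  refine ⟨2 * (G.card * (C + 1)) + 1, fun n hn => ?_⟩
  let Q : Finset ℝ := (G ×ˢ Finset.range n).biUnion fun p => fibre a p.1 p.2
  have hn1 : (1 : ℝ) ≤ n := by exact_mod_cast hn
  have hun : 1 ≤ u ^ n := one_le_pow₀ hu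
  have hQ : (Q.card : ℝ) ≤ G.card * (C + 1) * ((n : ℝ) ^ 2 * u ^ n) := by
    have h1 : ∀ p ∈ G ×ˢ Finset.range n, ((fibre a p.1 p.2).card : ℝ) ≤ (C + 1) * (n * u ^ n) := by
      intro p hp
      have hp2 : p.2 < n := Finset.mem_range.1 (Finset.mem_product.1 hp).2
      have h2 : ∑ j ∈ Finset.range p.2, ((firstZeros a j).card : ℝ) ≤ n * (C * u ^ n) := by
        calc _ ≤ ∑ j ∈ Finset.range n, ((firstZeros a j).card : ℝ) :=
              Finset.sum_le_sum_of_subset_of_nonneg (Finset.range_mono hp2.le)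
                fun _ _ _ => by positivity
          _ ≤ ∑ j ∈ Finset.range n, C * u ^ n := Finset.sum_le_sum fun j hj => (H j).trans
              (mul_le_mul_of_nonneg_left (pow_le_pow_right₀ hu (Finset.mem_range.1 hj).le) hC)
          _ = _ := by simp
      have h3 : ((fibre a p.1 p.2).card : ℝ) ≤
          ∑ j ∈ Finset.range p.2, ((firstZeros a j).card : ℝ) + 1 := by
        exact_mod_cast card_fibre_le a p.1 p.2
      nlinarith
    calc (Q.card : ℝ) ≤ ∑ p ∈ G ×ˢ Finset.range n, ((fibre a p.1 p.2).card : ℝ) := by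
          exact_mod_cast Finset.card_biUnion_le
      _ ≤ ∑ p ∈ G ×ˢ Finset.range n, (C + 1) * (n * u ^ n) := Finset.sum_le_sum h1
      _ = _ := by
        rw [Finset.sum_const, Finset.card_product, Finset.card_range, nsmul_eq_mul]; push_cast; ring
  suffices hsep : ∀ x ∈ Ia a, ∀ y ∈ Ia a, x < y → (∀ q ∈ Q, q ∉ Icc x y) →
      ∀ i < n, |(fa a)^[i] x - (fa a)^[i] y| < e by
    obtain ⟨s, hs, hcov⟩ := exists_representatives_of_finset (Ia a)
      (R := fun x y => ∀ i < n, |(fa a)^[i] x - (fa a)^[i] y| < e)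
      (fun x y h i hi => by rw [abs_sub_comm]; exact h i hi) (fun x i _ => by simpa using he) Q hsep
    refine ⟨s, ?_, hcov⟩
    have h1 : (s.card : ℝ) ≤ 2 * Q.card + 1 := by exact_mod_cast hs
    have h2 : 1 ≤ (n : ℝ) ^ 2 * u ^ n := by
      have : (1 : ℝ) ≤ (n : ℝ) ^ 2 := one_le_pow₀ hn1
      nlinarith
    nlinarith
  · intro x hx y hy hlt hno i hi
    by_contra! hcon
    have hx2 := abs_iterate_le_two ha ha' hx i
    have hy2 := abs_iterate_le_two ha ha' hy i
    have key : ∃ g ∈ G, g ∈ uIcc ((fa a)^[i] x) ((fa a)^[i] y) := by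
      rcases le_total ((fa a)^[i] x) ((fa a)^[i] y) with h | h
      · rw [abs_sub_comm, abs_of_nonneg (by linarith)] at hcon
        obtain ⟨g, hg, h1, h2⟩ := hG _ _ hx2 hy2 h hcon
        exact ⟨g, hg, Set.mem_uIcc.2 (Or.inl ⟨h1, h2⟩)⟩
      · rw [abs_of_nonneg (by linarith)] at hcon
        obtain ⟨g, hg, h1, h2⟩ := hG _ _ hy2 hx2 h hcon
        exact ⟨g, hg, Set.mem_uIcc.2 (Or.inr ⟨h1, h2⟩)⟩
    obtain ⟨g, hg, hgu⟩ := key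
    obtain ⟨t, ht, htg⟩ := intermediate_value_uIcc (continuous_iterate a i).continuousOn hgu
    rw [uIcc_of_le hlt.le] at ht
    exact hno t (Finset.mem_biUnion.2 ⟨(g, i), Finset.mem_product.2 ⟨hg, Finset.mem_range.2 hi⟩,
      mem_fibre.2 htg⟩) ht

/-- The entropy is at most the growth rate of the number of first zeros. -/
lemma coverEntropy_le_log (ha : -2 ≤ a) (ha' : a ≤ 1 / 4) {u C : ℝ} (hu : 1 ≤ u) (hC : 0 ≤ C)
    (H : ∀ j, ((firstZeros a j).card : ℝ) ≤ C * u ^ j) :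
    Dynamics.coverEntropy (fa a) (Ia a) ≤ (Real.log u : ℝ) := by
  refine EReal.le_of_forall_lt_iff_le.1 fun b hb => ?_
  have hb' : Real.log u < b := by exact_mod_cast hb
  refine coverEntropy_le_of_covers fun e he => ?_
  obtain ⟨K, hK⟩ := exists_cover_card_le ha ha' hu hC H he
  have hu0 : 0 < u := by linarith
  have hr : |u * Real.exp (-b)| < 1 := by
    rw [abs_of_pos (by positivity), Real.exp_neg, ← div_eq_mul_inv, div_lt_one (Real.exp_pos _)]
    rw [← Real.exp_log hu0]; exact Real.exp_lt_exp.2 hb'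
  have h1 := (tendsto_pow_const_mul_const_pow_of_abs_lt_one 2 hr).const_mul K
  rw [mul_zero] at h1
  filter_upwards [h1.eventually (gt_mem_nhds one_pos), eventually_ge_atTop 1] with n hn hn1
  obtain ⟨s, hs, hcov⟩ := hK n hn1
  refine ⟨s, hs.trans ?_, hcov⟩
  rw [mul_pow, ← Real.exp_nat_mul] at hn
  have e1 : Real.exp ((n : ℝ) * -b) = (Real.exp (b * n))⁻¹ := by rw [← Real.exp_neg]; ring_nf
  rw [e1, ← mul_assoc, ← mul_assoc, ← div_eq_mul_inv, div_lt_one (Real.exp_pos _)] at hn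
  linarith

lemma coverEntropy_le_log_two (ha : -2 ≤ a) (ha' : a ≤ 1 / 4) :
    Dynamics.coverEntropy (fa a) (Ia a) ≤ (Real.log 2 : ℝ) :=
  coverEntropy_le_log ha ha' (by norm_num) zero_le_one fun j => by
    rw [one_mul]; exact_mod_cast (card_firstZeros_le a j).trans (card_zeros_le a j)

lemma coe_h (ha : -2 ≤ a) (ha' : a ≤ 1 / 4) :
    ((h a : ℝ) : EReal) = Dynamics.coverEntropy (fa a) (Ia a) := by
  refine EReal.coe_toReal ?_ ?_
  · exact ((coverEntropy_le_log_two ha ha').trans_lt (EReal.coe_lt_top _)).ne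
  · refine (lt_of_lt_of_le EReal.bot_lt_zero (Dynamics.coverEntropy_nonneg _ ⟨0, ?_⟩)).ne'
    rw [Ia_eq]; exact ⟨by linarith [beta_pos a], (beta_pos a).le⟩

lemma h_nonneg (ha : -2 ≤ a) (ha' : a ≤ 1 / 4) : 0 ≤ h a := by
  have h1 : (0 : EReal) ≤ (h a : ℝ) := by
    rw [coe_h ha ha']
    refine Dynamics.coverEntropy_nonneg _ ⟨0, ?_⟩
    rw [Ia_eq]; exact ⟨by linarith [beta_pos a], (beta_pos a).le⟩
  exact_mod_cast h1

lemma h_le_log (ha : -2 ≤ a) (ha' : a ≤ 1 / 4) {u C : ℝ} (hu : 1 ≤ u) (hC : 0 ≤ C)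
    (H : ∀ j, ((firstZeros a j).card : ℝ) ≤ C * u ^ j) : h a ≤ Real.log u := by
  have := coverEntropy_le_log ha ha' hu hC H
  rw [← coe_h ha ha'] at this
  exact_mod_cast this

lemma h_le_log_two (ha : -2 ≤ a) (ha' : a ≤ 1 / 4) : h a ≤ Real.log 2 := by
  have := coverEntropy_le_log_two ha ha'
  rw [← coe_h ha ha'] at this
  exact_mod_cast this

lemma admissible_of_lt (ha : -2 ≤ a) (ha' : a ≤ 1 / 4) (hz : 0 < z) (hz1 : z < 1)
    (hzh : z < Real.exp (-h a)) : Admissible a z := by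
  have h1 : h a < -Real.log z := by
    have := Real.log_lt_log hz hzh
    rw [Real.log_exp] at this; linarith
  obtain ⟨b, hb1, hb2⟩ := exists_between h1
  refine admissible_of_coverEntropy_lt ha ha' (b := b) ?_ hz hz1 ?_
  · rw [← coe_h ha ha']; exact_mod_cast hb1
  · rw [← lt_div_iff₀ (Real.exp_pos _), one_div, ← Real.exp_neg, ← Real.log_lt_iff_lt_exp hz]
    linarith

end

section

variable {a z : ℝ}

lemma continuous_iterate_param (x : ℝ) (m : ℕ) : Continuous fun b => (fa b)^[m] x := by
  induction m with
  | zero => simpa using continuous_const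
  | succ m ih =>
    simp only [Function.iterate_succ', Function.comp_apply, fa_apply]
    exact (ih.pow 2).add continuous_id

lemma eventually_exists_zero {m : ℕ} {x : ℝ} (hx : x ∈ firstZeros a m) {U : Set ℝ} (hU : U ∈ 𝓝 x) :
    ∀ᶠ b in 𝓝 a, ∃ y ∈ U, (fa b)^[m] y = 0 := by
  rw [mem_firstZeros] at hx
  have hd := hasDerivAt_iterate a x m
  set d := ∏ i ∈ Finset.range m, 2 * (fa a)^[i] x with hd_def
  have hd0 : d ≠ 0 := Finset.prod_ne_zero_iff.2 fun i hi =>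
    mul_ne_zero two_ne_zero (hx.2 i (Finset.mem_range.1 hi))
  have h1 := hasDerivAt_iff_tendsto_slope_zero.1 hd
  have hneg : Tendsto (fun t : ℝ => -t) (𝓝[≠] 0) (𝓝[≠] 0) := by
    refine tendsto_nhdsWithin_iff.2 ⟨?_, ?_⟩
    · have : Tendsto (fun t : ℝ => -t) (𝓝 0) (𝓝 (-0)) := tendsto_id.neg
      rw [neg_zero] at this
      exact this.mono_left nhdsWithin_le_nhds
    · filter_upwards [self_mem_nhdsWithin] with t ht
      simpa using ht
  have h2 := h1.mul (h1.comp hneg)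
  have h3 := h2.eventually_const_lt (mul_self_pos.2 hd0)
  obtain ⟨η, hη, hηU⟩ := Metric.mem_nhds_iff.1 hU
  have h4 : ∀ᶠ t : ℝ in 𝓝[≠] 0, |t| < η := by
    refine nhdsWithin_le_nhds ?_
    filter_upwards [Metric.ball_mem_nhds (0 : ℝ) hη] with t ht
    simpa using ht
  have h5 : ∀ᶠ t : ℝ in 𝓝[≠] 0, t ≠ 0 := self_mem_nhdsWithin
  obtain ⟨t, ht, htη, ht0⟩ := (h3.and (h4.and h5)).exists
  have hprod : (fa a)^[m] (x + t) * (fa a)^[m] (x + -t) < 0 := by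
    simp only [Function.comp_apply, hx.1, sub_zero, smul_eq_mul] at ht
    have : t⁻¹ * (fa a)^[m] (x + t) * ((-t)⁻¹ * (fa a)^[m] (x + -t)) =
        -((fa a)^[m] (x + t) * (fa a)^[m] (x + -t)) * (t⁻¹) ^ 2 := by
      rw [inv_neg]; ring
    rw [this] at ht
    have := pos_of_mul_pos_left ht (sq_nonneg _)
    linarith
  have hev : ∀ᶠ b in 𝓝 a, (fa b)^[m] (x + t) * (fa b)^[m] (x + -t) < 0 :=
    (((continuous_iterate_param (x + t) m).mul
      (continuous_iterate_param (x + -t) m)).tendsto a).eventually_lt_const hprod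
  filter_upwards [hev] with b hb
  by_contra! hcon
  have hJ : (Metric.ball x η).OrdConnected := by
    rw [Real.ball_eq_Ioo]; exact ordConnected_Ioo
  have := mul_pos_of_preconnected (continuous_iterate b m) hJ
    (fun y hy => hcon y (hηU hy)) (x := x + t) (y := x + -t)
    (by simpa [Real.dist_eq] using htη) (by simpa [Real.dist_eq] using htη)
  linarith

lemma eventually_card_firstZeros_le (a : ℝ) (m : ℕ) :
    ∀ᶠ b in 𝓝 a, (firstZeros a m).card ≤ (zeros b m).card := by
  obtain ⟨U, hU, hdis⟩ := (firstZeros a m).finite_toSet.t2_separation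
  have : ∀ᶠ b in 𝓝 a, ∀ x ∈ firstZeros a m, ∃ y ∈ U x, (fa b)^[m] y = 0 :=
    (firstZeros a m).eventually_all.2 fun x hx =>
      eventually_exists_zero hx ((hU x).2.mem_nhds (hU x).1)
  filter_upwards [this] with b hb
  choose! g hgU hg0 using hb
  refine Finset.card_le_card_of_injOn g (fun x hx => mem_zeros.2 (hg0 x hx)) ?_
  intro x hx y hy hxy
  by_contra hne
  exact (disjoint_left.1 (hdis hx hy hne)) (hgU x hx) (hxy ▸ hgU y hy)

lemma Admissible.of_le {z' : ℝ} (hz : Admissible a z') (h0 : 0 < z) (h1 : z ≤ z') : Admissible a z where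
  neg_two_le := hz.neg_two_le
  pos := h0
  lt_one := h1.trans_lt hz.lt_one
  summable := hz.summable.of_nonneg_of_le (fun m => by positivity) fun m => by gcongr

lemma Admissible.count_le_count {z' : ℝ} (hz : Admissible a z') (h0 : 0 < z) (h1 : z ≤ z')
    (J : Set ℝ) : count a z J ≤ count a z' J := by
  refine (((hz.of_le h0 h1).summable_count J).tsum_le_tsum (fun m => ?_) (hz.summable_count J))
  have := sum_indicator_nonneg a J m
  gcongr

lemma Admissible.count_zero_le (hz : Admissible a z) : count a z {0} ≤ 1 / (1 - z) := by
  rw [one_div, ← tsum_geometric_of_lt_one hz.pos.le hz.lt_one]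
  refine (hz.summable_count {0}).tsum_le_tsum (fun m => ?_)
    (summable_geometric_of_lt_one hz.pos.le hz.lt_one)
  refine mul_le_of_le_one_right (pow_nonneg hz.pos.le m) ?_
  simp only [indicator_apply, mem_singleton_iff, Pi.one_apply, Finset.sum_ite_eq']
  split_ifs <;> norm_num

lemma pow_mul_card_zeros_le (hz : Admissible a z) (m : ℕ) :
    z ^ m * ((zeros a m).card : ℝ) ≤ count a z univ := by
  refine le_trans (le_of_eq ?_) ((hz.summable_count univ).le_tsum m
    fun i _ => mul_nonneg (pow_nonneg hz.pos.le i) (sum_indicator_nonneg a univ i))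
  simp

/-- If the entropies tend to `0`, then the zero counts stay bounded at every radius. -/
lemma exists_count_le {𝒰 : Ultrafilter ℕ} (h𝒰 : (𝒰 : Filter ℕ) ≤ atTop) {α : ℕ → ℝ}
    (hadm : ∀ z : ℝ, 0 < z → z < 1 → ∀ᶠ k in (𝒰 : Filter ℕ), Admissible (α k) z)
    (hz : 0 < z) (hz1 : z < 1) :
    ∃ B : ℝ, ∀ᶠ k in (𝒰 : Filter ℕ), count (α k) z univ ≤ B := by
  by_contra! hcon
  have hcount : Tendsto (fun k => count (α k) z univ) 𝒰 atTop :=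
    tendsto_atTop.2 fun B => (hcon B).mono fun k hk => hk.le
  set z₂ : ℝ := (1 + z) / 2 with hz₂
  have hz₂1 : z₂ < 1 := by linarith
  have hz₂0 : 0 < z₂ := by linarith
  set y : ℕ → ℝ := fun j => z + (1 - z) / 2 * (1 / ((j : ℝ) + 1)) with hy
  have hj1 : ∀ j : ℕ, 0 < 1 / ((j : ℝ) + 1) ∧ 1 / ((j : ℝ) + 1) ≤ 1 := fun j =>
    ⟨by positivity, by rw [div_le_one (by positivity)]; linarith [(Nat.cast_nonneg j : (0 : ℝ) ≤ j)]⟩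
  have hyz : ∀ j, z < y j := fun j => by
    have := mul_pos (show 0 < (1 - z) / 2 by linarith) (hj1 j).1
    simp only [hy]; linarith
  have hyz₂ : ∀ j, y j ≤ z₂ := fun j => by
    have := mul_le_mul_of_nonneg_left (hj1 j).2 (show 0 ≤ (1 - z) / 2 by linarith)
    simp only [hy]; linarith
  have hylim : Tendsto y atTop (𝓝 z) := by
    have := (tendsto_one_div_add_atTop_nhds_zero_nat (𝕜 := ℝ)).const_mul ((1 - z) / 2)
    simpa [hy] using this.const_add z
  have hex : ∀ᶠ k in (𝒰 : Filter ℕ), ∃ x : ℝ, 0 < x ∧ ∀ j ≤ k,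
      theta (α k) (y j) x ≤ nu (α k) (y j) {0} / 2 + 1 / ((k : ℝ) + 1) := by
    filter_upwards [hadm z₂ hz₂0 hz₂1] with k hk
    have h1 : ∀ j ∈ Finset.range (k + 1), ∀ᶠ x in 𝓝[>] (0 : ℝ),
        theta (α k) (y j) x ≤ nu (α k) (y j) {0} / 2 + 1 / ((k : ℝ) + 1) := fun j _ =>
      (hk.of_le (hz.trans (hyz j)) (hyz₂ j)).exists_theta_le (by positivity)
    have h2 := (Finset.range (k + 1)).eventually_all.2 h1
    obtain ⟨x, hx, hx0⟩ := (h2.and self_mem_nhdsWithin).exists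
    exact ⟨x, hx0, fun j hj => hx j (Finset.mem_range.2 (by omega))⟩
  obtain ⟨x, hx⟩ : ∃ x : ℕ → ℝ, ∀ᶠ k in (𝒰 : Filter ℕ), 0 < x k ∧ ∀ j ≤ k,
      theta (α k) (y j) (x k) ≤ nu (α k) (y j) {0} / 2 + 1 / ((k : ℝ) + 1) := by
    classical
    refine ⟨fun k => if H : ∃ x : ℝ, 0 < x ∧ ∀ j ≤ k,
      theta (α k) (y j) x ≤ nu (α k) (y j) {0} / 2 + 1 / ((k : ℝ) + 1) then H.choose else 0, ?_⟩
    filter_upwards [hex] with k hk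
    simp only [hk, dif_pos]
    exact hk.choose_spec
  have htheta : ∀ j, Tendsto (fun k => theta (α k) (y j) (x k)) 𝒰 (𝓝 0) := fun j => by
    have hub : Tendsto (fun k : ℕ => 1 / (1 - z₂) / ((1 - z₂) * count (α k) z univ)
        + 1 / ((k : ℝ) + 1)) 𝒰 (𝓝 0) := by
      have h1 := (hcount.const_mul_atTop (show 0 < 1 - z₂ by linarith)).const_div_atTop (1 / (1 - z₂))
      have h2 := (tendsto_one_div_add_atTop_nhds_zero_nat (𝕜 := ℝ)).mono_left h𝒰
      simpa using h1.add h2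
    refine squeeze_zero' ?_ ?_ hub
    · filter_upwards [hx, hadm z₂ hz₂0 hz₂1] with k hk hak
      have hadj := hak.of_le (hz.trans (hyz j)) (hyz₂ j)
      have := hadj.theta_mono hk.1.le
      rwa [theta_zero] at this
    · filter_upwards [hx, hadm z₂ hz₂0 hz₂1, h𝒰 (eventually_ge_atTop j)] with k hk hak hjk
      have hadj := hak.of_le (hz.trans (hyz j)) (hyz₂ j)
      refine (hk.2 j hjk).trans (add_le_add_left ?_ _)
      have e : nu (α k) (y j) {0} / 2 =
          count (α k) (y j) {0} / ((1 - y j) * count (α k) (y j) univ) := by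
        unfold nu; ring
      rw [e]
      have hc := hadj.count_le_count hz (hyz j).le univ
      have hc0 := hadj.count_zero_le
      have hc1 := (hak.of_le hz ((hyz j).le.trans (hyz₂ j))).one_le_count_univ
      have hyj := hyz₂ j
      have hcz : count (α k) (y j) {0} ≤ 1 / (1 - z₂) :=
        hc0.trans (one_div_le_one_div_of_le (by linarith) (by linarith))
      have h1z : 0 < 1 - z₂ := by linarith
      have hprod : (1 - z₂) * count (α k) z univ ≤ (1 - y j) * count (α k) (y j) univ :=
        mul_le_mul (by linarith) hc (by linarith) (by linarith)
      exact div_le_div₀ (by positivity) hcz (mul_pos h1z (by linarith)) hprod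
  obtain ⟨c, hc⟩ : ∃ c : ℕ → ℝ, ∀ n, Tendsto (fun k => ∏ i ∈ Finset.range (n + 1),
      Real.sign ((fa (α k))^[i] (x k))) 𝒰 (𝓝 (c n)) ∧ |c n| ≤ 1 := by
    have : ∀ n : ℕ, ∃ c : ℝ, Tendsto (fun k => ∏ i ∈ Finset.range (n + 1),
      Real.sign ((fa (α k))^[i] (x k))) 𝒰 (𝓝 c) ∧ |c| ≤ 1 := fun n => by
      obtain ⟨c, hc, hc'⟩ := (isCompact_Icc (a := (-1 : ℝ)) (b := 1)).ultrafilter_le_nhds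
        (𝒰.map fun k => ∏ i ∈ Finset.range (n + 1), Real.sign ((fa (α k))^[i] (x k)))
        (by
          rw [le_principal_iff, Ultrafilter.mem_coe, Ultrafilter.mem_map]
          exact univ_mem' fun k => abs_le.1 (abs_prod_sign_le _ _ _))
      exact ⟨c, hc', abs_le.2 hc⟩
    choose c hc using this
    exact ⟨c, hc⟩
  have hc0 : c 0 = 1 := by
    refine tendsto_nhds_unique (hc 0).1 (tendsto_const_nhds.congr' ?_)
    filter_upwards [hx] with k hk
    simp [Real.sign_of_pos hk.1]
  have hzero : ∀ j, ∑' n, y j ^ n * c n = 0 := fun j => by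
    have hyj0 := hz.trans (hyz j)
    have hyj1 := (hyz₂ j).trans_lt hz₂1
    refine tendsto_nhds_unique (f := fun k => theta (α k) (y j) (x k)) (l := (𝒰 : Filter ℕ)) ?_
      (htheta j)
    exact tendsto_tsum_of_dominated_convergence (bound := fun n => y j ^ n)
      (summable_geometric_of_lt_one hyj0.le hyj1)
      (fun n => (hc n).1.const_mul _)
      (Filter.Eventually.of_forall fun k n => abs_theta_term_le hyj0 _ _ _)
  set r : ℝ := (3 + z) / 4 with hr
  have hr1 : r < 1 := by linarith
  have hr0 : 0 < r := by linarith
  set g : ℂ → ℂ := fun w => ∑' n, w ^ n * (c n : ℂ) with hg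
  have hdiff : DifferentiableOn ℂ g (Metric.ball 0 r) := by
    refine Complex.differentiableOn_tsum_of_summable_norm (summable_geometric_of_lt_one hr0.le hr1)
      (fun n => by fun_prop) Metric.isOpen_ball fun n w hw => ?_
    rw [norm_mul, norm_pow, Complex.norm_real, Real.norm_eq_abs]
    have : ‖w‖ ≤ r := by simpa using (mem_ball_zero_iff.1 hw).le
    calc ‖w‖ ^ n * |c n| ≤ r ^ n * 1 := by
          gcongr
          exact (hc n).2
      _ = r ^ n := mul_one _
  have hfreq : ∃ᶠ w in 𝓝[≠] (z : ℂ), g w = 0 := by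
    have ht : Tendsto (fun j => ((y j : ℝ) : ℂ)) atTop (𝓝[≠] (z : ℂ)) := by
      refine tendsto_nhdsWithin_iff.2 ⟨(Complex.continuous_ofReal.tendsto z).comp hylim,
        Filter.Eventually.of_forall fun j => ?_⟩
      simpa using (hyz j).ne'
    refine ht.frequently (Filter.Eventually.frequently (Filter.Eventually.of_forall fun j => ?_))
    simp only [hg]
    rw [← Complex.ofReal_zero, ← hzero j, Complex.ofReal_tsum]
    simp
  have := (hdiff.analyticOnNhd Metric.isOpen_ball).eqOn_zero_of_preconnected_of_frequently_eq_zero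
    (convex_ball (0 : ℂ) r).isPreconnected (z₀ := (z : ℂ))
    (by simp [abs_of_pos hz]; linarith) hfreq (Metric.mem_ball_self hr0)
  simp only [hg, Pi.zero_apply] at this
  rw [tsum_eq_single 0 (fun n hn => by simp [hn])] at this
  simp [hc0] at this

/-- Entropies along an ultrafilter stay away from zero when the limit map has positive entropy. -/
lemma exists_le_entropy {𝒰 : Ultrafilter ℕ} (h𝒰 : (𝒰 : Filter ℕ) ≤ atTop) {α : ℕ → ℝ}
    (hα : ∀ k, -2 ≤ α k ∧ α k ≤ 1 / 4) (hlim : Tendsto α 𝒰 (𝓝 a)) (ha : -2 ≤ a) (ha' : a ≤ 1 / 4)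
    (hpos : 0 < h a) : ∃ c > 0, ∀ᶠ k in (𝒰 : Filter ℕ), c ≤ h (α k) := by
  by_contra! hcon
  have hadm : ∀ z : ℝ, 0 < z → z < 1 → ∀ᶠ k in (𝒰 : Filter ℕ), Admissible (α k) z := by
    intro z hz hz1
    filter_upwards [hcon (-Real.log z) (neg_pos.2 (Real.log_neg hz hz1))] with k hk
    refine admissible_of_lt (hα k).1 (hα k).2 hz hz1 ?_
    rw [← Real.log_lt_iff_lt_exp hz]
    linarith
  set z := Real.exp (-(h a / 2)) with hz
  have hz1 : z < 1 := Real.exp_lt_one_iff.2 (by linarith)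
  have hz0 : 0 < z := Real.exp_pos _
  obtain ⟨B, hB⟩ := exists_count_le h𝒰 hadm hz0 hz1
  have hbound : ∀ m, ((firstZeros a m).card : ℝ) ≤ max B 0 * (z⁻¹) ^ m := fun m => by
    obtain ⟨k, hk1, hk2, hk3⟩ := ((hlim.eventually (eventually_card_firstZeros_le a m)).and
      (hB.and (hadm z hz0 hz1))).exists
    have h1 := pow_mul_card_zeros_le hk3 m
    have h2 : ((firstZeros a m).card : ℝ) ≤ (zeros (α k) m).card := by exact_mod_cast hk1
    have hzm : 0 < z ^ m := pow_pos hz0 m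
    rw [inv_pow, ← div_eq_mul_inv, le_div_iff₀ hzm, mul_comm]
    calc z ^ m * ((firstZeros a m).card : ℝ) ≤ z ^ m * (zeros (α k) m).card := by gcongr
      _ ≤ B := h1.trans hk2
      _ ≤ _ := le_max_left _ _
  have := h_le_log ha ha' (u := z⁻¹) ((one_le_inv₀ hz0).2 hz1.le) (le_max_right _ _) hbound
  rw [Real.log_inv, hz, Real.log_exp] at this
  linarith

end

section

variable {a z : ℝ}

/-- The tent map with slope `s` whose turning value is `-1`. -/
def tent (s t : ℝ) : ℝ := s * |t| - 1

lemma tent_iterate_mem {s : ℝ} (hs : 1 < s) (hs2 : s ^ 2 ≤ 2) (q : ℕ) :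
    |(tent s)^[2 * q] 0| ≤ 1 / (s + 1) ∧
      (tent s)^[2 * q + 1] 0 < 0 ∧
      (tent s)^[2 * q] 0 = -(s - 1) * (tent (s ^ 2))^[q] 0 := by
  have hs1 : 0 < s + 1 := by linarith
  have key : ∀ t, |t| ≤ 1 / (s + 1) → tent s t < 0 ∧ tent s (tent s t) = (s - 1) - s ^ 2 * |t| := by
    intro t ht
    have h1 : tent s t < 0 := by
      have : s * |t| ≤ s * (1 / (s + 1)) := by gcongr
      have h2 : s * (1 / (s + 1)) < 1 := by
        rw [mul_one_div, div_lt_one hs1]; linarith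
      unfold tent; linarith
    refine ⟨h1, ?_⟩
    rw [tent, abs_of_neg h1, tent]; ring
  induction q with
  | zero => simp [tent]; positivity
  | succ q ih =>
    obtain ⟨h1, h2, h3⟩ := ih
    have hstep : (tent s)^[2 * (q + 1)] 0 = (s - 1) - s ^ 2 * |(tent s)^[2 * q] 0| := by
      rw [show 2 * (q + 1) = (2 * q + 1) + 1 by ring, Function.iterate_succ_apply',
        Function.iterate_succ_apply', (key _ h1).2]
    have hbound : |(tent s)^[2 * (q + 1)] 0| ≤ 1 / (s + 1) := by
      have e : s ^ 2 * (1 / (s + 1)) - (s - 1) = 1 / (s + 1) := by field_simp; ring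
      have h4 : s ^ 2 * |(tent s)^[2 * q] 0| ≤ s ^ 2 * (1 / (s + 1)) := by gcongr
      have h5 : s - 1 ≤ 1 / (s + 1) := by rw [le_div_iff₀ hs1]; nlinarith
      rw [hstep, abs_le]
      constructor
      · linarith
      · have : 0 ≤ s ^ 2 * |(tent s)^[2 * q] 0| := by positivity
        linarith
    refine ⟨hbound, ?_, ?_⟩
    · rw [Function.iterate_succ_apply']; exact (key _ hbound).1
    · rw [hstep, h3, Function.iterate_succ_apply', tent, abs_mul, abs_neg,
        abs_of_pos (show 0 < s - 1 by linarith)]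
      ring

/-- If the turning point of the tent map is periodic of period `p`, then `s ^ p > 2`. -/
lemma two_lt_pow_of_tent_iterate_eq_zero (p : ℕ) : ∀ {s : ℝ}, 1 < s → 0 < p →
    (tent s)^[p] 0 = 0 → 2 < s ^ p := by
  induction p using Nat.strong_induction_on with
  | _ p ih =>
    intro s hs hp h0
    rcases le_or_gt (s ^ 2) 2 with hs2 | hs2
    · obtain ⟨q, hq | hq⟩ := Nat.even_or_odd' p
      · subst hq
        have h1 := (tent_iterate_mem hs hs2 q).2.2
        rw [h0] at h1
        have h2 : (tent (s ^ 2))^[q] 0 = 0 := by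
          rcases mul_eq_zero.1 h1.symm with h | h
          · linarith
          · exact h
        have := ih q (by omega) (one_lt_pow₀ hs two_ne_zero) (by omega) h2
        rwa [← pow_mul] at this
      · subst hq
        exact absurd h0 (tent_iterate_mem hs hs2 q).2.1.ne
    · have hp3 : 2 ≤ p := by
        by_contra hlt
        have : p = 1 := by omega
        subst this
        norm_num [tent] at h0
      calc 2 < s ^ 2 := hs2
        _ ≤ s ^ p := pow_le_pow_right₀ hs.le hp3

lemma fold_iterate_eq_tent {s : ℝ} (hs : 0 < s) (n : ℕ) :
    (fun t => s * (|t| - 1))^[n] 0 = s * (tent s)^[n] 0 := by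
  induction n with
  | zero => simp
  | succ n ih =>
    rw [Function.iterate_succ_apply', Function.iterate_succ_apply', ih, abs_mul, abs_of_pos hs, tent]

lemma two_lt_pow_of_fold_iterate_eq_zero {s : ℝ} (hs : 1 < s) {p : ℕ} (hp : 0 < p)
    (h0 : (fun t => s * (|t| - 1))^[p] 0 = 0) : 2 < s ^ p := by
  rw [fold_iterate_eq_tent (by linarith)] at h0
  exact two_lt_pow_of_tent_iterate_eq_zero p hs hp ((mul_eq_zero.1 h0).resolve_left (by linarith))

/-- Iterates of `fa` restricted to a lap expand cross ratios. -/
lemma cross_ratio_le (n : ℕ) {x : Fin 4 → ℝ} (hx : Monotone x)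
    (hs : ∀ i < n, ∀ p q, 0 ≤ (fa a)^[i] (x p) * (fa a)^[i] (x q)) :
    |x 3 - x 0| * |x 2 - x 1| *
        (|(fa a)^[n] (x 1) - (fa a)^[n] (x 0)| * |(fa a)^[n] (x 3) - (fa a)^[n] (x 2)|) ≤
      |(fa a)^[n] (x 3) - (fa a)^[n] (x 0)| * |(fa a)^[n] (x 2) - (fa a)^[n] (x 1)| *
        (|x 1 - x 0| * |x 3 - x 2|) := by
  suffices H : (Monotone (fun p => (fa a)^[n] (x p)) ∨ Antitone (fun p => (fa a)^[n] (x p))) ∧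
      |x 3 - x 0| * |x 2 - x 1| *
        (|(fa a)^[n] (x 1) - (fa a)^[n] (x 0)| * |(fa a)^[n] (x 3) - (fa a)^[n] (x 2)|) ≤
      |(fa a)^[n] (x 3) - (fa a)^[n] (x 0)| * |(fa a)^[n] (x 2) - (fa a)^[n] (x 1)| *
        (|x 1 - x 0| * |x 3 - x 2|) from H.2
  induction n with
  | zero =>
    refine ⟨Or.inl hx, le_of_eq ?_⟩
    simp only [Function.iterate_zero, id]
  | succ n ih =>
    obtain ⟨hm, hle⟩ := ih fun i hi => hs i (by omega)
    set y : Fin 4 → ℝ := fun p => (fa a)^[n] (x p) with hy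
    have hyy : ∀ p q, 0 ≤ y p * y q := hs n (by omega)
    have hstep : ∀ p, (fa a)^[n + 1] (x p) = y p ^ 2 + a := fun p => by
      rw [Function.iterate_succ_apply', fa_apply]
    have hall : (∀ p, 0 ≤ y p) ∨ (∀ p, y p ≤ 0) := by
      by_contra! hcon
      obtain ⟨⟨p, hp⟩, q, hq⟩ := hcon
      have := hyy p q
      nlinarith
    have hdiff : ∀ p q, |y p ^ 2 + a - (y q ^ 2 + a)| = |y p - y q| * (|y p| + |y q|) := by
      intro p q
      rw [show y p ^ 2 + a - (y q ^ 2 + a) = (y p - y q) * (y p + y q) by ring, abs_mul]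
      congr 1
      rcases hall with h | h
      · rw [abs_of_nonneg (add_nonneg (h p) (h q)), abs_of_nonneg (h p), abs_of_nonneg (h q)]
      · rw [abs_of_nonpos (add_nonpos (h p) (h q)), abs_of_nonpos (h p), abs_of_nonpos (h q)]; ring
    have habs : Monotone (fun p => |y p|) ∨ Antitone (fun p => |y p|) := by
      rcases hall with h | h
      · simp only [abs_of_nonneg (h _)]; exact hm
      · simp only [abs_of_nonpos (h _)]
        rcases hm with hm | hm
        · exact Or.inr fun p q hpq => neg_le_neg (hm hpq)
        · exact Or.inl fun p q hpq => neg_le_neg (hm hpq)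
    refine ⟨?_, ?_⟩
    · simp only [hstep, ← sq_abs (y _)]
      rcases habs with h | h
      · exact Or.inl fun p q hpq => by
          have := h hpq
          simp only at this ⊢
          gcongr
      · exact Or.inr fun p q hpq => by
          have := h hpq
          simp only at this ⊢
          gcongr
    · simp only [hstep, hdiff]
      have hw : (|y 1| + |y 0|) * (|y 3| + |y 2|) ≤ (|y 3| + |y 0|) * (|y 2| + |y 1|) := by
        have : 0 ≤ (|y 3| - |y 1|) * (|y 2| - |y 0|) := by
          rcases habs with h | h
          · exact mul_nonneg (sub_nonneg.2 (h (by decide))) (sub_nonneg.2 (h (by decide)))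
          · exact mul_nonneg_of_nonpos_of_nonpos (sub_nonpos.2 (h (by decide)))
              (sub_nonpos.2 (h (by decide)))
        nlinarith
      have := mul_le_mul hle hw (by positivity) (by positivity)
      refine le_trans (le_of_eq ?_) (this.trans (le_of_eq ?_)) <;> ring

end

section

variable {a z : ℝ}

lemma abs_iterate_sub_le (ha : -2 ≤ a) (ha' : a ≤ 1 / 4) {u v : ℝ} (hu : u ∈ Ia a) (hv : v ∈ Ia a)
    (n : ℕ) : |(fa a)^[n] u - (fa a)^[n] v| ≤ 4 ^ n * |u - v| := by
  induction n with
  | zero => simp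
  | succ n ih =>
    rw [Function.iterate_succ_apply', Function.iterate_succ_apply', fa_apply, fa_apply]
    have h1 := abs_iterate_le_two ha ha' hu n
    have h2 := abs_iterate_le_two ha ha' hv n
    have h3 : |(fa a)^[n] u + (fa a)^[n] v| ≤ 4 := (abs_add_le _ _).trans (by linarith)
    calc |(fa a)^[n] u ^ 2 + a - ((fa a)^[n] v ^ 2 + a)|
        = |(fa a)^[n] u + (fa a)^[n] v| * |(fa a)^[n] u - (fa a)^[n] v| := by
          rw [← abs_mul]; congr 1; ring
      _ ≤ 4 * (4 ^ n * |u - v|) := by gcongr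
      _ = 4 ^ (n + 1) * |u - v| := by ring

lemma mem_Ia_of_abs_le (a : ℝ) {x : ℝ} (hx : |x| ≤ 1 / 2) : x ∈ Ia a := by
  rw [Ia_eq]
  have : 1 / 2 ≤ beta a := by
    rw [beta]; linarith [Real.sqrt_nonneg (1 - 4 * a)]
  exact abs_le.1 (hx.trans this)

lemma abs_iterate_sub_iterate_zero_le (ha : -2 ≤ a) (ha' : a ≤ 1 / 4) {x : ℝ} (hx : |x| ≤ 1 / 2)
    {p : ℕ} (hp : 0 < p) : |(fa a)^[p] x - (fa a)^[p] 0| ≤ 4 ^ p * x ^ 2 := by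
  obtain ⟨q, rfl⟩ := Nat.exists_eq_succ_of_ne_zero hp.ne'
  rw [Function.iterate_succ_apply, Function.iterate_succ_apply]
  refine (abs_iterate_sub_le ha ha' (mapsTo_Ia ha ha' (mem_Ia_of_abs_le a hx))
    (mapsTo_Ia ha ha' (mem_Ia_of_abs_le a (by norm_num))) q).trans ?_
  have : |fa a x - fa a 0| = x ^ 2 := by
    rw [fa_apply, fa_apply, show x ^ 2 + a - (0 ^ 2 + a) = x ^ 2 by ring, abs_of_nonneg (sq_nonneg x)]
  rw [this]
  gcongr
  · norm_num
  · omega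

namespace Admissible

lemma theta_nonneg (hz : Admissible a z) {x : ℝ} (hx : 0 ≤ x) : 0 ≤ theta a z x := by
  simpa [theta_zero] using hz.theta_mono hx

lemma abs_theta (hz : Admissible a z) (x : ℝ) : |theta a z x| = theta a z |x| := by
  rcases le_total 0 x with h | h
  · rw [abs_of_nonneg h, abs_of_nonneg (hz.theta_nonneg h)]
  · rw [abs_of_nonpos h, theta_neg hz.pos hz.lt_one, ← abs_neg, ← theta_neg hz.pos hz.lt_one,
      abs_of_nonneg (hz.theta_nonneg (neg_nonneg.2 h))]

lemma mul_theta_fa (hz : Admissible a z) {x : ℝ} (hx : x ≠ 0) :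
    z * theta a z (fa a x) = |theta a z x| - 1 := by
  rw [hz.abs_theta, theta_of_pos hz.pos hz.lt_one (abs_pos.2 hx)]
  simp [fa_apply]

lemma abs_theta_sub_le_of_mul_pos (hz : Admissible a z) {u v t : ℝ} (huv : 0 < u * v)
    (hu : |u| ≤ t) (hv : |v| ≤ t) :
    |theta a z u - theta a z v| ≤ theta a z t - nu a z {0} / 2 := by
  have e : |theta a z u - theta a z v| = |(theta a z |u|) - (theta a z |v|)| := by
    rcases mul_pos_iff.1 huv with ⟨h1, h2⟩ | ⟨h1, h2⟩
    · rw [abs_of_pos h1, abs_of_pos h2]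
    · rw [abs_of_neg h1, abs_of_neg h2, theta_neg hz.pos hz.lt_one, theta_neg hz.pos hz.lt_one,
        ← abs_neg]
      congr 1; ring
  have h0 := mul_ne_zero_iff.1 huv.ne'
  rw [e, abs_le]
  have := hz.nu_zero_le_theta (abs_pos.2 h0.1)
  have := hz.nu_zero_le_theta (abs_pos.2 h0.2)
  have := hz.theta_mono hu
  have := hz.theta_mono hv
  constructor <;> linarith

/-- If the critical point is almost periodic, `theta` is small near it. -/
lemma theta_le_of_near_periodic (hz : Admissible a z) {p : ℕ} (hp : 0 < p) {x₀ C : ℝ} (hx₀ : 0 < x₀)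
    (hC : 0 ≤ C) (hCx : C * x₀ ≤ 1 / 4)
    (hs : ∀ x ∈ Ioc 0 x₀, ∀ y ∈ Ioc 0 x₀, ∀ i < p, 0 < (fa a)^[i] x * (fa a)^[i] y)
    (hF : ∀ x ∈ Ioc 0 x₀, |(fa a)^[p] x - (fa a)^[p] 0| ≤ C * x ^ 2)
    (he : 2 * |(fa a)^[p] 0| ≤ x₀) :
    (1 - z ^ p) * theta a z x₀ ≤ nu a z {0} := by
  set e := (fa a)^[p] 0 with he_def
  set D := nu a z {0} / 2 with hD
  have hzp0 : 0 ≤ z ^ p := pow_nonneg hz.pos.le p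
  have hzp1 : z ^ p < 1 := pow_lt_one₀ hz.pos.le hz.lt_one hp.ne'
  have hD0 : 0 ≤ D := by have := hz.nu_nonneg {0}; positivity
  have hsub : ∀ x ∈ Ioc 0 x₀, ∀ y ∈ Ioc 0 x₀, |theta a z x - theta a z y| =
      z ^ p * |theta a z ((fa a)^[p] x) - theta a z ((fa a)^[p] y)| := fun x hx y hy =>
    hz.abs_theta_iterate_sub p (hs x hx y hy)
  have hsmall : ∀ r > 0, ∀ t > 0, ∃ y, 0 < y ∧ y ≤ t ∧ theta a z y ≤ D + r := fun r hr t ht => by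
    obtain ⟨y, ⟨hy, hy0⟩, hyt⟩ := (((hz.exists_theta_le hr).and self_mem_nhdsWithin).and
      (nhdsWithin_le_nhds (Iic_mem_nhds ht))).exists
    exact ⟨y, hy0, hyt, hy⟩
  have hquad : ∀ x ∈ Ioc 0 x₀, C * x ^ 2 ≤ x / 4 := fun x hx => by
    have : C * x ≤ 1 / 4 := (mul_le_mul_of_nonneg_left hx.2 hC).trans hCx
    nlinarith [hx.1]
  have htrap : e ≠ 0 → theta a z (2 * |e|) ≤ D := by
    intro he0
    set t := 2 * |e| with ht
    have ht0 : 0 < t := by positivity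
    have hmap : ∀ x, 0 < x → x ≤ t → 0 < (fa a)^[p] x * e ∧ |(fa a)^[p] x| ≤ t := by
      intro x hx hxt
      have h1 := hF x ⟨hx, hxt.trans he⟩
      have h2 := hquad x ⟨hx, hxt.trans he⟩
      have h3 : |(fa a)^[p] x - e| < |e| := by
        have : 0 < |e| := abs_pos.2 he0
        linarith
      constructor
      · rcases lt_or_gt_of_ne he0 with h | h
        · rw [abs_of_neg h, abs_lt] at h3
          exact mul_pos_of_neg_of_neg (by linarith) h
        · rw [abs_of_pos h, abs_lt] at h3
          exact mul_pos (by linarith) h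
      · have := abs_sub_abs_le_abs_sub ((fa a)^[p] x) e
        linarith
    refine le_of_forall_pos_le_add fun r hr => ?_
    obtain ⟨y, hy0, hyt, hy⟩ := hsmall ((1 - z ^ p) * r) (mul_pos (by linarith) hr) t ht0
    have h1 := hsub t ⟨ht0, he⟩ y ⟨hy0, hyt.trans he⟩
    obtain ⟨h2, h3⟩ := hmap t ht0 le_rfl
    obtain ⟨h4, h5⟩ := hmap y hy0 hyt
    have h6 : 0 < (fa a)^[p] t * (fa a)^[p] y := by
      have : 0 < ((fa a)^[p] t * (fa a)^[p] y) * e ^ 2 := by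
        have := mul_pos h2 h4; linarith [this]
      exact pos_of_mul_pos_left this (sq_nonneg e)
    have h7 := hz.abs_theta_sub_le_of_mul_pos h6 h3 h5
    have h8 := le_abs_self (theta a z t - theta a z y)
    have h9 : theta a z t - theta a z y ≤ z ^ p * (theta a z t - D) := by
      rw [h1] at h8
      exact h8.trans (by gcongr)
    have : (1 - z ^ p) * theta a z t ≤ (1 - z ^ p) * (D + r) := by linarith
    exact le_of_mul_le_mul_left this (by linarith)
  refine le_of_forall_pos_le_add fun r hr => ?_
  have hyex : ∃ y ∈ Ioc 0 x₀, theta a z y ≤ D + r / 2 ∧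
      |theta a z ((fa a)^[p] y)| ≤ D + r / 2 := by
    rcases eq_or_ne e 0 with he0 | he0
    · obtain ⟨y, hy0, hyt, hy⟩ := hsmall (r / 2) (by linarith) x₀ hx₀
      refine ⟨y, ⟨hy0, hyt⟩, hy, ?_⟩
      have h1 := hF y ⟨hy0, hyt⟩
      have h2 := hquad y ⟨hy0, hyt⟩
      rw [he0, sub_zero] at h1
      rw [hz.abs_theta]
      exact (hz.theta_mono (by linarith)).trans hy
    · have ht0 : 0 < 2 * |e| := by positivity
      obtain ⟨y, hy0, hyt, hy⟩ := hsmall (r / 2) (by linarith) (2 * |e|) ht0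
      refine ⟨y, ⟨hy0, hyt.trans he⟩, hy, ?_⟩
      have h1 := hF y ⟨hy0, hyt.trans he⟩
      have h2 := hquad y ⟨hy0, hyt.trans he⟩
      have h3 := abs_sub_abs_le_abs_sub ((fa a)^[p] y) e
      rw [hz.abs_theta]
      exact (hz.theta_mono (show |(fa a)^[p] y| ≤ 2 * |e| by linarith)).trans
        ((htrap he0).trans (by linarith))
  obtain ⟨y, hy, hyD, hFy⟩ := hyex
  have h1 := hsub x₀ ⟨hx₀, le_rfl⟩ y hy
  have h2 : |theta a z ((fa a)^[p] x₀)| ≤ theta a z x₀ := by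
    rw [hz.abs_theta]
    refine hz.theta_mono ?_
    have h1 := hF x₀ ⟨hx₀, le_rfl⟩
    have h2 := hquad x₀ ⟨hx₀, le_rfl⟩
    have h3 := abs_sub_abs_le_abs_sub ((fa a)^[p] x₀) e
    linarith
  have h3 := le_abs_self (theta a z x₀ - theta a z y)
  have h4 : theta a z x₀ - theta a z y ≤ z ^ p * (theta a z x₀ + (D + r / 2)) := by
    rw [h1] at h3
    refine h3.trans (mul_le_mul_of_nonneg_left ?_ hzp0)
    exact (abs_sub _ _).trans (add_le_add h2 hFy)
  have h5 : z ^ p * (D + r / 2) ≤ D + r / 2 := mul_le_of_le_one_left (by linarith) hzp1.le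
  have h6 : nu a z {0} = 2 * D := by rw [hD]; ring
  linarith

end Admissible

/-- Data along an ultrafilter: parameters, weights, and the limit of the maps `theta`. -/
structure LimitFamily (𝒰 : Ultrafilter ℕ) (α ζ : ℕ → ℝ) (a z : ℝ) (ψ : ℝ → ℝ) : Prop where
  adm : ∀ k, Admissible (α k) (ζ k)
  le_quarter : ∀ k, α k ≤ 1 / 4
  tendsto_param : Tendsto α 𝒰 (𝓝 a)
  tendsto_weight : Tendsto ζ 𝒰 (𝓝 z)
  weight_pos : 0 < z
  weight_lt : z < 1
  tendsto_nu : Tendsto (fun k => nu (α k) (ζ k) {0}) 𝒰 (𝓝 0)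
  tendsto_theta : ∀ x, Tendsto (fun k => theta (α k) (ζ k) x) 𝒰 (𝓝 (ψ x))

namespace LimitFamily

variable {𝒰 : Ultrafilter ℕ} {α ζ : ℕ → ℝ} {ψ : ℝ → ℝ}

lemma tendsto_iterate (H : LimitFamily 𝒰 α ζ a z ψ) (x : ℝ) (n : ℕ) :
    Tendsto (fun k => (fa (α k))^[n] x) 𝒰 (𝓝 ((fa a)^[n] x)) :=
  ((continuous_iterate_param x n).tendsto a).comp H.tendsto_param

lemma mono (H : LimitFamily 𝒰 α ζ a z ψ) : Monotone ψ := fun x y hxy =>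
  le_of_tendsto_of_tendsto' (H.tendsto_theta x) (H.tendsto_theta y) fun k => (H.adm k).theta_mono hxy

lemma odd (H : LimitFamily 𝒰 α ζ a z ψ) (x : ℝ) : ψ (-x) = -ψ x :=
  tendsto_nhds_unique (H.tendsto_theta (-x)) ((H.tendsto_theta x).neg.congr fun k =>
    (theta_neg (H.adm k).pos (H.adm k).lt_one _ x).symm)

lemma abs_le (H : LimitFamily 𝒰 α ζ a z ψ) (x : ℝ) : |ψ x| ≤ 1 / (1 - z) :=
  le_of_tendsto_of_tendsto' (H.tendsto_theta x).abs
    (tendsto_const_nhds.div (tendsto_const_nhds.sub H.tendsto_weight) (by linarith [H.weight_lt]))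
    fun k => abs_theta_le (H.adm k).pos (H.adm k).lt_one _ x

/-- `ψ` increases by at least `c` across `x`. -/
def HasJump (ψ : ℝ → ℝ) (x c : ℝ) : Prop := ∀ u v, u < x → x < v → c ≤ ψ v - ψ u

lemma hasJump_neg (H : LimitFamily 𝒰 α ζ a z ψ) {x c : ℝ} (hx : HasJump ψ x c) :
    HasJump ψ (-x) c := fun u v hu hv => by
  have := hx (-v) (-u) (by linarith) (by linarith)
  rw [H.odd, H.odd] at this
  linarith

lemma hasJump_fa (H : LimitFamily 𝒰 α ζ a z ψ) {x c : ℝ} (hx0 : x ≠ 0) (hx : HasJump ψ x c) :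
    HasJump ψ (fa a x) (c / z) := by
  wlog hpos : 0 < x generalizing x
  · have := this (neg_ne_zero.2 hx0) (H.hasJump_neg hx)
      (by rcases lt_or_gt_of_ne hx0 with h | h; exacts [by linarith, absurd h hpos])
    rwa [fa_neg] at this
  intro u v hu hv
  have hcont := (continuous_fa a).tendsto x
  obtain ⟨y, ⟨hyu, hy0⟩, hyx⟩ := (((hcont.mono_left nhdsWithin_le_nhds).eventually
    (lt_mem_nhds hu)).and (nhdsWithin_le_nhds (lt_mem_nhds hpos))).and
      (self_mem_nhdsWithin (s := Iio x)) |>.exists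
  obtain ⟨y', hyv, hyx'⟩ := ((hcont.mono_left nhdsWithin_le_nhds).eventually
    (gt_mem_nhds hv)).and (self_mem_nhdsWithin (s := Ioi x)) |>.exists
  rw [div_le_iff₀ H.weight_pos]
  refine (hx y y' hyx hyx').trans ?_
  refine le_of_tendsto_of_tendsto ((H.tendsto_theta y').sub (H.tendsto_theta y))
    (((H.tendsto_theta v).sub (H.tendsto_theta u)).mul H.tendsto_weight) ?_
  filter_upwards [(H.tendsto_iterate y 1).eventually (lt_mem_nhds hyu),
    (H.tendsto_iterate y' 1).eventually (gt_mem_nhds hyv)] with k h1 h2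
  have hk := H.adm k
  rw [theta_of_pos hk.pos hk.lt_one hy0, theta_of_pos hk.pos hk.lt_one (hpos.trans hyx')]
  have h3 := hk.theta_mono h1.le
  have h4 := hk.theta_mono h2.le
  simp only [Function.iterate_one] at h3 h4
  have := mul_le_mul_of_nonneg_left (sub_le_sub h4 h3) hk.pos.le
  linarith

lemma not_hasJump_of_ne (H : LimitFamily 𝒰 α ζ a z ψ) {x c : ℝ} (hc : 0 < c)
    (hx : ∀ n, (fa a)^[n] x ≠ 0) : ¬HasJump ψ x c := by
  intro hj
  have hn : ∀ n : ℕ, HasJump ψ ((fa a)^[n] x) (c / z ^ n) := fun n => by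
    induction n with
    | zero => simpa using hj
    | succ n ih =>
      rw [Function.iterate_succ_apply', pow_succ, ← div_div]
      exact H.hasJump_fa (hx n) ih
  have hlim : Tendsto (fun n : ℕ => c * (z⁻¹) ^ n) atTop atTop :=
    (tendsto_pow_atTop_atTop_of_one_lt ((one_lt_inv₀ H.weight_pos).2 H.weight_lt)).const_mul_atTop hc
  obtain ⟨n, hn'⟩ := (hlim.eventually (eventually_gt_atTop (2 * (1 / (1 - z))))).exists
  have h1 := hn n ((fa a)^[n] x - 1) ((fa a)^[n] x + 1) (by linarith) (by linarith)
  have h2 := _root_.abs_le.1 (H.abs_le ((fa a)^[n] x - 1))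
  have h3 := _root_.abs_le.1 (H.abs_le ((fa a)^[n] x + 1))
  rw [inv_pow, ← div_eq_mul_inv] at hn'
  linarith [h2.1, h3.2]

lemma hasJump_param (H : LimitFamily 𝒰 α ζ a z ψ) {c : ℝ} (h0 : HasJump ψ 0 c) :
    HasJump ψ a (c / 2 / z) := by
  intro u v hu hv
  have hψ : ∀ y, 0 < y → c / 2 ≤ ψ y := fun y hy => by
    have := h0 (-y) y (by linarith) hy
    rw [H.odd] at this; linarith
  have hv' : c / 2 - 1 ≤ z * ψ v := by
    have hcont : Tendsto (fa a) (𝓝[>] 0) (𝓝 a) := by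
      have := (continuous_fa a).tendsto 0
      simp only [fa_apply, ne_eq, OfNat.ofNat_ne_zero, not_false_eq_true, zero_pow, zero_add] at this
      exact this.mono_left nhdsWithin_le_nhds
    obtain ⟨y, hyv, hy0⟩ := ((hcont.eventually (gt_mem_nhds hv)).and self_mem_nhdsWithin).exists
    have h1 : ψ y - 1 ≤ z * ψ v := by
      refine le_of_tendsto_of_tendsto ((H.tendsto_theta y).sub_const 1)
        (H.tendsto_weight.mul (H.tendsto_theta v)) ?_
      filter_upwards [(H.tendsto_iterate y 1).eventually (gt_mem_nhds hyv)] with k hk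
      have hak := H.adm k
      rw [theta_of_pos hak.pos hak.lt_one hy0]
      have := mul_le_mul_of_nonneg_left (hak.theta_mono hk.le) hak.pos.le
      simp only [Function.iterate_one] at this
      linarith
    linarith [hψ y hy0]
  have hu' : z * ψ u ≤ -1 := by
    refine le_of_forall_pos_le_add fun e he => ?_
    have hlim : Tendsto (fun k => nu (α k) (ζ k) {0} / 2 + e - 1) 𝒰 (𝓝 (0 / 2 + e - 1)) :=
      ((H.tendsto_nu.div_const 2).add_const e).sub_const 1
    refine (le_of_tendsto_of_tendsto (H.tendsto_weight.mul (H.tendsto_theta u)) hlim ?_).trans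
      (by linarith)
    filter_upwards [H.tendsto_param.eventually (lt_mem_nhds hu)] with k hk
    have hak := H.adm k
    obtain ⟨y, hy, hy0⟩ := ((hak.exists_theta_le he).and self_mem_nhdsWithin).exists
    rw [theta_of_pos hak.pos hak.lt_one hy0] at hy
    have huy : u ≤ fa (α k) y := by rw [fa_apply]; nlinarith
    have := mul_le_mul_of_nonneg_left (hak.theta_mono huy) hak.pos.le
    linarith
  rw [div_le_iff₀ H.weight_pos]
  linarith

lemma not_hasJump_zero (H : LimitFamily 𝒰 α ζ a z ψ) {c : ℝ} (hc : 0 < c) : ¬HasJump ψ 0 c := by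
  intro h0
  by_cases hper : ∃ p, 0 < p ∧ (fa a)^[p] 0 = 0
  · classical
    obtain ⟨hp, hp0⟩ := Nat.find_spec hper
    have hmin : ∀ i, 0 < i → i < Nat.find hper → (fa a)^[i] 0 ≠ 0 := fun i hi hip h =>
      Nat.find_min hper hip ⟨hi, h⟩
    set p := Nat.find hper
    have hcont : ∀ i : ℕ, Continuous fun q : ℝ × ℝ => (fa q.1)^[i] q.2 := fun i => by
      induction i with
      | zero => simpa using continuous_snd
      | succ i ih =>
        simp only [Function.iterate_succ', Function.comp_apply, fa_apply]
        exact (ih.pow 2).add continuous_fst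
    have hsign : ∀ᶠ q in 𝓝 (a, (0 : ℝ)), ∀ i ∈ Finset.Ico 1 p,
        0 < (fa q.1)^[i] q.2 * (fa a)^[i] 0 := by
      refine (Finset.Ico 1 p).eventually_all.2 fun i hi => ?_
      have hi' := Finset.mem_Ico.1 hi
      have := (((hcont i).mul (continuous_const (y := (fa a)^[i] 0))).tendsto (a, (0 : ℝ)))
      exact this.eventually_const_lt (mul_self_pos.2 (hmin i (by omega) hi'.2))
    rw [nhds_prod_eq] at hsign
    obtain ⟨P, hP, Q, hQ, hPQ⟩ := eventually_prod_iff.1 hsign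
    obtain ⟨δ, hδ, hδQ⟩ := Metric.eventually_nhds_iff.1 hQ
    set C : ℝ := 4 ^ p with hC
    have hC0 : 0 < C := by positivity
    set x₀ := min (min (δ / 2) (1 / 2)) (1 / (4 * C)) with hx₀
    have hx₀0 : 0 < x₀ := by positivity
    have hx₀δ : x₀ < δ := ((min_le_left _ _).trans (min_le_left _ _)).trans_lt (by linarith)
    have hx₀2 : x₀ ≤ 1 / 2 := (min_le_left _ _).trans (min_le_right _ _)
    have hx₀C : C * x₀ ≤ 1 / 4 := by
      calc C * x₀ ≤ C * (1 / (4 * C)) := by gcongr; exact min_le_right _ _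
        _ = 1 / 4 := by field_simp
    have hψ : c / 2 ≤ ψ x₀ := by
      have := h0 (-x₀) x₀ (by linarith) hx₀0
      rw [H.odd] at this; linarith
    have hF0 : ∀ᶠ k in (𝒰 : Filter ℕ), |(fa (α k))^[p] 0| < x₀ / 2 := by
      have := (H.tendsto_iterate 0 p).abs
      rw [hp0, abs_zero] at this
      exact this.eventually (gt_mem_nhds (by positivity))
    have hle : (1 - z ^ p) * ψ x₀ ≤ 0 := by
      refine le_of_tendsto_of_tendsto
        ((tendsto_const_nhds.sub (H.tendsto_weight.pow p)).mul (H.tendsto_theta x₀)) H.tendsto_nu ?_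
      filter_upwards [hF0, H.tendsto_param.eventually hP] with k hk hPk
      have hxQ : ∀ x ∈ Ioc 0 x₀, Q x := fun x hx => hδQ (by
        rw [Real.dist_eq, sub_zero, abs_of_pos hx.1]; exact hx.2.trans_lt hx₀δ)
      refine (H.adm k).theta_le_of_near_periodic hp hx₀0 hC0.le hx₀C ?_ ?_ (by linarith)
      · intro x hx y hy i hi
        rcases Nat.eq_zero_or_pos i with rfl | hi0
        · exact mul_pos hx.1 hy.1
        · have h1 := hPQ hPk (hxQ x hx) i (Finset.mem_Ico.2 ⟨hi0, hi⟩)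
          have h2 := hPQ hPk (hxQ y hy) i (Finset.mem_Ico.2 ⟨hi0, hi⟩)
          have h3 : 0 < ((fa (α k))^[i] x * (fa (α k))^[i] y) * ((fa a)^[i] 0) ^ 2 := by
            have := mul_pos h1 h2
            simp only at this
            linarith
          exact pos_of_mul_pos_left h3 (sq_nonneg _)
      · intro x hx
        exact abs_iterate_sub_iterate_zero_le (H.adm k).neg_two_le (H.le_quarter k)
          (by rw [abs_of_pos hx.1]; exact hx.2.trans hx₀2) hp
    have hzp : z ^ p < 1 := pow_lt_one₀ H.weight_pos.le H.weight_lt hp.ne'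
    have := mul_pos (sub_pos.2 hzp) (show 0 < ψ x₀ by linarith)
    linarith
  · push Not at hper
    refine H.not_hasJump_of_ne (c := c / 2 / z) (x := a) (div_pos (by linarith) H.weight_pos) ?_
      (H.hasJump_param h0)
    intro n hn
    refine hper (n + 1) (by omega) ?_
    rw [Function.iterate_succ_apply, fa_apply]
    simpa using hn

lemma not_hasJump (H : LimitFamily 𝒰 α ζ a z ψ) {x c : ℝ} (hc : 0 < c) : ¬HasJump ψ x c := by
  intro hj
  by_cases hx : ∃ n, (fa a)^[n] x = 0
  · classical
    have h1 := Nat.find_spec hx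
    have hmin : ∀ i < Nat.find hx, (fa a)^[i] x ≠ 0 := fun i hi => Nat.find_min hx hi
    have hn : ∀ n ≤ Nat.find hx, HasJump ψ ((fa a)^[n] x) (c / z ^ n) := fun n => by
      induction n with
      | zero => intro _; simpa using hj
      | succ n ih =>
        intro hn
        rw [Function.iterate_succ_apply', pow_succ, ← div_div]
        exact H.hasJump_fa (hmin n (by omega)) (ih (by omega))
    have h2 := hn _ le_rfl
    rw [h1] at h2
    exact H.not_hasJump_zero (div_pos hc (pow_pos H.weight_pos _)) h2
  · push Not at hx
    exact H.not_hasJump_of_ne hc hx hj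

lemma continuous (H : LimitFamily 𝒰 α ζ a z ψ) : Continuous ψ := by
  refine continuous_iff_continuousAt.2 fun x => Metric.tendsto_nhds.2 fun e he => ?_
  have := H.not_hasJump (x := x) he
  unfold HasJump at this
  push Not at this
  obtain ⟨u, v, hu, hv, huv⟩ := this
  filter_upwards [Ioo_mem_nhds hu hv] with y hy
  have h1 := H.mono hy.1.le
  have h2 := H.mono hy.2.le
  have h3 := H.mono hu.le
  have h4 := H.mono hv.le
  rw [Real.dist_eq, abs_lt]
  constructor <;> linarith

/-- The maps `theta` converge continuously to `ψ`. -/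
lemma tendsto_theta_of_tendsto (H : LimitFamily 𝒰 α ζ a z ψ) {x : ℕ → ℝ} {x₀ : ℝ}
    (hx : Tendsto x 𝒰 (𝓝 x₀)) : Tendsto (fun k => theta (α k) (ζ k) (x k)) 𝒰 (𝓝 (ψ x₀)) := by
  refine tendsto_order.2 ⟨fun c hc => ?_, fun c hc => ?_⟩
  · obtain ⟨u, hu, hux⟩ := (((H.continuous.tendsto x₀).mono_left nhdsWithin_le_nhds).eventually
      (lt_mem_nhds hc) |>.and (self_mem_nhdsWithin (s := Iio x₀))).exists
    filter_upwards [hx.eventually (lt_mem_nhds hux),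
      (H.tendsto_theta u).eventually (lt_mem_nhds hu)] with k h1 h2
    exact h2.trans_le ((H.adm k).theta_mono h1.le)
  · obtain ⟨u, hu, hux⟩ := (((H.continuous.tendsto x₀).mono_left nhdsWithin_le_nhds).eventually
      (gt_mem_nhds hc) |>.and (self_mem_nhdsWithin (s := Ioi x₀))).exists
    filter_upwards [hx.eventually (gt_mem_nhds hux),
      (H.tendsto_theta u).eventually (gt_mem_nhds hu)] with k h1 h2
    exact ((H.adm k).theta_mono h1.le).trans_lt h2

lemma foldSemiconj (H : LimitFamily 𝒰 α ζ a z ψ) : FoldSemiconj a z⁻¹ ψ where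
  mono := H.mono
  odd := H.odd
  map_fa := by
    have hmain : ∀ x, x ≠ 0 → ψ (fa a x) = z⁻¹ * (|ψ x| - 1) := fun x hx => by
      rw [eq_inv_mul_iff_mul_eq₀ H.weight_pos.ne']
      have h1 := H.tendsto_weight.mul (H.tendsto_theta_of_tendsto (H.tendsto_iterate x 1))
      refine tendsto_nhds_unique h1 (((H.tendsto_theta x).abs.sub_const 1).congr fun k => ?_)
      simp only [Function.iterate_one]
      exact ((H.adm k).mul_theta_fa hx).symm
    have hcl : IsClosed {x | ψ (fa a x) = z⁻¹ * (|ψ x| - 1)} :=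
      isClosed_eq (H.continuous.comp (continuous_fa a))
        (continuous_const.mul (H.continuous.abs.sub continuous_const))
    have hd : Dense {x | ψ (fa a x) = z⁻¹ * (|ψ x| - 1)} :=
      (dense_compl_singleton (0 : ℝ)).mono fun x hx => by
        rw [mem_ofPred_eq]; exact hmain x hx
    intro x
    have := hcl.closure_eq ▸ hd x
    rwa [mem_ofPred_eq] at this

end LimitFamily

end

section

variable {a z : ℝ}

lemma rpow_half_sub_le {v η : ℝ} (hv : 0 ≤ v) (hv1 : v ≤ 1) (hη : 0 ≤ η) (hη' : η ≤ 1 / 4) :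
    v ^ (1 / 2 - η) ≤ √v + 4 * η := by
  rcases hv.eq_or_lt with rfl | hv0
  · rw [Real.zero_rpow (by linarith)]; simp [hη]
  obtain ⟨t, ht⟩ : ∃ t, t = -Real.log v := ⟨_, rfl⟩
  have ht0 : 0 ≤ t := by rw [ht]; exact neg_nonneg.2 (Real.log_nonpos hv hv1)
  have hvt : v = Real.exp (-t) := by rw [ht, neg_neg, Real.exp_log hv0]
  have e1 : v ^ (1 / 2 - η) = Real.exp (-(1 / 2 - η) * t) := by
    rw [hvt, ← Real.exp_mul]; congr 1; ring
  have e2 : √v = Real.exp (-(1 / 2 - η) * t) * Real.exp (-(η * t)) := by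
    rw [Real.sqrt_eq_rpow, hvt, ← Real.exp_mul, ← Real.exp_add]; congr 1; ring
  have h1 := Real.add_one_le_exp (-(η * t))
  have h2 : Real.exp (-(1 / 2 - η) * t) * t ≤ 4 := by
    have h3 := Real.add_one_le_exp (t / 4)
    have h4 : Real.exp (-(1 / 2 - η) * t) ≤ Real.exp (-(t / 4)) :=
      Real.exp_le_exp.2 (by nlinarith)
    calc Real.exp (-(1 / 2 - η) * t) * t ≤ Real.exp (-(t / 4)) * (4 * Real.exp (t / 4)) := by
          gcongr; linarith
      _ = 4 := by rw [mul_left_comm, ← Real.exp_add]; simp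
  rw [e1, e2]
  have h5 := Real.exp_pos (-(1 / 2 - η) * t)
  nlinarith [mul_le_mul_of_nonneg_left h1 h5.le, mul_le_mul_of_nonneg_left h2 hη]

section Sums

variable {ι : Type*} [Fintype ι] {l v : ι → ℝ} {η : ℝ}

lemma one_sub_le_sum_sqrt (hl : ∀ i, 0 ≤ l i) (hv : ∀ i, 0 ≤ v i) (hl1 : ∑ i, l i = 1)
    (hv1 : ∑ i, v i ≤ 1) (hη : 0 ≤ η) (hη' : η ≤ 1 / 4) (H : 1 ≤ ∑ i, √(l i) * v i ^ (1 / 2 - η)) :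
    1 - 4 * η * Fintype.card ι ≤ ∑ i, √(l i) * √(v i) := by
  have h1 : ∀ i, √(l i) * v i ^ (1 / 2 - η) ≤ √(l i) * √(v i) + 4 * η := fun i => by
    have h2 : v i ≤ 1 := (Finset.single_le_sum (fun j _ => hv j) (Finset.mem_univ i)).trans hv1
    have h3 : l i ≤ 1 := (Finset.single_le_sum (fun j _ => hl j) (Finset.mem_univ i)).trans hl1.le
    have h4 := rpow_half_sub_le (hv i) h2 hη hη'
    have h5 : √(l i) ≤ 1 := Real.sqrt_le_one.2 h3
    nlinarith [mul_le_mul_of_nonneg_left h4 (Real.sqrt_nonneg (l i))]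
  have h2 := H.trans (Finset.sum_le_sum fun i _ => h1 i)
  rw [Finset.sum_add_distrib, Finset.sum_const, nsmul_eq_mul, Finset.card_univ] at h2
  linarith

lemma sq_le_sum_of_le_sum_sqrt {t : ℝ} (hl : ∀ i, 0 ≤ l i) (hv : ∀ i, 0 ≤ v i)
    (hl1 : ∑ i, l i = 1) (ht : 0 ≤ t) (H : t ≤ ∑ i, √(l i) * √(v i)) : t ^ 2 ≤ ∑ i, v i := by
  have h1 := Finset.sum_mul_sq_le_sq_mul_sq Finset.univ (fun i => √(l i)) (fun i => √(v i))
  simp only [Real.sq_sqrt (hl _), Real.sq_sqrt (hv _), hl1, one_mul] at h1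
  exact (pow_le_pow_left₀ ht H 2).trans h1

lemma sum_abs_sub_le {τ : ℝ} (hl : ∀ i, 0 ≤ l i) (hv : ∀ i, 0 ≤ v i) (hl1 : ∑ i, l i = 1)
    (hv1 : ∑ i, v i ≤ 1) (H : 1 - τ ≤ ∑ i, √(l i) * √(v i)) :
    ∑ i, |l i - v i| ≤ 2 * √(2 * τ) := by
  have h1 := Finset.sum_mul_sq_le_sq_mul_sq Finset.univ (fun i => |√(l i) - √(v i)|)
    (fun i => √(l i) + √(v i))
  have e1 : ∀ i, |√(l i) - √(v i)| * (√(l i) + √(v i)) = |l i - v i| := fun i => by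
    rw [← abs_of_nonneg (add_nonneg (Real.sqrt_nonneg (l i)) (Real.sqrt_nonneg (v i))), ← abs_mul]
    congr 1
    nlinarith [Real.sq_sqrt (hl i), Real.sq_sqrt (hv i)]
  have e2 : ∀ i, |√(l i) - √(v i)| ^ 2 = l i + v i - 2 * (√(l i) * √(v i)) := fun i => by
    rw [sq_abs]; nlinarith [Real.sq_sqrt (hl i), Real.sq_sqrt (hv i)]
  have e3 : ∀ i, (√(l i) + √(v i)) ^ 2 ≤ 2 * (l i + v i) := fun i => by
    nlinarith [Real.sq_sqrt (hl i), Real.sq_sqrt (hv i), sq_nonneg (√(l i) - √(v i))]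
  simp only [e1, e2, Finset.sum_sub_distrib, Finset.sum_add_distrib, ← Finset.mul_sum, hl1] at h1
  have h2 : ∑ i, (√(l i) + √(v i)) ^ 2 ≤ 4 := by
    refine (Finset.sum_le_sum fun i _ => e3 i).trans ?_
    rw [← Finset.mul_sum, Finset.sum_add_distrib, hl1]; linarith
  have h3 : 0 ≤ ∑ i, (√(l i) + √(v i)) ^ 2 := Finset.sum_nonneg fun i _ => sq_nonneg _
  have h4 : 0 ≤ ∑ i, (l i + v i - 2 * (√(l i) * √(v i))) :=
    Finset.sum_nonneg fun i _ => by rw [← e2]; positivity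
  rw [Finset.sum_sub_distrib, Finset.sum_add_distrib, ← Finset.mul_sum, hl1] at h4
  have h5 : (∑ i, |l i - v i|) ^ 2 ≤ 4 * (2 * τ) := by nlinarith
  have h6 : 0 ≤ 2 * τ := by nlinarith
  refine le_of_sq_le_sq ?_ (by positivity)
  rw [mul_pow, Real.sq_sqrt h6]; linarith

lemma sum_sqrt_mul_rpow_le {N : ℕ} (hl : ∀ i, 0 ≤ l i) (hv : ∀ i, 0 ≤ v i) (hl1 : ∑ i, l i = 1)
    (hv1 : ∑ i, v i ≤ 1) (hη : 0 ≤ η) (hη' : η ≤ 1 / 4) (s : Finset ι) (hs : ∀ i ∉ s, l i = 0)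
    (hN : s.card ≤ N) (hN0 : 0 < N) :
    ∑ i, √(l i) * v i ^ (1 / 2 - η) ≤ (N : ℝ) ^ η := by
  have hN' : (0 : ℝ) < N := by exact_mod_cast hN0
  have e : ∑ i, √(l i) * v i ^ (1 / 2 - η) = ∑ i ∈ s, √(l i) * v i ^ (1 / 2 - η) :=
    (Finset.sum_subset (Finset.subset_univ s) fun i _ hi => by simp [hs i hi]).symm
  have h1 : ∀ i ∈ s, √(l i) * v i ^ (1 / 2 - η) * (N : ℝ)⁻¹ ^ η ≤
      1 / 2 * l i + (1 / 2 - η) * v i + η * (N : ℝ)⁻¹ := fun i _ => by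
    rw [Real.sqrt_eq_rpow]
    exact Real.geom_mean_le_arith_mean3_weighted (by norm_num) (by linarith) hη (hl i) (hv i)
      (by positivity) (by ring)
  have h2 := Finset.sum_le_sum h1
  rw [← Finset.sum_mul, ← e, Finset.sum_add_distrib, Finset.sum_add_distrib, ← Finset.mul_sum,
    ← Finset.mul_sum, Finset.sum_const, nsmul_eq_mul, Real.inv_rpow hN'.le,
    ← div_eq_mul_inv, div_le_iff₀ (Real.rpow_pos_of_pos hN' η)] at h2
  refine h2.trans (mul_le_of_le_one_left (Real.rpow_nonneg hN'.le _) ?_)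
  have h3 : ∑ i ∈ s, l i ≤ 1 :=
    (Finset.sum_le_sum_of_subset_of_nonneg (Finset.subset_univ s) fun i _ _ => hl i).trans hl1.le
  have h4 : ∑ i ∈ s, v i ≤ 1 :=
    (Finset.sum_le_sum_of_subset_of_nonneg (Finset.subset_univ s) fun i _ _ => hv i).trans hv1
  have h5 : (s.card : ℝ) * (N : ℝ)⁻¹ ≤ 1 := by
    rw [← div_eq_mul_inv]; exact div_le_one_of_le₀ (by exact_mod_cast hN) hN'.le
  have h6 : (1 / 2 - η) * ∑ i ∈ s, v i ≤ (1 / 2 - η) * 1 :=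
    mul_le_mul_of_nonneg_left h4 (by linarith)
  nlinarith

end Sums

/-- The proportion of `J` occupied by its children. -/
noncomputable def lengthRatio (a : ℝ) (n : ℕ) (J : Set ℝ) {m : ℕ} (w : Fin m → Bool) : ℝ :=
  volume.real (child a n J w) / volume.real J

/-- The proportion of the weight of `J` carried by its children. -/
noncomputable def omegaRatio (a z : ℝ) (n : ℕ) (J : Set ℝ) {m : ℕ} (w : Fin m → Bool) : ℝ :=
  omega a z (n + m) (child a n J w) / omega a z n J

section Ratios

variable {n m : ℕ} {J : Set ℝ} {χ ρ η : ℝ}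

lemma lengthRatio_nonneg (w : Fin m → Bool) : 0 ≤ lengthRatio a n J w := by
  rw [lengthRatio]; positivity

lemma Admissible.omegaRatio_nonneg (hz : Admissible a z) (w : Fin m → Bool) :
    0 ≤ omegaRatio a z n J w := div_nonneg (omega_nonneg hz _ _) (omega_nonneg hz _ _)

lemma Admissible.omega_pos (hz : Admissible a z) (hne : J.Nonempty) : 0 < omega a z n J := by
  rw [omega_of_nonempty hne]
  exact add_pos_of_nonneg_of_pos (hz.nu_nonneg J) (mul_pos (pow_pos hz.pos n) hz.nu_zero_pos)

lemma IsLap.volume_eq_sum (hJ : IsLap a n J) (m : ℕ) :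
    volume.real J = ∑ w : Fin m → Bool, volume.real (QuadraticFamily.child a n J w) := by
  simpa using setIntegral_eq_sum_child hJ m (g := fun _ => (1 : ℝ)) continuous_const

lemma IsLap.sum_lengthRatio (hJ : IsLap a n J) (hne : J.Nonempty) (m : ℕ) :
    ∑ w : Fin m → Bool, lengthRatio a n J w = 1 := by
  simp only [lengthRatio, ← Finset.sum_div]
  rw [← hJ.volume_eq_sum]
  exact div_self (hJ.volume_pos hne).ne'

lemma IsLap.sum_omegaRatio_le (hz : Admissible a z) (hJ : IsLap a n J) (m : ℕ) :
    ∑ w : Fin m → Bool, omegaRatio a z n J w ≤ 1 := by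
  simp only [omegaRatio, ← Finset.sum_div]
  exact div_le_one_of_le₀ (sum_omega_child_le hz hJ m) (omega_nonneg hz _ _)

lemma IsLap.pow_le_sum_of_not_contracts (hz : Admissible a z) (hJ : IsLap a n J) (hne : J.Nonempty)
    (hF : ¬Contracts a z χ ρ n m J) :
    ρ ^ m ≤ ∑ w : Fin m → Bool, √(lengthRatio a n J w) * omegaRatio a z n J w ^ χ := by
  rw [Contracts, not_le] at hF
  have h1 := Real.sqrt_pos.2 (hJ.volume_pos hne)
  have h2 := Real.rpow_pos_of_pos (hz.omega_pos (n := n) hne) χ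
  have e : ∀ w : Fin m → Bool, √(lengthRatio a n J w) * omegaRatio a z n J w ^ χ =
      √(volume.real (QuadraticFamily.child a n J w)) * omega a z (n + m) (QuadraticFamily.child a n J w) ^ χ /
        (√(volume.real J) * omega a z n J ^ χ) := fun w => by
    rw [lengthRatio, omegaRatio, Real.sqrt_div (by positivity),
      Real.div_rpow (omega_nonneg hz _ _) (omega_nonneg hz _ _), div_mul_div_comm]
  simp only [e, ← Finset.sum_div]
  exact (le_div_iff₀ (by positivity)).2 hF.le

lemma IsLap.nu_zero_le_of_not_contracts (hz : Admissible a z) (hJ : IsLap a n J) (hne : J.Nonempty)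
    (hη : 0 ≤ η) (hη' : η ≤ 1 / 8) (hρ : 1 ≤ ρ) (hF : ¬Contracts a z (1 / 2 - η) ρ n 1 J) :
    nu a z {0} ≤ 64 * η / (1 - z) ^ 2 := by
  have hz1 : 0 < 1 - z := by linarith [hz.lt_one]
  have hΩ := hz.omega_pos (n := n) hne
  have h1 := one_sub_le_sum_sqrt (l := fun w : Fin 1 → Bool => lengthRatio a n J w)
    (v := fun w => omegaRatio a z n J w) lengthRatio_nonneg hz.omegaRatio_nonneg
    (hJ.sum_lengthRatio hne 1) (hJ.sum_omegaRatio_le hz 1) hη (by linarith)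
    ((one_le_pow₀ hρ).trans (hJ.pow_le_sum_of_not_contracts hz hne hF))
  simp only [Fintype.card_fun, Fintype.card_bool, Fintype.card_fin, pow_one, Nat.cast_ofNat] at h1
  have h2 := sq_le_sum_of_le_sum_sqrt lengthRatio_nonneg hz.omegaRatio_nonneg
    (hJ.sum_lengthRatio hne 1) (by linarith) h1
  have h3 := sum_omega_child_one hz hJ hne
  have e : ∑ w : Fin 1 → Bool, omegaRatio a z n J w =
      (∑ b : Bool, omega a z (n + 1) (QuadraticFamily.child a n J (fun _ : Fin 1 => b))) / omega a z n J := by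
    rw [Finset.sum_div, ← (Equiv.funUnique (Fin 1) Bool).symm.sum_comp]
    rfl
  rw [e, le_div_iff₀ hΩ] at h2
  have h4 : omega a z n J ≤ z ^ n * (4 / (1 - z)) := by
    rw [omega_of_nonempty hne]
    have := hJ.nu_le hz
    have h5 := mul_le_mul_of_nonneg_left (hz.nu_le {0}) (pow_pos hz.pos n).le
    calc _ ≤ z ^ n * (2 / (1 - z)) + z ^ n * (2 / (1 - z)) := add_le_add this h5
      _ = z ^ n * (4 / (1 - z)) := by ring
  have hzn := pow_pos hz.pos n
  have h5 : z ^ n * (nu a z {0} * (1 - z)) ≤ z ^ n * (16 * η * (4 / (1 - z))) := by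
    nlinarith [mul_le_mul_of_nonneg_left h4 (show 0 ≤ 16 * η by positivity),
      mul_nonneg (sq_nonneg η) hΩ.le]
  have h6 := le_of_mul_le_mul_left h5 hzn
  rw [le_div_iff₀ (by positivity)]
  have h7 : 16 * η * (4 / (1 - z)) * (1 - z) = 64 * η := by field_simp; ring
  nlinarith [mul_le_mul_of_nonneg_right h6 hz1.le]

lemma IsLap.sum_abs_ratio_sub_le (hz : Admissible a z) (hJ : IsLap a n J) (hne : J.Nonempty)
    (hη : 0 ≤ η) (hη' : η ≤ 1 / 4) (hρ : 1 ≤ ρ) (hF : ¬Contracts a z (1 / 2 - η) ρ n m J) :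
    ∑ w : Fin m → Bool, |lengthRatio a n J w - omegaRatio a z n J w| ≤ 2 * √(2 * (4 * η * 2 ^ m)) := by
  have h1 := one_sub_le_sum_sqrt (l := fun w : Fin m → Bool => lengthRatio a n J w)
    (v := fun w => omegaRatio a z n J w) lengthRatio_nonneg hz.omegaRatio_nonneg
    (hJ.sum_lengthRatio hne m) (hJ.sum_omegaRatio_le hz m) hη (by linarith)
    ((one_le_pow₀ hρ).trans (hJ.pow_le_sum_of_not_contracts hz hne hF))
  simp only [Fintype.card_fun, Fintype.card_bool, Fintype.card_fin, Nat.cast_pow,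
    Nat.cast_ofNat] at h1
  exact sum_abs_sub_le lengthRatio_nonneg hz.omegaRatio_nonneg
    (hJ.sum_lengthRatio hne m) (hJ.sum_omegaRatio_le hz m) h1

/-- A lap that is not contracted at level `m` has at least three children at that level,
unless `ρ` is small. -/
lemma IsLap.exists_three_children (hz : Admissible a z) (hJ : IsLap a n J) (hne : J.Nonempty)
    (hη : 0 ≤ η) (hη' : η ≤ 1 / 4) (hF : ¬Contracts a z (1 / 2 - η) ρ n m J)
    (hρm : (2 : ℝ) ^ η < ρ ^ m) :
    ∃ u v w : Fin m → Bool, u ≠ v ∧ u ≠ w ∧ v ≠ w ∧ (QuadraticFamily.child a n J u).Nonempty ∧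
      (QuadraticFamily.child a n J v).Nonempty ∧ (QuadraticFamily.child a n J w).Nonempty := by
  classical
  set s := Finset.univ.filter fun w : Fin m → Bool => (QuadraticFamily.child a n J w).Nonempty with hs
  by_contra! hcon
  have hcard : s.card ≤ 2 := by
    by_contra! h3
    obtain ⟨u, v, w, hu, hv, hw, h1, h2, h3⟩ := Finset.two_lt_card_iff.1 h3
    simp only [hs, Finset.mem_filter, Finset.mem_univ, true_and] at hu hv hw
    exact hw.ne_empty (hcon u v w h1 h2 h3 hu hv)
  have h1 := sum_sqrt_mul_rpow_le (l := fun w : Fin m → Bool => lengthRatio a n J w)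
    (v := fun w => omegaRatio a z n J w) lengthRatio_nonneg hz.omegaRatio_nonneg
    (hJ.sum_lengthRatio hne m) (hJ.sum_omegaRatio_le hz m) hη hη' s
    (fun w hw => by
      have : QuadraticFamily.child a n J w = ∅ := not_nonempty_iff_eq_empty.1 fun h => hw (by simp [hs, h])
      simp [lengthRatio, this]) hcard two_pos
  have h2 := hJ.pow_le_sum_of_not_contracts hz hne hF
  exact absurd (h2.trans h1) (not_le.2 (by exact_mod_cast hρm))

end Ratios

end

section

variable {a z : ℝ}

lemma Admissible.sum_nu_le (hz : Admissible a z) {ι : Type*} [DecidableEq ι] {A : ι → Set ℝ}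
    (hA : Pairwise fun i j => Disjoint (A i) (A j)) {K : Set ℝ} (hK : ∀ i, A i ⊆ K) (s : Finset ι) :
    ∑ i ∈ s, nu a z (A i) ≤ nu a z K := by
  have : ∑ i ∈ s, nu a z (A i) ≤ nu a z (⋃ i ∈ s, A i) := by
    induction s using Finset.induction_on with
    | empty => simpa using hz.nu_nonneg ∅
    | insert i s hi ih =>
      rw [Finset.sum_insert hi, Finset.set_biUnion_insert, hz.nu_union]
      · linarith
      · simp only [disjoint_iUnion_right]
        exact fun j hj => hA fun h => hi (h ▸ hj)
  exact this.trans (hz.nu_mono (iUnion₂_subset fun i _ => hK i))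

lemma IsLap.mono {n : ℕ} {J K : Set ℝ} (hJ : IsLap a n J) (ho : IsOpen K) (hc : K.OrdConnected)
    (hK : K ⊆ J) : IsLap a n K :=
  ⟨ho, hc, hK.trans hJ.subset, fun i hi x hx => hJ.ne_zero i hi x (hK hx)⟩

namespace IsLap

variable {n m : ℕ} {J : Set ℝ}

/-- The error in the comparison of lengths and weights of subintervals of a lap. -/
noncomputable def ratioError (a z : ℝ) (n m : ℕ) (J : Set ℝ) (E : ℝ) : ℝ :=
  z ^ (n + m) * (2 * (2 / (1 - z)) + 2 ^ m * nu a z {0}) + E * omega a z n J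

open Classical in
lemma sum_mem_child_le (a : ℝ) (n m : ℕ) (J : Set ℝ) (x : ℝ) :
    ∑ w : Fin m → Bool, (if x ∈ QuadraticFamily.child a n J w then (1 : ℝ) else 0) ≤ 1 := by
  rw [Finset.sum_boole]
  have : (Finset.univ.filter fun w : Fin m → Bool => x ∈ QuadraticFamily.child a n J w).card ≤ 1 := by
    refine Finset.card_le_one.2 fun v hv w hw => ?_
    simp only [Finset.mem_filter, Finset.mem_univ, true_and] at hv hw
    by_contra h
    exact (Set.disjoint_left.1 (disjoint_child a n J h)) hv hw
  exact_mod_cast this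

open Classical in
lemma volume_ratio_mul_le (hz : Admissible a z) (hJ : IsLap a n J) (hne : J.Nonempty) {E : ℝ}
    (hE : ∑ w : Fin m → Bool, |lengthRatio a n J w - omegaRatio a z n J w| ≤ E)
    {K : Set ℝ} (ho : IsOpen K) (hc : K.OrdConnected) (hK : K ⊆ J) {x y : ℝ}
    (hxy : ∀ p ∈ K, ∀ q ∈ J, q ∉ K → x ∈ uIcc p q ∨ y ∈ uIcc p q) :
    volume.real K / volume.real J * omega a z n J ≤ nu a z K + ratioError a z n m J E := by
  have hKl := hJ.mono ho hc hK
  have hΩ := hz.omega_pos (n := n) hne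
  have hV := hJ.volume_pos hne
  have hz1 : 0 < 1 - z := by linarith [hz.lt_one]
  set C := 2 / (1 - z) with hC
  have hC0 : 0 < C := by positivity
  have hzn : 0 < z ^ (n + m) := pow_pos hz.pos _
  set X : (Fin m → Bool) → ℝ := fun w => if x ∈ QuadraticFamily.child a n J w then 1 else 0 with hX
  set Y : (Fin m → Bool) → ℝ := fun w => if y ∈ QuadraticFamily.child a n J w then 1 else 0 with hY
  have hX0 : ∀ w, 0 ≤ X w := fun w => by simp only [hX]; split_ifs <;> norm_num
  have hY0 : ∀ w, 0 ≤ Y w := fun w => by simp only [hY]; split_ifs <;> norm_num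
  have key : ∀ w : Fin m → Bool,
      volume.real (QuadraticFamily.child a n K w) / volume.real J * omega a z n J ≤
        nu a z (QuadraticFamily.child a n K w) + z ^ (n + m) * nu a z {0} +
        z ^ (n + m) * C * (X w + Y w) +
        |lengthRatio a n J w - omegaRatio a z n J w| * omega a z n J := fun w => by
    have hX0 := hX0 w
    have hY0 := hY0 w
    rcases (QuadraticFamily.child a n K w).eq_empty_or_nonempty with he | ⟨p, hp⟩
    · have h1 := hz.nu_nonneg (QuadraticFamily.child a n K w)
      have h2 := _root_.mul_pos hzn hz.nu_zero_pos
      rw [show volume.real (QuadraticFamily.child a n K w) = 0 by rw [he]; simp]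
      rw [zero_div, zero_mul]
      positivity
    · have hsub : QuadraticFamily.child a n K w ⊆ QuadraticFamily.child a n J w :=
        inter_subset_inter_left _ hK
      have h1 : volume.real (QuadraticFamily.child a n K w) / volume.real J ≤
          lengthRatio a n J w := by
        rw [lengthRatio]
        gcongr
        exact (hJ.child w).volume_lt_top.ne
      have h2 : omegaRatio a z n J w * omega a z n J =
          nu a z (QuadraticFamily.child a n J w) + z ^ (n + m) * nu a z {0} := by
        rw [omegaRatio, div_mul_cancel₀ _ hΩ.ne', omega_of_nonempty ⟨p, hsub hp⟩]
      have h3 : nu a z (QuadraticFamily.child a n J w) ≤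
          nu a z (QuadraticFamily.child a n K w) + z ^ (n + m) * C * (X w + Y w) := by
        by_cases hcs : QuadraticFamily.child a n J w ⊆ K
        · have : QuadraticFamily.child a n J w ⊆ QuadraticFamily.child a n K w :=
            fun t ht => ⟨hcs ht, ht.2⟩
          have h4 := hz.nu_mono this
          have : 0 ≤ z ^ (n + m) * C * (X w + Y w) := by positivity
          linarith
        · obtain ⟨q, hq, hqK⟩ := Set.not_subset.1 hcs
          have h4 := (hJ.child w).nu_le hz
          have h5 := hz.nu_nonneg (QuadraticFamily.child a n K w)
          have h6 : 1 ≤ X w + Y w := by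
            have h7 := (hJ.child w).ordConnected.uIcc_subset (hsub hp) hq
            rcases hxy p hp.1 q hq.1 hqK with h | h
            · have : X w = 1 := if_pos (h7 h)
              linarith
            · have : Y w = 1 := if_pos (h7 h)
              linarith
          have h8 : z ^ (n + m) * C * 1 ≤ z ^ (n + m) * C * (X w + Y w) := by gcongr
          linarith
      have h4 := mul_le_mul_of_nonneg_right h1 hΩ.le
      have h5 := mul_le_mul_of_nonneg_right
        (le_abs_self (lengthRatio a n J w - omegaRatio a z n J w)) hΩ.le
      linarith
  have hsum := Finset.sum_le_sum fun w (_ : w ∈ Finset.univ) => key w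
  rw [← Finset.sum_mul, ← Finset.sum_div, ← hKl.volume_eq_sum, Finset.sum_add_distrib,
    Finset.sum_add_distrib, Finset.sum_add_distrib, ← Finset.mul_sum, ← Finset.mul_sum,
    Finset.sum_add_distrib, Finset.sum_const, nsmul_eq_mul] at hsum
  simp only [Finset.card_univ, Fintype.card_fun, Fintype.card_bool, Fintype.card_fin, Nat.cast_pow,
    Nat.cast_ofNat] at hsum
  have h1 : ∑ w, nu a z (QuadraticFamily.child a n K w) ≤ nu a z K :=
    hz.sum_nu_le (A := fun w : Fin m → Bool => QuadraticFamily.child a n K w)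
      (fun _ _ h => disjoint_child a n K h) (child_subset a n K) Finset.univ
  have h2 := sum_mem_child_le a n m J x
  have h3 := sum_mem_child_le a n m J y
  have h4 : z ^ (n + m) * C * (∑ w, X w + ∑ w, Y w) ≤ z ^ (n + m) * C * (1 + 1) := by gcongr
  have h5 := mul_le_mul_of_nonneg_right hE hΩ.le
  rw [Finset.sum_mul] at h5
  rw [ratioError]
  linarith

/-- On a lap whose children have lengths proportional to their weights, the iterate is
nearly affine in the coordinate `theta`. -/
lemma abs_ratio_sub_theta_le (hz : Admissible a z) (hJ : IsLap a n J) {E : ℝ}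
    (hE : ∑ w : Fin m → Bool, |lengthRatio a n J w - omegaRatio a z n J w| ≤ E)
    {x y : ℝ} (hx : x ∈ J) (hy : y ∈ J) :
    abs (|x - y| / volume.real J * omega a z n J - |theta a z x - theta a z y|) ≤
      2 * ratioError a z n m J E := by
  wlog hxy : x ≤ y generalizing x y
  · rw [abs_sub_comm x y, abs_sub_comm (theta a z x)]
    exact this hy hx (le_of_not_ge hxy)
  have hne : J.Nonempty := ⟨x, hx⟩
  have hΩ := hz.omega_pos (n := n) hne
  have hV := hJ.volume_pos hne
  have hE0 : 0 ≤ E := (Finset.sum_nonneg fun w _ => abs_nonneg _).trans hE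
  have hR : 0 ≤ ratioError a z n m J E := by
    have : 0 < 1 - z := by linarith [hz.lt_one]
    have := hz.pos
    have := hz.nu_zero_pos
    rw [ratioError]; positivity
  have hθ := hz.theta_mono hxy
  rw [abs_sub_comm x y, abs_sub_comm (theta a z x), abs_of_nonneg (sub_nonneg.2 hxy),
    abs_of_nonneg (sub_nonneg.2 hθ)]
  have h1 := hJ.volume_ratio_mul_le hz hne hE isOpen_Ioo ordConnected_Ioo
    (Ioo_subset_Icc_self.trans (hJ.ordConnected.out hx hy)) (x := x) (y := y) (by
      intro p hp q _ hq
      rcases le_or_gt q x with h | h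
      · exact Or.inl (mem_uIcc.2 (Or.inr ⟨h, hp.1.le⟩))
      · exact Or.inr (mem_uIcc.2 (Or.inl ⟨hp.2.le, not_lt.1 fun h' => hq ⟨h, h'⟩⟩)))
  rw [Real.volume_real_Ioo_of_le hxy] at h1
  have h2 := hJ.volume_ratio_mul_le hz hne hE (K := J ∩ Iio x) (hJ.isOpen.inter isOpen_Iio)
    (hJ.ordConnected.inter ordConnected_Iio) inter_subset_left (x := x) (y := x) (by
      intro p hp q hqJ hq
      exact Or.inl (mem_uIcc.2 (Or.inl ⟨hp.2.le, not_lt.1 fun h' => hq ⟨hqJ, h'⟩⟩)))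
  have h3 := hJ.volume_ratio_mul_le hz hne hE (K := J ∩ Ioi y) (hJ.isOpen.inter isOpen_Ioi)
    (hJ.ordConnected.inter ordConnected_Ioi) inter_subset_left (x := y) (y := y) (by
      intro p hp q hqJ hq
      exact Or.inl (mem_uIcc.2 (Or.inr ⟨not_lt.1 fun h' => hq ⟨hqJ, h'⟩, hp.2.le⟩)))
  have hJu : J = (J ∩ Iio x) ∪ (Icc x y ∪ (J ∩ Ioi y)) := by
    ext t
    constructor
    · intro ht
      rcases lt_or_ge t x with h | h
      · exact Or.inl ⟨ht, h⟩
      · rcases le_or_gt t y with h' | h'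
        · exact Or.inr (Or.inl ⟨h, h'⟩)
        · exact Or.inr (Or.inr ⟨ht, h'⟩)
    · rintro (h | h | h)
      exacts [h.1, hJ.ordConnected.out hx hy h, h.1]
  have hd2 : Disjoint (Icc x y) (J ∩ Ioi y) :=
    Set.disjoint_left.2 fun t ht ht' => absurd ht'.2 (not_lt.2 ht.2)
  have hd1 : Disjoint (J ∩ Iio x) (Icc x y ∪ (J ∩ Ioi y)) := by
    refine Set.disjoint_left.2 fun t ht ht' => ?_
    have h0 : t < x := ht.2
    rcases ht' with h | h
    · linarith [h.1]
    · have : y < t := h.2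
      linarith
  have hνJ : nu a z J = nu a z (J ∩ Iio x) + (nu a z (Icc x y) + nu a z (J ∩ Ioi y)) := by
    rw [← hz.nu_union hd2, ← hz.nu_union hd1, ← hJu]
  have hfin : ∀ K ⊆ J, volume K ≠ ⊤ := fun K hK => ((measure_mono hK).trans_lt hJ.volume_lt_top).ne
  have hm2 : MeasurableSet (J ∩ Ioi y) := hJ.measurableSet.inter measurableSet_Ioi
  have hVJ : volume.real J = volume.real (J ∩ Iio x) + (y - x + volume.real (J ∩ Ioi y)) := by
    conv_lhs => rw [hJu]
    rw [measureReal_union hd1 (measurableSet_Icc.union hm2) (hfin _ inter_subset_left)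
      (hfin _ (union_subset (hJ.ordConnected.out hx hy) inter_subset_left)),
      measureReal_union hd2 hm2 (hfin _ (hJ.ordConnected.out hx hy)) (hfin _ inter_subset_left),
      Real.volume_real_Icc_of_le hxy]
  have h4 := hz.nu_Ioo_le hxy
  have h5 := hz.theta_sub_le hxy
  have h6 : omega a z n J = nu a z J + z ^ n * nu a z {0} := omega_of_nonempty hne
  have h7 : volume.real (J ∩ Iio x) / volume.real J * omega a z n J +
      volume.real (J ∩ Ioi y) / volume.real J * omega a z n J +
      (y - x) / volume.real J * omega a z n J = omega a z n J := by
    rw [← add_mul, ← add_mul, ← add_div, ← add_div, show volume.real (J ∩ Iio x) +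
      volume.real (J ∩ Ioi y) + (y - x) = volume.real J by linarith, div_self hV.ne', one_mul]
  have h8 := _root_.mul_pos (pow_pos hz.pos n) hz.nu_zero_pos
  rw [abs_le]
  constructor <;> linarith

end IsLap

end

section

variable {a z : ℝ}

lemma exists_first_difference {r : ℕ} {u v : Fin r → Bool} (h : u ≠ v) :
    ∃ i, u i ≠ v i ∧ ∀ l < i, u l = v l := by
  obtain ⟨i, hi, hmin⟩ := WellFounded.has_min (wellFounded_lt (α := Fin r)) {i | u i ≠ v i}
    (Function.ne_iff.1 h)
  exact ⟨i, hi, fun l hl => by_contra fun hne => hmin l hne hl⟩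

lemma exists_two_differences {r : ℕ} {u v w : Fin r → Bool} (huv : u ≠ v) (huw : u ≠ w)
    (hvw : v ≠ w) {P : (Fin r → Bool) → Prop} (hu : P u) (hv : P v) (hw : P w) :
    ∃ p q q', P p ∧ P q ∧ P q' ∧ ∃ i j, i < j ∧ (p i ≠ q i ∧ ∀ l < i, p l = q l) ∧
      (p j ≠ q' j ∧ ∀ l < j, p l = q' l) := by
  obtain ⟨i, hi⟩ := exists_first_difference huv
  obtain ⟨j, hj⟩ := exists_first_difference huw
  rcases lt_trichotomy i j with h | rfl | h
  · exact ⟨u, v, w, hu, hv, hw, i, j, h, hi, hj⟩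
  · obtain ⟨m, hm⟩ := exists_first_difference hvw
    refine ⟨v, u, w, hv, hu, hw, i, m, ?_, ⟨hi.1.symm, fun l hl => (hi.2 l hl).symm⟩, hm⟩
    refine not_le.1 fun hmi => hm.1 ?_
    rcases hmi.lt_or_eq with h | rfl
    · rw [← hi.2 m h, ← hj.2 m h]
    · have h1 := hi.1
      have h2 := hj.1
      revert h1 h2
      cases u m <;> cases v m <;> cases w m <;> simp
  · exact ⟨u, w, v, hu, hw, hv, j, i, h, hj, hi⟩

lemma Admissible.abs_theta_le_of_mul_neg (hz : Admissible a z) {x y : ℝ} (hxy : x * y ≤ 0) :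
    |theta a z x| ≤ |theta a z x - theta a z y| := by
  have h0 : ∀ t, t ≤ 0 → theta a z t ≤ 0 := fun t ht => by
    simpa [theta_zero] using hz.theta_mono ht
  rcases mul_nonpos_iff.1 hxy with ⟨h1, h2⟩ | ⟨h1, h2⟩
  · rw [abs_of_nonneg (hz.theta_nonneg h1)]
    exact le_trans (by linarith [h0 y h2]) (le_abs_self _)
  · rw [abs_of_nonpos (h0 x h1)]
    exact le_trans (by linarith [hz.theta_nonneg h2]) (neg_le_abs _)

lemma IsLap.abs_theta_sub_le_nu (hz : Admissible a z) {n : ℕ} {J : Set ℝ} (hJ : IsLap a n J)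
    {x y : ℝ} (hx : x ∈ J) (hy : y ∈ J) : |theta a z x - theta a z y| ≤ nu a z J := by
  wlog hxy : x ≤ y generalizing x y
  · rw [abs_sub_comm]; exact this hy hx (le_of_not_ge hxy)
  rw [abs_sub_comm, abs_of_nonneg (sub_nonneg.2 (hz.theta_mono hxy))]
  exact (hz.theta_sub_le hxy).trans (hz.nu_mono (hJ.ordConnected.out hx hy))

lemma abs_theta_iterate_le_of_ne (hz : Admissible a z) {n r : ℕ} {J : Set ℝ} (hJ : IsLap a n J)
    {p q : Fin r → Bool} {i : Fin r} (hi : p i ≠ q i) (hl : ∀ l < i, p l = q l) {x y : ℝ}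
    (hx : x ∈ child a n J p) (hy : y ∈ child a n J q) :
    |theta a z ((fa a)^[n + i] x)| ≤ nu a z J / z ^ n / z ^ r := by
  have hsame : ∀ l < n + i, 0 < (fa a)^[l] x * (fa a)^[l] y := fun l hln => by
    rcases lt_or_ge l n with h | h
    · exact hJ.mul_pos h hx.1 hy.1
    · obtain ⟨l, rfl⟩ := Nat.exists_eq_add_of_le h
      have hli : l < i := by omega
      have h1 := hx.2 ⟨l, hli.trans i.2⟩
      have h2 := hy.2 ⟨l, hli.trans i.2⟩
      rw [← hl ⟨l, hli.trans i.2⟩ hli] at h2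
      have h3 := mul_pos h1 h2
      rw [mul_mul_mul_comm] at h3
      exact pos_of_mul_pos_right h3 (mul_self_nonneg _)
  have hopp : (fa a)^[n + i] x * (fa a)^[n + i] y ≤ 0 := by
    have h1 := hx.2 i
    have h2 := hy.2 i
    revert h1 h2
    have : ∀ b c : Bool, b ≠ c → ∀ s t : ℝ, 0 < signOf b * s → 0 < signOf c * t → s * t ≤ 0 := by
      intro b c hbc s t
      cases b <;> cases c <;> simp [signOf] at hbc ⊢ <;> intro hs ht
      · exact (mul_neg_of_neg_of_pos hs ht).le
      · exact (mul_neg_of_pos_of_neg hs ht).le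
    exact this _ _ hi _ _
  have h1 := hz.abs_theta_le_of_mul_neg hopp
  have h2 := hz.abs_theta_iterate_sub (n + i) hsame
  have h3 := hJ.abs_theta_sub_le_nu hz hx.1 hy.1
  have h4 : z ^ r ≤ z ^ (i : ℕ) := pow_le_pow_of_le_one hz.pos.le hz.lt_one.le i.2.le
  rw [div_div, le_div_iff₀ (mul_pos (pow_pos hz.pos _) (pow_pos hz.pos _))]
  calc |theta a z ((fa a)^[n + i] x)| * (z ^ n * z ^ r)
      ≤ |theta a z ((fa a)^[n + i] x) - theta a z ((fa a)^[n + i] y)| * (z ^ n * z ^ (i : ℕ)) := by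
        have := hz.pos
        gcongr
    _ = |theta a z x - theta a z y| := by rw [h2, pow_add]; ring
    _ ≤ nu a z J := h3

lemma continuous_fold_iterate (p : ℕ) :
    Continuous fun q : ℝ × ℝ => (fun t => q.1 * (|t| - 1))^[p] q.2 := by
  induction p with
  | zero => simpa using continuous_snd
  | succ p ih =>
    simp only [Function.iterate_succ_apply']
    exact continuous_fst.mul (ih.abs.sub continuous_const)

lemma Admissible.theta_iterate (hz : Admissible a z) {x : ℝ} {p : ℕ}
    (hx : ∀ l < p, (fa a)^[l] x ≠ 0) :
    theta a z ((fa a)^[p] x) = (fun t => z⁻¹ * (|t| - 1))^[p] (theta a z x) := by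
  induction p with
  | zero => rfl
  | succ p ih =>
    rw [Function.iterate_succ_apply', Function.iterate_succ_apply',
      ← ih fun l hl => hx l (hl.trans p.lt_succ_self), eq_inv_mul_iff_mul_eq₀ hz.pos.ne',
      hz.mul_theta_fa (hx p p.lt_succ_self)]

namespace LimitFamily

variable {𝒰 : Ultrafilter ℕ} {α ζ : ℕ → ℝ} {ψ : ℝ → ℝ}

lemma false_of_tendsto_zero (H : LimitFamily 𝒰 α ζ a z ψ) {N : ℕ → ℕ} {J : ℕ → Set ℝ}
    (hJ : ∀ k, IsLap (α k) (N k) (J k))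
    (hlim : Tendsto (fun k => nu (α k) (ζ k) (J k) / ζ k ^ N k) 𝒰 (𝓝 0))
    (h3 : ∀ r, 2 < z⁻¹ ^ r → ∀ᶠ k in (𝒰 : Filter ℕ), ∃ u v w : Fin r → Bool, u ≠ v ∧ u ≠ w ∧ v ≠ w ∧
      (child (α k) (N k) (J k) u).Nonempty ∧ (child (α k) (N k) (J k) v).Nonempty ∧
      (child (α k) (N k) (J k) w).Nonempty) : False := by
  have hs1 : 1 < z⁻¹ := (one_lt_inv₀ H.weight_pos).2 H.weight_lt
  classical
  have hex : ∃ r, 2 < z⁻¹ ^ r := pow_unbounded_of_one_lt 2 hs1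
  have hr := Nat.find_spec hex
  have hmin : ∀ p < Nat.find hex, z⁻¹ ^ p ≤ 2 := fun p hp => not_lt.1 (Nat.find_min hex hp)
  set r := Nat.find hex
  have hne : ∀ᶠ q in 𝓝 (z⁻¹, (0 : ℝ), (0 : ℝ)), ∀ p ∈ Finset.Ico 1 r,
      (fun t => q.1 * (|t| - 1))^[p] q.2.1 ≠ q.2.2 := by
    refine (Finset.Ico 1 r).eventually_all.2 fun p hp => ?_
    obtain ⟨hp1, hpr⟩ := Finset.mem_Ico.1 hp
    have hcont : Continuous fun q : ℝ × ℝ × ℝ => (fun t => q.1 * (|t| - 1))^[p] q.2.1 :=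
      (continuous_fold_iterate p).comp (continuous_fst.prodMk (continuous_fst.comp continuous_snd))
    have h0 : (fun t => z⁻¹ * (|t| - 1))^[p] 0 - 0 ≠ 0 := fun h0 =>
      absurd (two_lt_pow_of_fold_iterate_eq_zero hs1 hp1 (by rwa [sub_zero] at h0))
        (not_lt.2 (hmin p hpr))
    exact (((hcont.sub (continuous_snd.comp continuous_snd)).tendsto
      (z⁻¹, (0 : ℝ), (0 : ℝ))).eventually_ne h0).mono fun q hq => sub_ne_zero.1 hq
  obtain ⟨e, he, hball⟩ := Metric.eventually_nhds_iff.1 hne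
  have hlim' : Tendsto (fun k => nu (α k) (ζ k) (J k) / ζ k ^ N k / ζ k ^ r) 𝒰 (𝓝 0) := by
    have := hlim.div (H.tendsto_weight.pow r) (pow_pos H.weight_pos r).ne'
    rwa [zero_div] at this
  have hinv : Tendsto (fun k => (ζ k)⁻¹) 𝒰 (𝓝 z⁻¹) := H.tendsto_weight.inv₀ H.weight_pos.ne'
  obtain ⟨k, ⟨⟨u, v, w, huv, huw, hvw, hu, hv, hw⟩, hk1⟩, hk2⟩ :=
    (((h3 r hr).and (hlim'.eventually (gt_mem_nhds he))).and
      (hinv.eventually (Metric.ball_mem_nhds _ he))).exists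
  obtain ⟨p, q, q', ⟨x, hx⟩, ⟨y, hy⟩, ⟨y', hy'⟩, i, j, hij, hi, hj⟩ :=
    exists_two_differences huv huw hvw
      (P := fun w : Fin r → Bool => (child (α k) (N k) (J k) w).Nonempty) hu hv hw
  have hz := H.adm k
  have h1 := abs_theta_iterate_le_of_ne hz (hJ k) hi.1 hi.2 hx hy
  have h2 := abs_theta_iterate_le_of_ne hz (hJ k) hj.1 hj.2 hx hy'
  have hij' : (i : ℕ) < j := hij
  have h4 := hz.theta_iterate (x := (fa (α k))^[N k + i] x) (p := j - i) (by
    intro l hl h0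
    rw [← Function.iterate_add_apply] at h0
    have h5 := hx.2 ⟨i + l, by omega⟩
    rw [show N k + ((⟨i + l, by omega⟩ : Fin r) : ℕ) = l + (N k + i) by simp; ring, h0] at h5
    simp at h5)
  rw [← Function.iterate_add_apply, show (j : ℕ) - i + (N k + i) = N k + j by omega] at h4
  refine hball (y := ((ζ k)⁻¹, theta (α k) (ζ k) ((fa (α k))^[N k + i] x),
    theta (α k) (ζ k) ((fa (α k))^[N k + j] x))) ?_ (j - i)
    (Finset.mem_Ico.2 ⟨by omega, by omega⟩) h4.symm
  rw [Prod.dist_eq, Prod.dist_eq, Real.dist_0_eq_abs, Real.dist_0_eq_abs]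
  exact max_lt hk2 (max_lt (h1.trans_lt hk1) (h2.trans_lt hk1))

end LimitFamily

end

section

variable {a z : ℝ}

namespace IsLap

variable {n : ℕ} {J : Set ℝ}

lemma exists_eq_Ioo (hJ : IsLap a n J) (hne : J.Nonempty) : ∃ c d, c < d ∧ J = Ioo c d := by
  have hJI : J ⊆ Icc (-beta a) (beta a) := by rw [← Ia_eq]; exact hJ.subset
  have hb : BddBelow J := bddBelow_Icc.mono hJI
  have hb' : BddAbove J := bddAbove_Icc.mono hJI
  have hsub : J ⊆ Ioo (sInf J) (sSup J) := fun t ht => by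
    obtain ⟨e, he, hball⟩ := Metric.isOpen_iff.1 hJ.isOpen t ht
    have h1 : t - e / 2 ∈ J := hball (by
      rw [Metric.mem_ball, Real.dist_eq, show t - e / 2 - t = -(e / 2) by ring, abs_neg,
        abs_of_pos (by linarith)]; linarith)
    have h2 : t + e / 2 ∈ J := hball (by
      rw [Metric.mem_ball, Real.dist_eq, add_sub_cancel_left, abs_of_pos (by linarith)]; linarith)
    exact ⟨(csInf_le hb h1).trans_lt (by linarith), lt_of_lt_of_le (by linarith) (le_csSup hb' h2)⟩
  obtain ⟨t, ht⟩ := hne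
  refine ⟨sInf J, sSup J, (hsub ht).1.trans (hsub ht).2, hsub.antisymm fun y hy => ?_⟩
  obtain ⟨u, hu, huy⟩ := exists_lt_of_csInf_lt ⟨t, ht⟩ hy.1
  obtain ⟨v, hv, hvy⟩ := exists_lt_of_lt_csSup ⟨t, ht⟩ hy.2
  exact hJ.ordConnected.out hu hv ⟨huy.le, hvy.le⟩

lemma abs_iterate_sub_mono (hJ : IsLap a n J) {x y u v : ℝ} (hx : x ∈ J) (hy : y ∈ J)
    (hxu : x ≤ u) (huv : u ≤ v) (hvy : v ≤ y) :
    |(fa a)^[n] v - (fa a)^[n] u| ≤ |(fa a)^[n] y - (fa a)^[n] x| := by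
  have hxy := hxu.trans (huv.trans hvy)
  have mx : x ∈ Icc x y := ⟨le_rfl, hxy⟩
  have my : y ∈ Icc x y := ⟨hxy, le_rfl⟩
  have mu : u ∈ Icc x y := ⟨hxu, huv.trans hvy⟩
  have mv : v ∈ Icc x y := ⟨hxu.trans huv, hvy⟩
  rcases hJ.mono_or_anti hx hy hxy with h | h
  · have h1 := h.monotoneOn mx mu hxu
    have h2 := h.monotoneOn mu mv huv
    have h3 := h.monotoneOn mv my hvy
    rw [abs_of_nonneg (by linarith), abs_of_nonneg (by linarith)]; linarith
  · have h1 := h.antitoneOn mx mu hxu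
    have h2 := h.antitoneOn mu mv huv
    have h3 := h.antitoneOn mv my hvy
    rw [abs_of_nonpos (by linarith), abs_of_nonpos (by linarith)]; linarith

lemma cross_ratio_le (hJ : IsLap a n J) {x₀ x₁ x₂ x₃ : ℝ} (h0 : x₀ ∈ J) (h3 : x₃ ∈ J) (h01 : x₀ ≤ x₁)
    (h12 : x₁ ≤ x₂) (h23 : x₂ ≤ x₃) :
    |x₃ - x₀| * |x₂ - x₁| *
        (|(fa a)^[n] x₁ - (fa a)^[n] x₀| * |(fa a)^[n] x₃ - (fa a)^[n] x₂|) ≤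
      |(fa a)^[n] x₃ - (fa a)^[n] x₀| * |(fa a)^[n] x₂ - (fa a)^[n] x₁| *
        (|x₁ - x₀| * |x₃ - x₂|) := by
  have hmono : Monotone ![x₀, x₁, x₂, x₃] := by
    refine Fin.monotone_iff_le_succ.2 fun i => ?_
    fin_cases i <;> simpa
  have hmem : ∀ i, ![x₀, x₁, x₂, x₃] i ∈ J := fun i => by
    refine hJ.ordConnected.out h0 h3 ⟨?_, ?_⟩
    · exact hmono (Fin.zero_le i)
    · exact hmono (Fin.le_last i)
  have := QuadraticFamily.cross_ratio_le (a := a) n hmono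
    (fun i hi p q => (hJ.mul_pos hi (hmem p) (hmem q)).le)
  simpa using this

end IsLap

/-- The point dividing the interval from `c` to `d` in the ratio `t`. -/
def fracPoint (c d t : ℝ) : ℝ := c + t * (d - c)

lemma fracPoint_mem {c d t : ℝ} (hcd : c < d) (ht : 0 < t) (ht' : t < 1) :
    fracPoint c d t ∈ Ioo c d := by
  constructor <;> rw [fracPoint] <;> nlinarith

lemma fracPoint_le {c d s t : ℝ} (hcd : c < d) (hst : s ≤ t) :
    fracPoint c d s ≤ fracPoint c d t := by
  rw [fracPoint, fracPoint]; nlinarith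

lemma abs_fracPoint_sub {c d : ℝ} (hcd : c < d) (s t : ℝ) :
    |fracPoint c d s - fracPoint c d t| = |s - t| * (d - c) := by
  rw [fracPoint, fracPoint, ← abs_of_pos (sub_pos.2 hcd), ← abs_mul, abs_of_pos (sub_pos.2 hcd)]
  congr 1; ring

/-- Bounded distortion in the middle of a lap. -/
lemma IsLap.distortion_le (ha : -2 ≤ a) (ha' : a ≤ 1 / 4) {n : ℕ} {c d g : ℝ} (hcd : c < d)
    (hJ : IsLap a n (Ioo c d)) (hg : 0 < g) {G : ℝ → ℝ}
    (hG : G = fun t => (fa a)^[n] (fracPoint c d t)) (h1 : g ≤ |G (3 / 8) - G (1 / 4)|)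
    (h2 : g ≤ |G (3 / 4) - G (5 / 8)|) (h3 : g ≤ |G (7 / 8) - G (3 / 4)|) {s t : ℝ}
    (hs : s ∈ Icc (3 / 8 : ℝ) (5 / 8)) (ht : t ∈ Icc (3 / 8 : ℝ) (5 / 8)) :
    g ^ 2 * |s - t| ≤ 2 * |G s - G t| ∧ g * |G s - G t| ≤ 64 * |s - t| := by
  wlog hst : s ≤ t generalizing s t
  · rw [abs_sub_comm s, abs_sub_comm (G s)]
    exact this ht hs (le_of_not_ge hst)
  have hL : 0 < d - c := sub_pos.2 hcd
  have hmem : ∀ t, 0 < t → t < 1 → fracPoint c d t ∈ Ioo c d := fun t => fracPoint_mem hcd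
  have hG2 : ∀ t, 0 < t → t < 1 → |G t| ≤ 2 := fun t h h' => by
    rw [hG]; exact abs_iterate_le_two ha ha' (hJ.subset (hmem t h h')) n
  have hG4 : ∀ s t, 0 < s → s < 1 → 0 < t → t < 1 → |G s - G t| ≤ 4 := fun s t h1 h2 h3 h4 =>
    (abs_sub _ _).trans (by linarith [hG2 s h1 h2, hG2 t h3 h4])
  have hmono : ∀ x u v y, 0 < x → x ≤ u → u ≤ v → v ≤ y → y < 1 → |G v - G u| ≤ |G y - G x| := by
    intro x u v y h1 h2 h3 h4 h5
    rw [hG]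
    exact hJ.abs_iterate_sub_mono (hmem x h1 (by linarith)) (hmem y (by linarith) h5)
      (fracPoint_le hcd h2) (fracPoint_le hcd h3) (fracPoint_le hcd h4)
  have hcross : ∀ x u v y, 0 < x → x ≤ u → u ≤ v → v ≤ y → y < 1 →
      |y - x| * |v - u| * (|G u - G x| * |G y - G v|) ≤
        |G y - G x| * |G v - G u| * (|u - x| * |y - v|) := by
    intro x u v y h1 h2 h3 h4 h5
    have := hJ.cross_ratio_le (hmem x h1 (by linarith)) (hmem y (by linarith) h5)
      (fracPoint_le hcd h2) (fracPoint_le hcd h3) (fracPoint_le hcd h4)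
    simp only [abs_fracPoint_sub hcd] at this
    rw [hG]
    refine le_of_mul_le_mul_right (?_ : _ * (d - c) ^ 2 ≤ _ * (d - c) ^ 2) (by positivity)
    linarith
  have hst0 := abs_nonneg (t - s)
  have hGst0 := abs_nonneg (G t - G s)
  rw [abs_sub_comm s, abs_sub_comm (G s)]
  constructor
  · have e1 := hcross (1 / 4) s t (3 / 4) (by norm_num) (by linarith [hs.1]) hst
      (by linarith [ht.2]) (by norm_num)
    have e2 : g ≤ |G s - G (1 / 4)| := h1.trans (hmono (1 / 4) (1 / 4) (3 / 8) s (by norm_num) le_rfl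
      (by norm_num) hs.1 (by linarith [hs.2]))
    have e3 : g ≤ |G (3 / 4) - G t| := h2.trans (hmono t (5 / 8) (3 / 4) (3 / 4)
      (by linarith [ht.1]) ht.2 (by norm_num) le_rfl (by norm_num))
    have e4 : |s - 1 / 4| ≤ 1 / 2 := abs_le.2 ⟨by linarith [hs.1], by linarith [hs.2]⟩
    have e5 : |3 / 4 - t| ≤ 1 / 2 := abs_le.2 ⟨by linarith [ht.2], by linarith [ht.1]⟩
    have e6 := hG4 (3 / 4) (1 / 4) (by norm_num) (by norm_num) (by norm_num) (by norm_num)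
    have e7 : |(3 / 4 : ℝ) - 1 / 4| = 1 / 2 := by norm_num [abs_of_pos]
    rw [e7] at e1
    have e8 : 1 / 2 * |t - s| * (g * g) ≤ 1 / 2 * |t - s| * (|G s - G (1 / 4)| * |G (3 / 4) - G t|) := by
      gcongr
    have e9 : |G (3 / 4) - G (1 / 4)| * |G t - G s| * (|s - 1 / 4| * |3 / 4 - t|) ≤
        4 * |G t - G s| * (1 / 2 * (1 / 2)) := by gcongr
    nlinarith
  · have e1 := hcross s t (3 / 4) (7 / 8) (by linarith [hs.1]) hst
      (by linarith [ht.2]) (by norm_num) (by norm_num)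
    have e4 : 1 / 4 ≤ |7 / 8 - s| := le_trans (by linarith [hs.2]) (le_abs_self _)
    have e5 : 1 / 8 ≤ |3 / 4 - t| := le_trans (by linarith [ht.2]) (le_abs_self _)
    have e6 := hG4 (7 / 8) s (by norm_num) (by norm_num) (by linarith [hs.1]) (by linarith [hs.2])
    have e6' := hG4 (3 / 4) t (by norm_num) (by norm_num) (by linarith [ht.1]) (by linarith [ht.2])
    have e7 : |(7 / 8 : ℝ) - 3 / 4| = 1 / 8 := by norm_num [abs_of_pos]
    rw [e7] at e1
    have e8 : 1 / 4 * (1 / 8) * (|G t - G s| * g) ≤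
        |7 / 8 - s| * |3 / 4 - t| * (|G t - G s| * |G (7 / 8) - G (3 / 4)|) := by gcongr
    have e9 : |G (7 / 8) - G s| * |G (3 / 4) - G t| * (|t - s| * (1 / 8)) ≤
        4 * 4 * (|t - s| * (1 / 8)) := by gcongr
    nlinarith

end

section

variable {a z : ℝ}

lemma exists_tendsto_of_abs_le {ι : Type*} {𝒰 : Ultrafilter ι} {x : ι → ℝ} {B : ℝ}
    (hx : ∀ᶠ k in (𝒰 : Filter ι), |x k| ≤ B) : ∃ y, |y| ≤ B ∧ Tendsto x 𝒰 (𝓝 y) := by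
  obtain ⟨y, hy, h⟩ := (isCompact_Icc (a := -B) (b := B)).ultrafilter_le_nhds (𝒰.map x)
    (le_principal_iff.2 (hx.mono fun k hk => abs_le.1 hk))
  exact ⟨y, abs_le.2 hy, h⟩

lemma IsLap.abs_mul_sub_theta_le (hz : Admissible a z) {n m : ℕ} {c d : ℝ} (hcd : c < d)
    (hJ : IsLap a n (Ioo c d)) {E : ℝ}
    (hE : ∑ w : Fin m → Bool, |lengthRatio a n (Ioo c d) w - omegaRatio a z n (Ioo c d) w| ≤ E)
    {s t : ℝ} (hs : s ∈ Ioo (0 : ℝ) 1) (ht : t ∈ Ioo (0 : ℝ) 1) :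
    abs (|s - t| * (omega a z n (Ioo c d) / z ^ n) -
        |theta a z ((fa a)^[n] (fracPoint c d s)) - theta a z ((fa a)^[n] (fracPoint c d t))|) ≤
      2 * (z ^ m * (2 * (2 / (1 - z)) + 2 ^ m * nu a z {0}) +
        E * (omega a z n (Ioo c d) / z ^ n)) := by
  have hx := fracPoint_mem hcd hs.1 hs.2
  have hy := fracPoint_mem hcd ht.1 ht.2
  have key := hJ.abs_ratio_sub_theta_le hz hE hx hy
  have hzn : 0 < z ^ n := pow_pos hz.pos n
  have hL : 0 < d - c := sub_pos.2 hcd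
  rw [hJ.abs_theta_sub hz hx hy, abs_fracPoint_sub hcd, Real.volume_real_Ioo_of_le hcd.le,
    mul_div_assoc, div_self hL.ne', mul_one, ratioError, pow_add] at key
  refine le_of_mul_le_mul_left (?_ : z ^ n * _ ≤ z ^ n * _) hzn
  rw [← abs_of_pos hzn, ← abs_mul, abs_of_pos hzn]
  convert key using 1
  · congr 1; field_simp
  · field_simp

namespace LimitFamily

variable {𝒰 : Ultrafilter ℕ} {α ζ : ℕ → ℝ} {ψ : ℝ → ℝ}

lemma tendsto_weight_pow (H : LimitFamily 𝒰 α ζ a z ψ) (h𝒰 : (𝒰 : Filter ℕ) ≤ atTop) :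
    Tendsto (fun k => ζ k ^ (k + 1)) 𝒰 (𝓝 0) := by
  have hz := H.weight_pos
  have hz1 := H.weight_lt
  have h1 : Tendsto (fun k : ℕ => ((1 + z) / 2) ^ (k + 1)) 𝒰 (𝓝 0) :=
    (((tendsto_pow_atTop_nhds_zero_of_lt_one (by linarith) (by linarith)).comp
      (tendsto_add_atTop_nat 1))).mono_left h𝒰
  refine squeeze_zero' (Eventually.of_forall fun k => (pow_pos (H.adm k).pos _).le) ?_ h1
  filter_upwards [H.tendsto_weight.eventually (gt_mem_nhds (by linarith : z < (1 + z) / 2))] with k hk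
  exact pow_le_pow_left₀ (H.adm k).pos.le hk.le _

theorem false_of_tendsto_pos (H : LimitFamily 𝒰 α ζ a z ψ) (h𝒰 : (𝒰 : Filter ℕ) ≤ atTop)
    (ha : -2 < a) {N : ℕ → ℕ} {c d : ℕ → ℝ} (hcd : ∀ k, c k < d k)
    (hJ : ∀ k, IsLap (α k) (N k) (Ioo (c k) (d k))) {E : ℕ → ℝ} (hE0 : Tendsto E 𝒰 (𝓝 0))
    (hE : ∀ k, ∑ w : Fin (k + 1) → Bool, |lengthRatio (α k) (N k) (Ioo (c k) (d k)) w -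
      omegaRatio (α k) (ζ k) (N k) (Ioo (c k) (d k)) w| ≤ E k)
    (hν : Tendsto (fun k => 2 ^ (k + 1) * nu (α k) (ζ k) {0}) 𝒰 (𝓝 0)) {ϑ : ℝ} (hϑ : 0 < ϑ)
    (hσ : Tendsto (fun k => omega (α k) (ζ k) (N k) (Ioo (c k) (d k)) / ζ k ^ N k) 𝒰 (𝓝 ϑ)) :
    False := by
  have hz := H.weight_pos
  have hz1 := H.weight_lt
  set σ : ℕ → ℝ := fun k => omega (α k) (ζ k) (N k) (Ioo (c k) (d k)) / ζ k ^ N k with hσdef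
  set R : ℕ → ℝ := fun k => 2 * (ζ k ^ (k + 1) * (2 * (2 / (1 - ζ k)) +
    2 ^ (k + 1) * nu (α k) (ζ k) {0}) + E k * σ k) with hRdef
  have hR : Tendsto R 𝒰 (𝓝 0) := by
    have h1 : Tendsto (fun k => 2 * (2 / (1 - ζ k))) 𝒰 (𝓝 (2 * (2 / (1 - z)))) :=
      (tendsto_const_nhds.div (tendsto_const_nhds.sub H.tendsto_weight) (by linarith)).const_mul 2
    have h2 := (((H.tendsto_weight_pow h𝒰).mul (h1.add hν)).add (hE0.mul hσ)).const_mul 2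
    simpa using h2
  set G : ℕ → ℝ → ℝ := fun k t => (fa (α k))^[N k] (fracPoint (c k) (d k) t) with hGdef
  have happrox : ∀ k, ∀ s ∈ Ioo (0 : ℝ) 1, ∀ t ∈ Ioo (0 : ℝ) 1, abs (|s - t| * σ k -
      |theta (α k) (ζ k) (G k s) - theta (α k) (ζ k) (G k t)|) ≤ R k := fun k s hs t ht =>
    (hJ k).abs_mul_sub_theta_le (H.adm k) (hcd k) (hE k) hs ht
  have hlim : ∀ t, ∃ y, t ∈ Ioo (0 : ℝ) 1 → Tendsto (fun k => G k t) 𝒰 (𝓝 y) := fun t => by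
    by_cases ht : t ∈ Ioo (0 : ℝ) 1
    · obtain ⟨y, -, hy⟩ := exists_tendsto_of_abs_le (𝒰 := 𝒰) (x := fun k => G k t) (B := 2)
        (Eventually.of_forall fun k => abs_iterate_le_two (H.adm k).neg_two_le (H.le_quarter k)
          ((hJ k).subset (fracPoint_mem (hcd k) ht.1 ht.2)) _)
      exact ⟨y, fun _ => hy⟩
    · exact ⟨0, fun h => absurd h ht⟩
  choose u hu using hlim
  have hψu : ∀ s ∈ Ioo (0 : ℝ) 1, ∀ t ∈ Ioo (0 : ℝ) 1, |s - t| * ϑ = |ψ (u s) - ψ (u t)| := by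
    intro s hs t ht
    have h1 : Tendsto (fun k => |s - t| * σ k -
        |theta (α k) (ζ k) (G k s) - theta (α k) (ζ k) (G k t)|) 𝒰 (𝓝 0) :=
      squeeze_zero_norm (fun k => happrox k s hs t ht) hR
    have h2 := (hσ.const_mul |s - t|).sub ((H.tendsto_theta_of_tendsto (hu s hs)).sub
      (H.tendsto_theta_of_tendsto (hu t ht))).abs
    exact sub_eq_zero.1 (tendsto_nhds_unique h2 h1)
  have hne : ∀ s ∈ Ioo (0 : ℝ) 1, ∀ t ∈ Ioo (0 : ℝ) 1, s ≠ t → u s - u t ≠ 0 := by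
    intro s hs t ht hst h0
    have := hψu s hs t ht
    rw [sub_eq_zero.1 h0, sub_self, abs_zero] at this
    exact (mul_pos (abs_pos.2 (sub_ne_zero.2 hst)) hϑ).ne' this
  have m1 : (1 / 4 : ℝ) ∈ Ioo (0 : ℝ) 1 := by constructor <;> norm_num
  have m2 : (3 / 8 : ℝ) ∈ Ioo (0 : ℝ) 1 := by constructor <;> norm_num
  have m3 : (1 / 2 : ℝ) ∈ Ioo (0 : ℝ) 1 := by constructor <;> norm_num
  have m4 : (5 / 8 : ℝ) ∈ Ioo (0 : ℝ) 1 := by constructor <;> norm_num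
  have m5 : (3 / 4 : ℝ) ∈ Ioo (0 : ℝ) 1 := by constructor <;> norm_num
  have m6 : (7 / 8 : ℝ) ∈ Ioo (0 : ℝ) 1 := by constructor <;> norm_num
  have hbetween : 0 < (u (1 / 2) - u (3 / 8)) * (u (5 / 8) - u (1 / 2)) := by
    refine lt_of_le_of_ne ?_ (mul_ne_zero (hne _ m3 _ m2 (by norm_num))
      (hne _ m4 _ m3 (by norm_num))).symm
    refine ge_of_tendsto (((hu _ m3).sub (hu _ m2)).mul ((hu _ m4).sub (hu _ m3)))
      (Eventually.of_forall fun k => ?_)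
    have e1 := fracPoint_le (hcd k) (by norm_num : (3 / 8 : ℝ) ≤ 1 / 2)
    have e2 := fracPoint_le (hcd k) (by norm_num : (1 / 2 : ℝ) ≤ 5 / 8)
    rcases (hJ k).mono_or_anti (fracPoint_mem (hcd k) m2.1 m2.2) (fracPoint_mem (hcd k) m4.1 m4.2)
      (e1.trans e2) with h | h
    · exact mul_nonneg (sub_nonneg.2 (h.monotoneOn ⟨le_rfl, e1.trans e2⟩ ⟨e1, e2⟩ e1))
        (sub_nonneg.2 (h.monotoneOn ⟨e1, e2⟩ ⟨e1.trans e2, le_rfl⟩ e2))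
    · exact mul_nonneg_of_nonpos_of_nonpos
        (sub_nonpos.2 (h.antitoneOn ⟨le_rfl, e1.trans e2⟩ ⟨e1, e2⟩ e1))
        (sub_nonpos.2 (h.antitoneOn ⟨e1, e2⟩ ⟨e1.trans e2, le_rfl⟩ e2))
  obtain ⟨g, hg, hgev⟩ : ∃ g > 0, ∀ᶠ k in (𝒰 : Filter ℕ), g ≤ |G k (3 / 8) - G k (1 / 4)| ∧
      g ≤ |G k (3 / 4) - G k (5 / 8)| ∧ g ≤ |G k (7 / 8) - G k (3 / 4)| := by
    have p1 := abs_pos.2 (hne _ m2 _ m1 (by norm_num))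
    have p2 := abs_pos.2 (hne _ m5 _ m4 (by norm_num))
    have p3 := abs_pos.2 (hne _ m6 _ m5 (by norm_num))
    obtain ⟨g, hg, hg'⟩ := exists_between (lt_min p1 (lt_min p2 p3))
    rw [lt_min_iff, lt_min_iff] at hg'
    refine ⟨g, hg, ?_⟩
    filter_upwards [((hu _ m2).sub (hu _ m1)).abs.eventually (lt_mem_nhds hg'.1),
      ((hu _ m5).sub (hu _ m4)).abs.eventually (lt_mem_nhds hg'.2.1),
      ((hu _ m6).sub (hu _ m5)).abs.eventually (lt_mem_nhds hg'.2.2)] with k h1 h2 h3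
    exact ⟨h1.le, h2.le, h3.le⟩
  have hpre : ∀ p, 0 < (p - u (3 / 8)) * (u (5 / 8) - p) → ∀ᶠ k in (𝒰 : Filter ℕ),
      ∃ s ∈ Icc (3 / 8 : ℝ) (5 / 8), G k s = p := by
    intro p hp
    filter_upwards [((tendsto_const_nhds.sub (hu _ m2)).mul ((hu _ m4).sub
      tendsto_const_nhds)).eventually (lt_mem_nhds hp)] with k hk
    have hcont : Continuous (G k) := (continuous_iterate (α k) (N k)).comp
      (continuous_const.add (continuous_id.mul continuous_const))
    have hmem : p ∈ uIcc (G k (3 / 8)) (G k (5 / 8)) := by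
      rw [mem_uIcc]
      rcases mul_pos_iff.1 hk with ⟨h1, h2⟩ | ⟨h1, h2⟩
      · left; constructor <;> linarith
      · right; constructor <;> linarith
    obtain ⟨s, hs, h⟩ := intermediate_value_uIcc hcont.continuousOn hmem
    rw [uIcc_of_le (by norm_num)] at hs
    exact ⟨s, hs, h⟩
  have hbi : BiLipAt ψ (u (1 / 2)) := by
    refine ⟨ϑ * g / 64, by positivity, 2 * ϑ / g ^ 2, by positivity, ?_⟩
    have hU : ∀ᶠ p in 𝓝 (u (1 / 2)), 0 < (p - u (3 / 8)) * (u (5 / 8) - p) :=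
      (Continuous.tendsto (by fun_prop) _).eventually (lt_mem_nhds hbetween)
    rw [nhds_prod_eq]
    filter_upwards [hU.prod_mk hU] with pq hpq
    obtain ⟨p, q⟩ := pq
    have hpq1 := hpq.1
    have hpq2 := hpq.2
    simp only at hpq1 hpq2 ⊢
    have hθ := ((H.tendsto_theta p).sub (H.tendsto_theta q)).abs
    have hev : ∀ᶠ k in (𝒰 : Filter ℕ),
        g ^ 2 * (|theta (α k) (ζ k) p - theta (α k) (ζ k) q| - R k) ≤ 2 * |p - q| * σ k ∧
        g * |p - q| * σ k ≤ 64 * (|theta (α k) (ζ k) p - theta (α k) (ζ k) q| + R k) := by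
      filter_upwards [hpre p hpq1, hpre q hpq2, hgev] with k ⟨s, hs, hsp⟩ ⟨t, ht, htq⟩ hgk
      have hσ0 : 0 ≤ σ k := div_nonneg (omega_nonneg (H.adm k) _ _) (pow_pos (H.adm k).pos _).le
      have h1 := (hJ k).distortion_le (H.adm k).neg_two_le (H.le_quarter k) (hcd k) hg
        (G := G k) rfl hgk.1 hgk.2.1 hgk.2.2 hs ht
      have h2 := _root_.abs_le.1 (happrox k s ⟨by linarith [hs.1], by linarith [hs.2]⟩ t
        ⟨by linarith [ht.1], by linarith [ht.2]⟩)
      rw [hsp, htq] at h1 h2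
      have h3 := mul_le_mul_of_nonneg_right h1.1 hσ0
      have h4 := mul_le_mul_of_nonneg_right h1.2 hσ0
      constructor
      · have := mul_le_mul_of_nonneg_left (h2.1) (sq_nonneg g)
        linarith
      · linarith [h2.2]
    have l1 := le_of_tendsto_of_tendsto ((hθ.sub hR).const_mul (g ^ 2)) (hσ.const_mul (2 * |p - q|))
      (hev.mono fun k hk => hk.1)
    have l2 := le_of_tendsto_of_tendsto (hσ.const_mul (g * |p - q|)) ((hθ.add hR).const_mul 64)
      (hev.mono fun k hk => hk.2)
    rw [sub_zero] at l1
    rw [add_zero] at l2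
    constructor
    · linarith
    · rw [div_mul_eq_mul_div, le_div_iff₀ (by positivity)]
      linarith
  exact H.foldSemiconj.false_of_biLipAt ha ((one_lt_inv₀ hz).2 hz1) H.abs_le hbi

end LimitFamily

end

section

variable {a z : ℝ}

/-- The defect from one half of the exponent of the weight at stage `k`. -/
noncomputable def defect (k : ℕ) : ℝ := (1 / 4) ^ (k + 2)

/-- The relative entropy margin at stage `k`. -/
noncomputable def margin (k : ℕ) : ℝ := defect k / (k + 2)

/-- The weight of the kneading map at stage `k`. -/
noncomputable def weight (k : ℕ) (a : ℝ) : ℝ := Real.exp (-((1 + margin k) * h a))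

/-- The growth factor at stage `k`. -/
noncomputable def growth (k : ℕ) (a : ℝ) : ℝ :=
  Real.exp (defect k * (h a * (1 - 1 / ((k : ℝ) + 2))))

lemma defect_pos (k : ℕ) : 0 < defect k := by rw [defect]; positivity

lemma defect_le (k : ℕ) : defect k ≤ 1 / 16 := by
  rw [defect, pow_add]
  have := pow_le_one₀ (n := k) (by norm_num : (0 : ℝ) ≤ 1 / 4) (by norm_num)
  linarith

lemma margin_pos (k : ℕ) : 0 < margin k := div_pos (defect_pos k) (by positivity)

lemma two_pow_mul_defect (k : ℕ) : 2 ^ (k + 1) * defect k = 1 / 4 * (1 / 2) ^ (k + 1) := by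
  rw [defect, show k + 2 = (k + 1) + 1 from rfl, pow_succ (1 / 4 : ℝ) (k + 1), ← mul_assoc, ← mul_pow]
  norm_num
  ring

lemma tendsto_two_pow_mul_defect : Tendsto (fun k => 2 ^ (k + 1) * defect k) atTop (𝓝 0) := by
  simp_rw [two_pow_mul_defect]
  have h1 := ((tendsto_pow_atTop_nhds_zero_of_lt_one (by norm_num : (0 : ℝ) ≤ 1 / 2)
    (by norm_num)).comp (tendsto_add_atTop_nat 1)).const_mul (1 / 4)
  rwa [mul_zero] at h1

lemma tendsto_margin : Tendsto margin atTop (𝓝 0) := by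
  refine squeeze_zero (fun k => (margin_pos k).le) (fun k => ?_) tendsto_two_pow_mul_defect
  rw [margin]
  have h1 : (1 : ℝ) ≤ 2 ^ (k + 1) := one_le_pow₀ (by norm_num)
  have h2 : (1 : ℝ) ≤ (k : ℝ) + 2 := by linarith [(Nat.cast_nonneg k : (0 : ℝ) ≤ k)]
  exact (div_le_self (defect_pos k).le h2).trans (le_mul_of_one_le_left (defect_pos k).le h1)

lemma one_div_add_two_le (k : ℕ) : 1 / ((k : ℝ) + 2) ≤ 1 := by
  rw [div_le_one (by positivity)]
  linarith [(Nat.cast_nonneg k : (0 : ℝ) ≤ k)]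

lemma one_le_growth (k : ℕ) (hpos : 0 ≤ h a) : 1 ≤ growth k a :=
  Real.one_le_exp (mul_nonneg (defect_pos k).le (mul_nonneg hpos (by linarith [one_div_add_two_le k])))

lemma admissible_weight (ha : -2 ≤ a) (ha' : a ≤ 1 / 4) (hpos : 0 < h a) (k : ℕ) :
    Admissible a (weight k a) := by
  have := margin_pos k
  refine admissible_of_lt ha ha' (Real.exp_pos _) (Real.exp_lt_one_iff.2 ?_) (Real.exp_lt_exp.2 ?_) <;> nlinarith

/-- If the exponent nearly reaches the entropy, then some lap fails to contract at all small depths. -/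
lemma exists_lap_not_contracts (ha : -2 ≤ a) (ha' : a ≤ 1 / 4) (hpos : 0 < h a) {k : ℕ}
    {μ : Measure ℝ} (hμ : IsAcip a μ)
    (hi : Integrable (fun x => Real.log |deriv (fa a) x|) μ)
    (hle : h a ≤ (1 + margin k) * ∫ x, Real.log |deriv (fa a) x| ∂μ) :
    ∃ n J, IsLap a n J ∧ J.Nonempty ∧ ∀ m, 1 ≤ m → m ≤ k + 1 →
      ¬Contracts a (weight k a) (1 / 2 - defect k) (growth k a) n m J := by
  by_contra! hcon
  obtain ⟨C, hC⟩ := exists_integral_sqrt_slope_le (admissible_weight ha ha' hpos k) ha'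
    (by linarith [defect_le k] : 0 ≤ 1 / 2 - defect k) (one_le_growth k hpos.le) hcon
  have hrate : (weight k a ^ (1 / 2 - defect k))⁻¹ * growth k a =
      Real.exp ((1 + margin k) * h a * (1 / 2 - defect k) +
        defect k * (h a * (1 - 1 / ((k : ℝ) + 2)))) := by
    rw [weight, growth, ← Real.exp_mul, ← Real.exp_neg, ← Real.exp_add]
    congr 1; ring
  rw [hrate] at hC
  have h1 := lyapunov_le ha ha' hμ hi (Real.exp_pos _) hC
  rw [Real.log_exp] at h1
  have hm := margin_pos k
  have hd := defect_pos k
  have h2 : defect k * (1 / ((k : ℝ) + 2)) = margin k := by rw [margin]; ring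
  have h3 : ∫ x, Real.log |deriv (fa a) x| ∂μ ≤ (1 - margin k) * h a := by
    refine h1.trans ?_
    have : 2 * ((1 + margin k) * h a * (1 / 2 - defect k) +
        defect k * (h a * (1 - 1 / ((k : ℝ) + 2)))) =
        h a * (1 + margin k - 2 * defect k * margin k - 2 * (defect k * (1 / ((k : ℝ) + 2)))) := by
      ring
    rw [this, h2, mul_comm]
    refine mul_le_mul_of_nonneg_right ?_ hpos.le
    nlinarith [mul_pos hd hm]
  have h4 := mul_le_mul_of_nonneg_left h3 (by linarith : 0 ≤ 1 + margin k)
  nlinarith [mul_pos (mul_pos hm hm) hpos]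

theorem false_of_laps_not_contract {𝒰 : Ultrafilter ℕ} (h𝒰 : (𝒰 : Filter ℕ) ≤ atTop) {α : ℕ → ℝ}
    (hα : ∀ k, -2 ≤ α k ∧ α k ≤ 1 / 4) (hhα : ∀ k, 0 < h (α k)) (hlim : Tendsto α 𝒰 (𝓝 a))
    (ha : -2 < a) (ha' : a ≤ 1 / 4) (hpos : 0 < h a) {N : ℕ → ℕ} {J : ℕ → Set ℝ}
    (hJ : ∀ k, IsLap (α k) (N k) (J k)) (hne : ∀ k, (J k).Nonempty)
    (hF : ∀ k m, 1 ≤ m → m ≤ k + 1 →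
      ¬Contracts (α k) (weight k (α k)) (1 / 2 - defect k) (growth k (α k)) (N k) m (J k)) :
    False := by
  obtain ⟨c, hc, hcev⟩ := exists_le_entropy h𝒰 hα hlim ha.le ha' hpos
  obtain ⟨b, -, hb⟩ := exists_tendsto_of_abs_le (𝒰 := 𝒰) (x := fun k => h (α k)) (B := Real.log 2)
    (Eventually.of_forall fun k => by
      rw [abs_of_pos (hhα k)]; exact h_le_log_two (hα k).1 (hα k).2)
  have hb0 : 0 < b := hc.trans_le (ge_of_tendsto hb hcev)
  set ζ : ℕ → ℝ := fun k => weight k (α k) with hζ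
  have hadm : ∀ k, Admissible (α k) (ζ k) := fun k =>
    admissible_weight (hα k).1 (hα k).2 (hhα k) k
  have hζlim : Tendsto ζ 𝒰 (𝓝 (Real.exp (-b))) := by
    have h1 := ((((tendsto_margin.mono_left h𝒰).const_add 1).mul hb).neg)
    rw [add_zero, one_mul] at h1
    exact (Real.continuous_exp.tendsto _).comp h1
  have hz1 : Real.exp (-b) < 1 := Real.exp_lt_one_iff.2 (by linarith)
  have hinv : Tendsto (fun k => 1 / (1 - ζ k)) 𝒰 (𝓝 (1 / (1 - Real.exp (-b)))) :=
    tendsto_const_nhds.div (tendsto_const_nhds.sub hζlim) (by linarith)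
  have hbdd : ∃ B, ∀ᶠ k in (𝒰 : Filter ℕ), 1 / (1 - ζ k) ≤ B :=
    ⟨1 / (1 - Real.exp (-b)) + 1, (hinv.eventually (gt_mem_nhds (lt_add_one _))).mono
      fun k hk => hk.le⟩
  obtain ⟨B, hB⟩ := hbdd
  have hψ : ∀ x, ∃ y, Tendsto (fun k => theta (α k) (ζ k) x) 𝒰 (𝓝 y) := fun x => by
    obtain ⟨y, -, hy⟩ := exists_tendsto_of_abs_le (𝒰 := 𝒰) (x := fun k => theta (α k) (ζ k) x)
      (B := B) (hB.mono fun k hk => (abs_theta_le (hadm k).pos (hadm k).lt_one _ x).trans hk)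
    exact ⟨y, hy⟩
  choose ψ hψ using hψ
  have hν : Tendsto (fun k => 2 ^ (k + 1) * nu (α k) (ζ k) {0}) 𝒰 (𝓝 0) := by
    have h1 := ((tendsto_two_pow_mul_defect.mono_left h𝒰).const_mul 64).mul (hinv.pow 2)
    rw [mul_zero, zero_mul] at h1
    refine squeeze_zero (fun k => mul_nonneg (by positivity) (hadm k).nu_zero_pos.le) (fun k => ?_) h1
    have h2 := (hJ k).nu_zero_le_of_not_contracts (hadm k) (hne k) (defect_pos k).le
      (by linarith [defect_le k]) (one_le_growth k (hhα k).le) (hF k 1 le_rfl (by omega))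
    refine (mul_le_mul_of_nonneg_left h2 (by positivity)).trans_eq ?_
    rw [div_pow, one_pow]; ring
  have hν' : Tendsto (fun k => nu (α k) (ζ k) {0}) 𝒰 (𝓝 0) :=
    squeeze_zero (fun k => (hadm k).nu_zero_pos.le)
      (fun k => le_mul_of_one_le_left (hadm k).nu_zero_pos.le (one_le_pow₀ (by norm_num))) hν
  have H : LimitFamily 𝒰 α ζ a (Real.exp (-b)) ψ :=
    { adm := hadm
      le_quarter := fun k => (hα k).2
      tendsto_param := hlim
      tendsto_weight := hζlim
      weight_pos := Real.exp_pos _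
      weight_lt := hz1
      tendsto_nu := hν'
      tendsto_theta := hψ }
  have hσle : ∀ k, nu (α k) (ζ k) (J k) / ζ k ^ N k ≤ omega (α k) (ζ k) (N k) (J k) / ζ k ^ N k ∧
      |omega (α k) (ζ k) (N k) (J k) / ζ k ^ N k| ≤ 4 * (1 / (1 - ζ k)) := fun k => by
    have hzn : 0 < ζ k ^ N k := pow_pos (hadm k).pos _
    have h1 := (hJ k).nu_le (hadm k)
    have h2 := (hadm k).nu_le {0}
    have h3 := (hadm k).nu_zero_pos
    have h4 := omega_nonneg (hadm k) (N k) (J k)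
    rw [abs_of_nonneg (div_nonneg h4 hzn.le), omega_of_nonempty (hne k)]
    constructor
    · gcongr
      linarith [mul_pos hzn h3]
    · rw [div_le_iff₀ hzn]
      have h5 := mul_le_mul_of_nonneg_left h2 hzn.le
      have e : 4 * (1 / (1 - ζ k)) * ζ k ^ N k = ζ k ^ N k * (2 / (1 - ζ k)) +
        ζ k ^ N k * (2 / (1 - ζ k)) := by ring
      rw [e]
      exact add_le_add h1 h5
  obtain ⟨ϑ, -, hϑ⟩ := exists_tendsto_of_abs_le (𝒰 := 𝒰)
    (x := fun k => omega (α k) (ζ k) (N k) (J k) / ζ k ^ N k) (B := 4 * B)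
    (hB.mono fun k hk => (hσle k).2.trans (by linarith))
  have hϑ0 : 0 ≤ ϑ := ge_of_tendsto hϑ (Eventually.of_forall fun k =>
    div_nonneg (omega_nonneg (hadm k) _ _) (pow_pos (hadm k).pos _).le)
  rcases hϑ0.eq_or_lt with rfl | hϑ0
  · refine H.false_of_tendsto_zero hJ (squeeze_zero (fun k => div_nonneg ((hadm k).nu_nonneg _)
      (pow_pos (hadm k).pos _).le) (fun k => (hσle k).1) hϑ) fun r hr => ?_
    have hr1 : 1 ≤ r := by
      by_contra! h0
      rw [Nat.lt_one_iff.1 h0, pow_zero] at hr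
      norm_num at hr
    have hlog : Real.log 2 < b * r := by
      have := Real.log_lt_log (by norm_num) hr
      rwa [← Real.exp_neg, neg_neg, ← Real.exp_nat_mul, Real.log_exp, mul_comm] at this
    have hfac : Tendsto (fun k : ℕ => 1 - 1 / ((k : ℝ) + 2)) 𝒰 (𝓝 1) := by
      have h1 : Tendsto (fun k : ℕ => 1 / ((k : ℝ) + 2)) atTop (𝓝 0) :=
        tendsto_const_nhds.div_atTop (tendsto_atTop_add_const_right _ _ tendsto_natCast_atTop_atTop)
      simpa using (h1.mono_left h𝒰).const_sub 1
    have hev := ((hb.mul hfac).mul_const (r : ℝ)).eventually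
      (lt_mem_nhds (by rwa [mul_one] : Real.log 2 < b * 1 * r))
    filter_upwards [hev, h𝒰 (eventually_ge_atTop r)] with k hk hrk
    refine (hJ k).exists_three_children (hadm k) (hne k) (defect_pos k).le
      (by linarith [defect_le k]) (hF k r hr1 (by omega)) ?_
    rw [growth, ← Real.exp_nat_mul, Real.rpow_def_of_pos (by norm_num)]
    refine Real.exp_lt_exp.2 ?_
    have := mul_lt_mul_of_pos_right hk (defect_pos k)
    linarith
  · choose c' d' hcd hJcd using fun k => (hJ k).exists_eq_Ioo (hne k)
    have hE0 : Tendsto (fun k => 2 * √(2 * (4 * defect k * 2 ^ (k + 1)))) 𝒰 (𝓝 0) := by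
      have h1 := ((tendsto_two_pow_mul_defect.mono_left h𝒰).const_mul 8)
      have h2 := ((Real.continuous_sqrt.tendsto _).comp h1).const_mul 2
      rw [mul_zero, Real.sqrt_zero, mul_zero] at h2
      refine h2.congr fun k => ?_
      simp only [Function.comp_apply]
      congr 2; ring
    refine H.false_of_tendsto_pos h𝒰 ha hcd (N := N) (fun k => hJcd k ▸ hJ k) hE0 (fun k => ?_) hν
      hϑ0 (by simp_rw [← hJcd]; exact hϑ)
    rw [← hJcd]
    exact (hJ k).sum_abs_ratio_sub_le (hadm k) (hne k) (defect_pos k).le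
      (by linarith [defect_le k]) (one_le_growth k (hhα k).le) (hF k (k + 1) (by omega) le_rfl)

lemma aF_le : aF ≤ 1 / 4 := by
  have hbdd : BddBelow {a ∈ Icc (-2 : ℝ) (1 / 4) | h a = 0} := ⟨-2, fun a ha => ha.1.1⟩
  rw [aF]
  rcases {a ∈ Icc (-2 : ℝ) (1 / 4) | h a = 0}.eq_empty_or_nonempty with h0 | ⟨a, ha⟩
  · rw [h0, Real.sInf_empty]; norm_num
  · exact (csInf_le hbdd ha).trans ha.1.2

lemma h_pos_of_lt_aF (ha : -2 ≤ a) (haF : a < aF) : 0 < h a := by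
  have ha' : a ≤ 1 / 4 := haF.le.trans aF_le
  refine lt_of_le_of_ne (h_nonneg ha ha') fun h0 => ?_
  exact haF.not_ge (csInf_le ⟨-2, fun a ha => ha.1.1⟩ ⟨⟨ha, ha'⟩, h0.symm⟩)

end

end QuadraticFamily

/-- Proposition (uniform entropy gap): for every `ε > 0` there is `δ > 0` such that, for
all `a ∈ [-2+ε, a_F−ε]`, if `μ` is an acip for `f_a`, then
`h(a) > (1+δ)·∫ log|f_a'| dμ`. -/
theorem uniform_entropy_acip_exponent_gap (ε : ℝ) (hε : 0 < ε) :
    ∃ δ : ℝ, 0 < δ ∧ ∀ a ∈ Set.Icc (-2 + ε) (aF - ε),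
      ∀ μ : Measure ℝ, IsAcip a μ →
        Integrable (fun x => Real.log |deriv (fa a) x|) μ →
        (1 + δ) * ∫ x, Real.log |deriv (fa a) x| ∂μ < h a := by
  by_contra! hcon
  choose! α hα μ hμ hi hle using fun k => hcon (QuadraticFamily.margin k) (QuadraticFamily.margin_pos k)
  have haF := QuadraticFamily.aF_le
  have hα2 : ∀ k, -2 ≤ α k ∧ α k ≤ 1 / 4 := fun k =>
    ⟨by linarith [(hα k).1], by linarith [(hα k).2]⟩
  have hpos : ∀ k, 0 < h (α k) := fun k => QuadraticFamily.h_pos_of_lt_aF (hα2 k).1 (by linarith [(hα k).2])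
  choose N J hJ hne hF using fun k =>
    QuadraticFamily.exists_lap_not_contracts (hα2 k).1 (hα2 k).2 (hpos k) (hμ k) (hi k) (hle k)
  obtain ⟨a, ha, hlim⟩ := (isCompact_Icc (a := -2 + ε) (b := aF - ε)).ultrafilter_le_nhds
    ((hyperfilter ℕ).map α) (le_principal_iff.2 (mem_map.2 (Eventually.of_forall hα)))
  exact QuadraticFamily.false_of_laps_not_contract (𝒰 := hyperfilter ℕ) Nat.hyperfilter_le_atTop hα2 hpos hlim
    (by linarith [ha.1]) (by linarith [ha.2]) (QuadraticFamily.h_pos_of_lt_aF (by linarith [ha.1])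
    (by linarith [ha.2])) hJ hne hF
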